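/- For every γ > 0, the Lyapunov exponent function A ↦ L(A) is continuous on the set FB^γ(Σ) := {A ∈ C^γ(Σ, SL₂(ℝ)) : A is γ-fiber bunched} with respect to the C^γ topology. (Backes–Brown–Butler continuity theorem for fiber-bunched cocycles.) -/

import Mathlib

open MeasureTheory

noncomputable section

abbrev Mat2 : Type := Matrix (Fin 2) (Fin 2) ℝ
abbrev SL2 : Type := Matrix.SpecialLinearGroup (Fin 2) ℝ
abbrev E2 : Type := EuclideanSpace ℝ (Fin 2)
abbrev Pone : Type := Projectivization ℝ E2

instance : TopologicalSpace SL2 :=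
  inferInstanceAs (TopologicalSpace { A : Mat2 // A.det = 1 })

/-- The operator norm of a 2×2 real matrix, acting on Euclidean ℝ². -/
def opNorm (M : Mat2) : ℝ := ‖Matrix.toEuclideanCLM (𝕜 := ℝ) M‖

/-- The continuous linear map on Euclidean ℝ² induced by a matrix in SL₂(ℝ). -/
def toEuc (g : SL2) : E2 →L[ℝ] E2 := Matrix.toEuclideanCLM (𝕜 := ℝ) (g : Mat2)

lemma toEuc_injective (g : SL2) : Function.Injective (toEuc g) := by
  intro x y hxy
  have key : ∀ z, toEuc g⁻¹ (toEuc g z) = z := by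
    intro z
    have h1 : ((g⁻¹ : SL2) : Mat2) * (g : Mat2) = 1 := by
      rw [← Matrix.SpecialLinearGroup.coe_mul, inv_mul_cancel,
        Matrix.SpecialLinearGroup.coe_one]
    calc toEuc g⁻¹ (toEuc g z)
        = (Matrix.toEuclideanCLM (𝕜 := ℝ) (((g⁻¹ : SL2) : Mat2) * (g : Mat2))) z := by
          rw [map_mul]; rfl
      _ = z := by rw [h1, map_one]; rfl
  have := congrArg (toEuc g⁻¹) hxy
  rwa [key, key] at this

/-- The projective action of SL₂(ℝ) on the real projective line ℙ¹. -/
def pact (g : SL2) : Pone → Pone :=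
  Projectivization.map (toEuc g).toLinearMap (toEuc_injective g)

instance : MeasurableSpace Pone :=
  inferInstanceAs (MeasurableSpace (Quotient (projectivizationSetoid ℝ E2)))

instance : TopologicalSpace Pone :=
  inferInstanceAs (TopologicalSpace (Quotient (projectivizationSetoid ℝ E2)))

/-- The space `Σ = {1,…,κ}^ℤ` of bilateral sequences in `κ` symbols. -/
abbrev Sig (κ : ℕ) : Type := ℤ → Fin κ

/-- The left shift map `σ((x_n)_n) = (x_{n+1})_n`. -/
def shift {κ : ℕ} (x : Sig κ) : Sig κ := fun n => x (n + 1)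

/-- The cocycle iterates: `A^n(x) = A(σ^{n-1}x) ⋯ A(σ x) A(x)`. -/
def cocycleN {κ : ℕ} (A : Sig κ → SL2) : ℕ → Sig κ → SL2
  | 0, _ => 1
  | n + 1, x => cocycleN A n (shift x) * A x

/-- `μ` is the Bernoulli measure `p^ℤ` on `Σ`: a probability measure giving each
cylinder its product measure. -/
def IsBernoulli {κ : ℕ} (p : Fin κ → ℝ) (μ : Measure (Sig κ)) : Prop :=
  IsProbabilityMeasure μ ∧
    ∀ (s : Finset ℤ) (a : ℤ → Fin κ),
      μ {x | ∀ n ∈ s, x n = a n} = ∏ n ∈ s, ENNReal.ofReal (p (a n))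

/-- The Lyapunov exponent `L(A) = inf_{n ≥ 1} (1/n) ∫_Σ log‖A^n(x)‖ dμ(x)`. -/
def lyap {κ : ℕ} (μ : Measure (Sig κ)) (A : Sig κ → SL2) : ℝ :=
  ⨅ n : {m : ℕ // 0 < m},
    (((n : ℕ) : ℝ))⁻¹ * ∫ x, Real.log (opNorm ((cocycleN A (n : ℕ) x : SL2) : Mat2)) ∂μ

/-- The first position (in absolute value) at which two sequences differ. -/
def firstDiff {κ : ℕ} (x y : Sig κ) : ℕ :=
  sInf {m : ℕ | x (m : ℤ) ≠ y (m : ℤ) ∨ x (-(m : ℤ)) ≠ y (-(m : ℤ))}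

open Classical in
/-- The distance `d(x,y) = ζ^{-N(x,y)}` on `Σ`. -/
def dSig {κ : ℕ} (ζ : ℝ) (x y : Sig κ) : ℝ :=
  if x = y then 0 else ζ ^ (-(firstDiff x y : ℤ))

/-- `A` is a cocycle with finite γ-Hölder seminorm w.r.t. the metric `dSig ζ`,
i.e. `A ∈ C^γ(Σ, SL₂(ℝ))`. -/
def HolderCocycle {κ : ℕ} (ζ γ : ℝ) (A : Sig κ → SL2) : Prop :=
  ∃ H : ℝ, ∀ x y : Sig κ, x ≠ y →
    opNorm ((A x : Mat2) - (A y : Mat2)) ≤ H * (dSig ζ x y) ^ γ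

/-- `‖A − B‖_{C^γ} < ε`: there are a bound on the sup distance and a bound on the
γ-Hölder seminorm of the difference, summing to less than `ε`. -/
def CgammaClose {κ : ℕ} (ζ γ : ℝ) (A B : Sig κ → SL2) (ε : ℝ) : Prop :=
  ∃ C₁ C₂ : ℝ, C₁ + C₂ < ε ∧
    (∀ x, opNorm ((A x : Mat2) - (B x : Mat2)) ≤ C₁) ∧
    (∀ x y : Sig κ, x ≠ y →
      opNorm (((A x : Mat2) - (B x : Mat2)) - ((A y : Mat2) - (B y : Mat2)))
        ≤ C₂ * (dSig ζ x y) ^ γ)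

/-- `A` is γ-fiber bunched: for some `n ≥ 1`, `sup_{x ∈ Σ} ‖A^n(x)‖² < ζ^{nγ}`. -/
def FiberBunched {κ : ℕ} (ζ γ : ℝ) (A : Sig κ → SL2) : Prop :=
  ∃ n : ℕ, 0 < n ∧ ∃ c : ℝ, c < ζ ^ ((n : ℝ) * γ) ∧
    ∀ x : Sig κ, (opNorm ((cocycleN A n x : SL2) : Mat2)) ^ 2 ≤ c

/-! ### Part 1: linear algebra -/

/-- the area form -/
def wdg (u v : E2) : ℝ := u 0 * v 1 - u 1 * v 0

lemma E2_norm_sq (u : E2) : ‖u‖ ^ 2 = u 0 ^ 2 + u 1 ^ 2 := by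
  rw [EuclideanSpace.norm_sq_eq]; simp [Fin.sum_univ_two]

lemma toEuc_apply (g : SL2) (u : E2) (i : Fin 2) :
    toEuc g u i = g.1 i 0 * u 0 + g.1 i 1 * u 1 := by
  unfold toEuc
  rw [Matrix.ofLp_toEuclideanCLM]
  simp [Matrix.mulVec, dotProduct, Fin.sum_univ_two]

lemma toEuc_mul (g h : SL2) : toEuc (g * h) = toEuc g * toEuc h := by
  simp [toEuc]

lemma toEuc_one : toEuc 1 = 1 := by
  simp [toEuc]

lemma toEuc_mul_apply (g h : SL2) (u : E2) : toEuc (g * h) u = toEuc g (toEuc h u) := by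
  rw [toEuc_mul]; rfl

lemma wdg_toEuc (g : SL2) (u v : E2) : wdg (toEuc g u) (toEuc g v) = wdg u v := by
  have h := g.2
  rw [Matrix.det_fin_two] at h
  simp only [wdg, toEuc_apply]
  linear_combination (u 0 * v 1 - u 1 * v 0) * h

lemma abs_wdg_le (u v : E2) : |wdg u v| ≤ ‖u‖ * ‖v‖ := by
  refine abs_le_of_sq_le_sq ?_ (by positivity)
  rw [mul_pow, E2_norm_sq, E2_norm_sq, wdg]
  nlinarith [sq_nonneg (u 0 * v 0 + u 1 * v 1)]

/-- nonzero vectors -/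
abbrev Q : Type := {u : E2 // u ≠ 0}

lemma Q_norm_pos (u : Q) : 0 < ‖u.1‖ := norm_pos_iff.mpr u.2

/-- action on nonzero vectors -/
def act (g : SL2) (u : Q) : Q := ⟨toEuc g u.1, fun h => u.2 (toEuc_injective g (by simpa using h))⟩

lemma act_mul (g h : SL2) (u : Q) : act (g * h) u = act g (act h u) :=
  Subtype.ext (toEuc_mul_apply g h u.1)

lemma act_one (u : Q) : act 1 u = u := Subtype.ext (by simp [act, toEuc_one])

lemma act_inv_act (g : SL2) (u : Q) : act g⁻¹ (act g u) = u := by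
  rw [← act_mul, inv_mul_cancel, act_one]

lemma act_act_inv (g : SL2) (u : Q) : act g (act g⁻¹ u) = u := by
  rw [← act_mul, mul_inv_cancel, act_one]

/-- projective distance -/
def dd (u v : Q) : ℝ := |wdg u.1 v.1| / (‖u.1‖ * ‖v.1‖)

lemma dd_mul (u v : Q) : dd u v * (‖u.1‖ * ‖v.1‖) = |wdg u.1 v.1| := by
  have := Q_norm_pos u; have := Q_norm_pos v
  unfold dd; field_simp

lemma dd_nonneg (u v : Q) : 0 ≤ dd u v := by unfold dd; positivity

lemma dd_le_one (u v : Q) : dd u v ≤ 1 := by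
  have h1 := Q_norm_pos u; have h2 := Q_norm_pos v
  exact (div_le_one (by positivity)).mpr (abs_wdg_le _ _)

lemma dd_self (u : Q) : dd u u = 0 := by simp [dd, wdg, mul_comm]

lemma dd_comm (u v : Q) : dd u v = dd v u := by
  unfold dd
  rw [mul_comm ‖u.1‖, show wdg u.1 v.1 = - wdg v.1 u.1 by unfold wdg; ring, abs_neg]

lemma wdg_triangle (u v w : E2) :
    |wdg u w| * ‖v‖ ≤ |wdg u v| * ‖w‖ + |wdg v w| * ‖u‖ := by
  have h : (wdg u w) • v = (wdg u v) • w + (wdg v w) • u := by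
    ext i
    fin_cases i <;> simp [wdg] <;> ring
  calc |wdg u w| * ‖v‖ = ‖(wdg u w) • v‖ := by rw [norm_smul, Real.norm_eq_abs]
    _ = ‖(wdg u v) • w + (wdg v w) • u‖ := by rw [h]
    _ ≤ ‖(wdg u v) • w‖ + ‖(wdg v w) • u‖ := norm_add_le _ _
    _ = _ := by simp [norm_smul]

lemma dd_triangle (u v w : Q) : dd u w ≤ dd u v + dd v w := by
  have h1 := Q_norm_pos u; have h2 := Q_norm_pos v; have h3 := Q_norm_pos w
  have h := wdg_triangle u.1 v.1 w.1
  unfold dd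
  rw [div_add_div _ _ (by positivity) (by positivity), div_le_div_iff₀ (by positivity) (by positivity)]
  have := mul_le_mul_of_nonneg_left h (show 0 ≤ ‖u.1‖ * ‖v.1‖ * ‖w.1‖ by positivity)
  nlinarith

lemma abs_dd_sub_le (u v w : Q) : |dd u w - dd v w| ≤ dd u v := by
  rw [abs_le]
  have h1 := dd_triangle u v w
  have h2 := dd_triangle v u w
  rw [dd_comm v u] at h2
  constructor <;> linarith

/-- the norm -/
def nm (g : SL2) : ℝ := ‖toEuc g‖

lemma norm_act_le (g : SL2) (u : Q) : ‖(act g u).1‖ ≤ nm g * ‖u.1‖ :=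
  (toEuc g).le_opNorm u.1

lemma nm_nonneg (g : SL2) : 0 ≤ nm g := norm_nonneg _

lemma nm_mul (g h : SL2) : nm (g * h) ≤ nm g * nm h := by
  unfold nm; rw [toEuc_mul]; exact norm_mul_le _ _

lemma nm_one : nm 1 = 1 := by
  unfold nm; rw [toEuc_one]; exact norm_one

/-- rotation by a quarter turn -/
def Jr (v : E2) : E2 := !₂[- v 1, v 0]

lemma norm_Jr (v : E2) : ‖Jr v‖ = ‖v‖ := by
  have : ‖Jr v‖ ^ 2 = ‖v‖ ^ 2 := by
    rw [E2_norm_sq, E2_norm_sq]; simp [Jr]; ring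
  exact (sq_eq_sq₀ (norm_nonneg _) (norm_nonneg _)).mp this

lemma wdg_Jr (v : E2) : wdg v (Jr v) = ‖v‖ ^ 2 := by
  rw [E2_norm_sq]; simp [wdg, Jr]; ring

lemma nm_inv_le (g : SL2) : nm g⁻¹ ≤ nm g := by
  refine ContinuousLinearMap.opNorm_le_bound _ (nm_nonneg g) (fun x => ?_)
  set v := toEuc g⁻¹ x with hv
  have hx : toEuc g v = x := by
    rw [hv, ← toEuc_mul_apply, mul_inv_cancel, toEuc_one]; rfl
  have h1 : ‖v‖ ^ 2 ≤ ‖x‖ * (nm g * ‖v‖) := by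
    rw [← wdg_Jr, ← wdg_toEuc g, hx]
    refine (le_abs_self _).trans ((abs_wdg_le _ _).trans ?_)
    have := (toEuc g).le_opNorm (Jr v)
    rw [norm_Jr] at this
    exact mul_le_mul_of_nonneg_left this (norm_nonneg _)
  rcases eq_or_lt_of_le (norm_nonneg v) with h0 | h0
  · rw [← h0]; exact mul_nonneg (nm_nonneg g) (norm_nonneg _)
  · nlinarith

lemma nm_inv (g : SL2) : nm g⁻¹ = nm g :=
  le_antisymm (nm_inv_le g) (by simpa using nm_inv_le g⁻¹)

lemma one_le_nm (g : SL2) : 1 ≤ nm g := by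
  have h : nm (g * g⁻¹) ≤ nm g * nm g⁻¹ := nm_mul _ _
  rw [mul_inv_cancel, nm_one, nm_inv] at h
  nlinarith [nm_nonneg g]

lemma nm_pos (g : SL2) : 0 < nm g := lt_of_lt_of_le one_pos (one_le_nm g)

lemma norm_act_ge (g : SL2) (u : Q) : ‖u.1‖ ≤ nm g * ‖(act g u).1‖ := by
  have := norm_act_le g⁻¹ (act g u)
  rwa [act_inv_act, nm_inv] at this

lemma dd_act (g : SL2) (u v : Q) :
    dd (act g u) (act g v) * (‖(act g u).1‖ * ‖(act g v).1‖) = dd u v * (‖u.1‖ * ‖v.1‖) := by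
  rw [dd_mul, dd_mul]; simp only [act, wdg_toEuc]

lemma dd_act_le (g : SL2) (u v : Q) : dd (act g u) (act g v) ≤ nm g ^ 2 * dd u v := by
  have h := dd_act g u v
  have h1 := norm_act_ge g u
  have h2 := norm_act_ge g v
  have h3 := Q_norm_pos (act g u)
  have h4 := Q_norm_pos (act g v)
  have h5 := Q_norm_pos u
  have h6 := Q_norm_pos v
  have h7 : ‖u.1‖ * ‖v.1‖ ≤ (nm g * ‖(act g u).1‖) * (nm g * ‖(act g v).1‖) :=
    mul_le_mul h1 h2 h6.le (mul_nonneg (nm_nonneg _) h3.le)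
  have h8 := mul_le_mul_of_nonneg_left h7 (dd_nonneg u v)
  rw [← h] at h8
  have h9 : 0 < ‖(act g u).1‖ * ‖(act g v).1‖ := by positivity
  refine le_of_mul_le_mul_right ?_ h9
  linarith

lemma dd_le_act (g : SL2) (u v : Q) : dd u v ≤ nm g ^ 2 * dd (act g u) (act g v) := by
  have := dd_act_le g⁻¹ (act g u) (act g v)
  rwa [act_inv_act, act_inv_act, nm_inv] at this

/-- logarithmic expansion -/
def phi (g : SL2) (u : Q) : ℝ := Real.log (‖(act g u).1‖ / ‖u.1‖)

lemma exp_phi (g : SL2) (u : Q) : Real.exp (phi g u) = ‖(act g u).1‖ / ‖u.1‖ :=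
  Real.exp_log (div_pos (Q_norm_pos _) (Q_norm_pos _))

lemma exp_phi_mul (g : SL2) (u : Q) : Real.exp (phi g u) * ‖u.1‖ = ‖(act g u).1‖ := by
  rw [exp_phi]; have := Q_norm_pos u; field_simp

lemma phi_le (g : SL2) (u : Q) : phi g u ≤ Real.log (nm g) := by
  apply Real.log_le_log (div_pos (Q_norm_pos _) (Q_norm_pos _))
  rw [div_le_iff₀ (Q_norm_pos _)]; exact norm_act_le g u

lemma neg_le_phi (g : SL2) (u : Q) : - Real.log (nm g) ≤ phi g u := by
  rw [← Real.log_inv]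
  apply Real.log_le_log (inv_pos.mpr (nm_pos g))
  rw [le_div_iff₀ (Q_norm_pos _), inv_mul_le_iff₀ (nm_pos g)]
  exact norm_act_ge g u

lemma abs_phi_le (g : SL2) (u : Q) : |phi g u| ≤ Real.log (nm g) :=
  abs_le.mpr ⟨neg_le_phi g u, phi_le g u⟩

lemma phi_mul (g h : SL2) (u : Q) : phi (g * h) u = phi h u + phi g (act h u) := by
  unfold phi
  rw [act_mul]
  have h1 := Q_norm_pos u; have h2 := Q_norm_pos (act h u)
  have h3 := Q_norm_pos (act g (act h u))
  rw [Real.log_div h3.ne' h1.ne', Real.log_div h2.ne' h1.ne', Real.log_div h3.ne' h2.ne']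
  ring

lemma phi_one (u : Q) : phi 1 u = 0 := by
  unfold phi; rw [act_one, div_self (Q_norm_pos u).ne', Real.log_one]

lemma dd_act_exp (g : SL2) (u v : Q) :
    dd (act g u) (act g v) = dd u v * Real.exp (- phi g u - phi g v) := by
  have h := dd_act g u v
  rw [← exp_phi_mul, ← exp_phi_mul] at h
  have h5 := Q_norm_pos u
  have h6 := Q_norm_pos v
  rw [sub_eq_add_neg, Real.exp_add, Real.exp_neg, Real.exp_neg]
  have := Real.exp_pos (phi g u)
  have := Real.exp_pos (phi g v)
  field_simp
  have h9 : 0 < ‖u.1‖ * ‖v.1‖ := by positivity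
  refine mul_right_cancel₀ h9.ne' ?_
  linarith

lemma ratio_lip (T : E2 →L[ℝ] E2) (u v : Q) :
    ‖T u.1‖ / ‖u.1‖ ≤ ‖T v.1‖ / ‖v.1‖ + ‖T‖ * dd u v := by
  have h5 := Q_norm_pos u
  have h6 := Q_norm_pos v
  set c : ℝ := u.1 0 * v.1 0 + u.1 1 * v.1 1 with hc
  have hdec : (‖v.1‖ ^ 2) • u.1 = c • v.1 + (wdg v.1 u.1) • Jr v.1 := by
    rw [E2_norm_sq]
    ext i
    fin_cases i <;> simp [wdg, Jr, hc] <;> ring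
  have hcle : |c| ≤ ‖u.1‖ * ‖v.1‖ := by
    refine abs_le_of_sq_le_sq ?_ (by positivity)
    rw [mul_pow, E2_norm_sq, E2_norm_sq, hc]
    nlinarith [sq_nonneg (u.1 0 * v.1 1 - u.1 1 * v.1 0)]
  have h1 : ‖v.1‖ ^ 2 * ‖T u.1‖ ≤ (‖u.1‖ * ‖v.1‖) * ‖T v.1‖ + |wdg u.1 v.1| * (‖T‖ * ‖v.1‖) := by
    have e1 : ‖v.1‖ ^ 2 * ‖T u.1‖ = ‖c • T v.1 + (wdg v.1 u.1) • T (Jr v.1)‖ := by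
      rw [← map_smul, ← map_smul, ← map_add, ← hdec, map_smul, norm_smul]
      simp
    rw [e1]
    refine (norm_add_le _ _).trans ?_
    rw [norm_smul, norm_smul, Real.norm_eq_abs, Real.norm_eq_abs]
    have e2 := T.le_opNorm (Jr v.1)
    rw [norm_Jr] at e2
    have e3 : |wdg v.1 u.1| = |wdg u.1 v.1| := by
      rw [show wdg v.1 u.1 = - wdg u.1 v.1 by unfold wdg; ring, abs_neg]
    rw [e3]
    exact add_le_add (mul_le_mul_of_nonneg_right hcle (norm_nonneg _))
      (mul_le_mul_of_nonneg_left e2 (abs_nonneg _))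
  rw [← dd_mul] at h1
  rw [div_add' _ _ _ h6.ne', div_le_div_iff₀ h5 h6]
  refine le_of_mul_le_mul_right ?_ h6
  nlinarith

lemma phi_sub_le (g : SL2) (u v : Q) : phi g u - phi g v ≤ nm g ^ 2 * dd u v := by
  have h1 := ratio_lip (toEuc g) u v
  have hv : 0 < ‖(act g v).1‖ / ‖v.1‖ := div_pos (Q_norm_pos _) (Q_norm_pos _)
  have hu : 0 < ‖(act g u).1‖ / ‖u.1‖ := div_pos (Q_norm_pos _) (Q_norm_pos _)
  have h1' : ‖(act g u).1‖ / ‖u.1‖ ≤ ‖(act g v).1‖ / ‖v.1‖ + nm g * dd u v := h1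
  unfold phi
  rw [← Real.log_div hu.ne' hv.ne']
  refine (Real.log_le_sub_one_of_pos (div_pos hu hv)).trans ?_
  rw [sub_le_iff_le_add, div_le_iff₀ hv]
  have h3 : 1 ≤ nm g * (‖(act g v).1‖ / ‖v.1‖) := by
    rw [← mul_div_assoc, le_div_iff₀ (Q_norm_pos _), one_mul]; exact norm_act_ge g v
  have h4 := mul_le_mul_of_nonneg_left h3 (mul_nonneg (nm_nonneg g) (dd_nonneg u v))
  nlinarith

lemma abs_phi_sub_le (g : SL2) (u v : Q) : |phi g u - phi g v| ≤ nm g ^ 2 * dd u v := by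
  rw [abs_le]
  have h1 := phi_sub_le g u v
  have h2 := phi_sub_le g v u
  rw [dd_comm] at h2
  constructor <;> linarith

/-- distance of matrices -/
def gd (g h : SL2) : ℝ := ‖toEuc g - toEuc h‖

lemma gd_nonneg (g h : SL2) : 0 ≤ gd g h := norm_nonneg _

lemma gd_comm (g h : SL2) : gd g h = gd h g := norm_sub_rev _ _

lemma gd_apply (g h : SL2) (u : Q) : ‖(act g u).1 - (act h u).1‖ ≤ gd g h * ‖u.1‖ := by
  exact (toEuc g - toEuc h).le_opNorm u.1

lemma dd_act_act_le (g h : SL2) (u : Q) : dd (act g u) (act h u) ≤ gd g h * nm h := by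
  have h1 := Q_norm_pos (act g u)
  have h2 := Q_norm_pos (act h u)
  unfold dd
  rw [div_le_iff₀ (by positivity)]
  have e : wdg (act g u).1 (act h u).1 = wdg (act g u).1 ((act h u).1 - (act g u).1) := by
    simp [wdg]; ring
  rw [e]
  refine (abs_wdg_le _ _).trans ?_
  have h3 := gd_apply g h u
  rw [norm_sub_rev] at h3
  have h4 := norm_act_ge h u
  have h5 : ‖(act h u).1 - (act g u).1‖ ≤ gd g h * (nm h * ‖(act h u).1‖) :=
    h3.trans (mul_le_mul_of_nonneg_left h4 (gd_nonneg _ _))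
  have := mul_le_mul_of_nonneg_left h5 h1.le
  linarith

lemma phi_sub_gd_le (g h : SL2) (u : Q) : phi g u - phi h u ≤ gd g h * nm h := by
  have hv : 0 < ‖(act h u).1‖ / ‖u.1‖ := div_pos (Q_norm_pos _) (Q_norm_pos _)
  have hu : 0 < ‖(act g u).1‖ / ‖u.1‖ := div_pos (Q_norm_pos _) (Q_norm_pos _)
  unfold phi
  rw [← Real.log_div hu.ne' hv.ne']
  refine (Real.log_le_sub_one_of_pos (div_pos hu hv)).trans ?_
  have h1 := Q_norm_pos (act g u)
  have h2 := Q_norm_pos (act h u)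
  have h3 := Q_norm_pos u
  have e : ‖(act g u).1‖ / ‖u.1‖ / (‖(act h u).1‖ / ‖u.1‖) = ‖(act g u).1‖ / ‖(act h u).1‖ := by
    field_simp
  rw [e, sub_le_iff_le_add, div_le_iff₀ h2]
  have h4 := gd_apply g h u
  have h5 := norm_sub_norm_le (act g u).1 (act h u).1
  have h6 := mul_le_mul_of_nonneg_left (norm_act_ge h u) (gd_nonneg g h)
  linarith

lemma dd_one_le (g h : SL2) (u : Q) : dd (act g u) (act h u) ≤ ‖toEuc (h * g⁻¹) - 1‖ := by
  have h1 := dd_act_act_le (h * g⁻¹) 1 (act g u)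
  rw [act_one, nm_one, ← act_mul, inv_mul_cancel_right, mul_one] at h1
  rw [dd_comm]
  refine h1.trans (le_of_eq ?_)
  rw [gd, toEuc_one]

/-- basis vectors -/
def eb (i : Fin 2) : Q := ⟨EuclideanSpace.single i 1, by simp⟩

lemma eb_norm (i : Fin 2) : ‖(eb i).1‖ = 1 := by simp [eb]

lemma exists_basis_big (g : SL2) : ∃ i, nm g ≤ 2 * ‖(act g (eb i)).1‖ := by
  by_contra hcon
  push Not at hcon
  have h0 := hcon 0
  have h1 := hcon 1
  set m := max ‖(act g (eb 0)).1‖ ‖(act g (eb 1)).1‖ with hm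
  have hb : nm g ≤ 2 * m := by
    refine ContinuousLinearMap.opNorm_le_bound _ (by positivity) (fun x => ?_)
    have hx : x = x 0 • (eb 0).1 + x 1 • (eb 1).1 := by
      ext i; fin_cases i <;> simp [eb]
    have e : ∀ i, |x i| ≤ ‖x‖ := fun i => by
      rw [← Real.norm_eq_abs]; exact PiLp.norm_apply_le x i
    conv_lhs => rw [hx, map_add, map_smul, map_smul]
    refine (norm_add_le _ _).trans ?_
    rw [norm_smul, norm_smul, Real.norm_eq_abs, Real.norm_eq_abs]
    have a0 : |x 0| * ‖toEuc g (eb 0).1‖ ≤ ‖x‖ * m :=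
      mul_le_mul (e 0) (le_max_left _ _) (norm_nonneg _) (norm_nonneg _)
    have a1 : |x 1| * ‖toEuc g (eb 1).1‖ ≤ ‖x‖ * m :=
      mul_le_mul (e 1) (le_max_right _ _) (norm_nonneg _) (norm_nonneg _)
    linarith
  rcases max_cases ‖(act g (eb 0)).1‖ ‖(act g (eb 1)).1‖ with h | h <;> linarith

/-- most contracted and most expanded directions -/
lemma exists_se (g : SL2) : ∃ s e : Q, (∀ u, nm g * dd u s * ‖u.1‖ ≤ 2 * ‖(act g u).1‖) ∧
    ∀ u, dd (act g u) e * dd u s * nm g ^ 2 ≤ 4 := by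
  obtain ⟨i, hi⟩ := exists_basis_big g⁻¹
  obtain ⟨k, hk⟩ := exists_basis_big g
  rw [nm_inv] at hi
  have key : ∀ u, nm g * dd u (act g⁻¹ (eb i)) * ‖u.1‖ ≤ 2 * ‖(act g u).1‖ := by
    intro u
    have h1 := dd_act g u (act g⁻¹ (eb i))
    rw [act_act_inv, eb_norm] at h1
    have h2 := dd_le_one (act g u) (eb i)
    have h3 := mul_le_mul_of_nonneg_left hi
      (mul_nonneg (dd_nonneg u (act g⁻¹ (eb i))) (norm_nonneg u.1))
    have h4 := mul_le_mul_of_nonneg_right h2 (norm_nonneg (act g u).1)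
    nlinarith
  refine ⟨act g⁻¹ (eb i), act g (eb k), ?_, ?_⟩
  · exact key
  · intro u
    have h0 := key u
    have h1 := dd_act g u (eb k)
    rw [eb_norm] at h1
    have h2 := dd_le_one u (eb k)
    have hu := Q_norm_pos u
    have hg := Q_norm_pos (act g u)
    set d1 := dd (act g u) (act g (eb k))
    set d2 := dd u (act g⁻¹ (eb i))
    have hd1 : 0 ≤ d1 := dd_nonneg _ _
    have hd2 : 0 ≤ d2 := dd_nonneg _ _
    have h3 : d1 * ‖(act g u).1‖ * nm g ≤ 2 * ‖u.1‖ := by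
      have := mul_le_mul_of_nonneg_left hk (mul_nonneg hd1 hg.le)
      have := mul_le_mul_of_nonneg_right h2 hu.le
      nlinarith
    have h5 := mul_le_mul h3 h0 (by have := nm_pos g; positivity) (by positivity)
    have h6 : 0 < ‖u.1‖ * ‖(act g u).1‖ := by positivity
    refine le_of_mul_le_mul_right ?_ h6
    nlinarith

/-! grid -/
/-- grid points -/
def gp (M l : ℕ) : Q := ⟨!₂[(1 : ℝ), (l : ℝ) / M], fun h => by
  have := congrArg (fun v : E2 => v 0) h
  simp at this⟩

/-- grid average -/
def gav (M : ℕ) (f : Q → ℝ) : ℝ := (M : ℝ)⁻¹ * ∑ l ∈ Finset.range M, f (gp M l)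

lemma gp_norm (M l : ℕ) (hl : l ≤ M) : ‖(gp M l).1‖ ^ 2 ≤ 2 := by
  rw [E2_norm_sq]
  have : (l : ℝ) / M ≤ 1 := div_le_one_of_le₀ (by exact_mod_cast hl) (by positivity)
  have h0 : 0 ≤ (l : ℝ) / M := by positivity
  simp [gp]
  nlinarith

lemma gp_dd (M l m : ℕ) (hM : 0 < M) (hl : l ≤ M) (hm : m ≤ M) :
    |(l : ℝ) - m| ≤ 2 * M * dd (gp M l) (gp M m) := by
  have hM' : (0 : ℝ) < M := by exact_mod_cast hM
  have h := dd_mul (gp M l) (gp M m)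
  have e : |wdg (gp M l).1 (gp M m).1| = |(l : ℝ) - m| / M := by
    rw [abs_sub_comm]
    have : wdg (gp M l).1 (gp M m).1 = ((m : ℝ) - l) / M := by simp [wdg, gp]; ring
    rw [this, abs_div, abs_of_pos hM']
  rw [e] at h
  have h1 := gp_norm M l hl
  have h2 := gp_norm M m hm
  have h3 : ‖(gp M l).1‖ * ‖(gp M m).1‖ ≤ 2 := by
    nlinarith [sq_nonneg (‖(gp M l).1‖ - ‖(gp M m).1‖)]
  have h4 := mul_le_mul_of_nonneg_left h3 (dd_nonneg (gp M l) (gp M m))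
  rw [h, div_le_iff₀ hM'] at h4
  linarith

lemma card_near (S : Finset ℕ) (D : ℝ) (h : ∀ l ∈ S, ∀ m ∈ S, |(l : ℝ) - m| ≤ D)
    (hD : 0 ≤ D) : (S.card : ℝ) ≤ D + 1 := by
  rcases S.eq_empty_or_nonempty with rfl | hne
  · simp; linarith
  · have hsub : S ⊆ Finset.Icc (S.min' hne) (S.max' hne) := fun x hx =>
      Finset.mem_Icc.mpr ⟨S.min'_le x hx, S.le_max' x hx⟩
    have hc := Finset.card_le_card hsub
    rw [Nat.card_Icc] at hc
    have hle : S.min' hne ≤ S.max' hne := S.min'_le _ (S.max'_mem hne)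
    have h1 := h _ (S.max'_mem hne) _ (S.min'_mem hne)
    have h2 : (S.card : ℝ) ≤ (S.max' hne : ℝ) + 1 - S.min' hne := by
      have : S.card + S.min' hne ≤ S.max' hne + 1 := by omega
      have : ((S.card + S.min' hne : ℕ) : ℝ) ≤ ((S.max' hne + 1 : ℕ) : ℝ) := by exact_mod_cast this
      push_cast at this; linarith
    have := le_abs_self ((S.max' hne : ℝ) - S.min' hne)
    linarith

open Classical in
lemma grid_bound (M : ℕ) (hM : 0 < M) (s : Q) (r : ℝ) (hr : 0 ≤ r) :
    gav M (fun u => if dd u s ≤ r then 1 else 0) ≤ 4 * r + (M : ℝ)⁻¹ := by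
  have hM' : (0 : ℝ) < M := by exact_mod_cast hM
  unfold gav
  rw [Finset.sum_ite, Finset.sum_const_zero, add_zero, Finset.sum_const, nsmul_eq_mul, mul_one]
  have := card_near ((Finset.range M).filter (fun l => dd (gp M l) s ≤ r)) (4 * r * M) (by
    intro l hl m hm
    simp only [Finset.mem_filter, Finset.mem_range] at hl hm
    refine (gp_dd M l m hM hl.1.le hm.1.le).trans ?_
    have h1 := dd_triangle (gp M l) s (gp M m)
    rw [dd_comm s] at h1
    have h2 : dd (gp M l) (gp M m) ≤ 2 * r := by linarith [hl.2, hm.2]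
    have := mul_le_mul_of_nonneg_left h2 (show (0:ℝ) ≤ 2 * M by positivity)
    linarith) (by positivity)
  rw [inv_mul_le_iff₀ hM']
  have e : (M : ℝ) * (4 * r + (M : ℝ)⁻¹) = 4 * r * M + 1 := by field_simp
  linarith

lemma gav_mono (M : ℕ) (f f' : Q → ℝ) (h : ∀ u, f u ≤ f' u) : gav M f ≤ gav M f' :=
  mul_le_mul_of_nonneg_left (Finset.sum_le_sum fun l _ => h _) (by positivity)

lemma gav_add (M : ℕ) (f f' : Q → ℝ) : gav M (fun u => f u + f' u) = gav M f + gav M f' := by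
  simp only [gav, Finset.sum_add_distrib, mul_add]

lemma gav_smul (M : ℕ) (c : ℝ) (f : Q → ℝ) : gav M (fun u => c * f u) = c * gav M f := by
  simp only [gav, ← Finset.mul_sum]; ring

lemma gav_const (M : ℕ) (hM : 0 < M) (c : ℝ) : gav M (fun _ => c) = c := by
  have hM' : (M : ℝ) ≠ 0 := by exact_mod_cast hM.ne'
  simp [gav]; field_simp

/-! ### Part 2: symbolic dynamics and the Markov operator -/

/-- one-sided sequences -/
abbrev Y (κ : ℕ) : Type := ℕ → Fin κ

/-- prepend a symbol -/
def scons {κ : ℕ} (i : Fin κ) (y : Y κ) : Y κ := fun n => Nat.casesOn n i y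

/-- shift by one -/
def ssh {κ : ℕ} (y : Y κ) : Y κ := fun n => y (n + 1)

/-- shift by n -/
def shn {κ : ℕ} (n : ℕ) (y : Y κ) : Y κ := fun m => y (m + n)

lemma ssh_scons {κ : ℕ} (i : Fin κ) (y : Y κ) : ssh (scons i y) = y := rfl

lemma scons_ssh {κ : ℕ} (y : Y κ) : scons (y 0) (ssh y) = y := by
  funext n; cases n <;> rfl

lemma shn_zero {κ : ℕ} (y : Y κ) : shn 0 y = y := rfl

lemma shn_one {κ : ℕ} (y : Y κ) : shn 1 y = ssh y := rfl

lemma shn_succ {κ : ℕ} (n : ℕ) (y : Y κ) : shn (n + 1) y = shn n (ssh y) := by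
  funext m; rfl

lemma shn_succ' {κ : ℕ} (n : ℕ) (y : Y κ) : shn (n + 1) y = ssh (shn n y) := by
  funext m; simp only [shn, ssh]; congr 1; omega

lemma shn_shn {κ : ℕ} (m n : ℕ) (y : Y κ) : shn m (shn n y) = shn (m + n) y := by
  funext k; simp only [shn]; congr 1; omega

/-- agreement on the first N coordinates -/
def Agree {κ : ℕ} (N : ℕ) (y y' : Y κ) : Prop := ∀ n < N, y n = y' n

lemma Agree.mono {κ : ℕ} {M N : ℕ} {y y' : Y κ} (h : Agree N y y') (hM : M ≤ N) : Agree M y y' :=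
  fun n hn => h n (hn.trans_le hM)

lemma Agree.symm {κ : ℕ} {N : ℕ} {y y' : Y κ} (h : Agree N y y') : Agree N y' y :=
  fun n hn => (h n hn).symm

lemma Agree.scons {κ : ℕ} {N : ℕ} {y y' : Y κ} (h : Agree N y y') (i : Fin κ) :
    Agree (N + 1) (scons i y) (scons i y') := by
  intro n hn
  cases n with
  | zero => rfl
  | succ n => exact h n (by omega)

lemma Agree.shn {κ : ℕ} {m N : ℕ} {y y' : Y κ} (h : Agree (m + N) y y') :
    Agree N (shn m y) (shn m y') := fun n hn => h _ (by omega)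

/-- probability vectors -/
structure PV {κ : ℕ} (p : Fin κ → ℝ) : Prop where
  pos : ∀ i, 0 < p i
  sum : ∑ i, p i = 1

/-- Markov operator iterates -/
def Pn {κ : ℕ} (p : Fin κ → ℝ) : ℕ → (Y κ → ℝ) → Y κ → ℝ
  | 0, F => F
  | n + 1, F => fun y => ∑ i, p i * Pn p n F (scons i y)

section Sym
variable {κ : ℕ} {p : Fin κ → ℝ}

lemma Pn_zero (F : Y κ → ℝ) : Pn p 0 F = F := rfl

lemma Pn_succ (n : ℕ) (F : Y κ → ℝ) (y : Y κ) :
    Pn p (n + 1) F y = ∑ i, p i * Pn p n F (scons i y) := rfl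

lemma Pn_one (F : Y κ → ℝ) (y : Y κ) : Pn p 1 F y = ∑ i, p i * F (scons i y) := rfl

lemma Pn_add (m n : ℕ) (F : Y κ → ℝ) : Pn p (m + n) F = Pn p m (Pn p n F) := by
  induction m with
  | zero => simp [Pn_zero]
  | succ m ih => funext y; rw [Nat.succ_add, Pn_succ, Pn_succ, ih]

lemma Pn_mono (hp : PV p) (n : ℕ) {F F' : Y κ → ℝ} (h : ∀ z, F z ≤ F' z) (y : Y κ) :
    Pn p n F y ≤ Pn p n F' y := by
  induction n generalizing y with
  | zero => exact h y
  | succ n ih =>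
    exact Finset.sum_le_sum fun i _ => mul_le_mul_of_nonneg_left (ih _) (hp.pos i).le

lemma Pn_const (hp : PV p) (n : ℕ) (c : ℝ) (y : Y κ) : Pn p n (fun _ => c) y = c := by
  induction n generalizing y with
  | zero => rfl
  | succ n ih => rw [Pn_succ]; simp only [ih]; rw [← Finset.sum_mul, hp.sum, one_mul]

lemma Pn_le (hp : PV p) (n : ℕ) {F : Y κ → ℝ} {c : ℝ} (h : ∀ z, F z ≤ c) (y : Y κ) :
    Pn p n F y ≤ c := (Pn_mono hp n h y).trans_eq (Pn_const hp n c y)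

lemma le_Pn (hp : PV p) (n : ℕ) {F : Y κ → ℝ} {c : ℝ} (h : ∀ z, c ≤ F z) (y : Y κ) :
    c ≤ Pn p n F y := (Pn_const hp n c y).symm.trans_le (Pn_mono hp n h y)

lemma Pn_add_fun (n : ℕ) (F F' : Y κ → ℝ) (y : Y κ) :
    Pn p n (fun z => F z + F' z) y = Pn p n F y + Pn p n F' y := by
  induction n generalizing y with
  | zero => rfl
  | succ n ih => simp only [Pn_succ, ih, mul_add, Finset.sum_add_distrib]

lemma Pn_smul (n : ℕ) (c : ℝ) (F : Y κ → ℝ) (y : Y κ) :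
    Pn p n (fun z => c * F z) y = c * Pn p n F y := by
  induction n generalizing y with
  | zero => rfl
  | succ n ih =>
    simp only [Pn_succ, ih, Finset.mul_sum]
    exact Finset.sum_congr rfl fun i _ => by ring

lemma Pn_neg (n : ℕ) (F : Y κ → ℝ) (y : Y κ) :
    Pn p n (fun z => - F z) y = - Pn p n F y := by
  have := Pn_smul (p := p) n (-1) F y
  simpa using this

lemma Pn_sub_fun (n : ℕ) (F F' : Y κ → ℝ) (y : Y κ) :
    Pn p n (fun z => F z - F' z) y = Pn p n F y - Pn p n F' y := by
  simp only [sub_eq_add_neg, Pn_add_fun, Pn_neg]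

lemma Pn_zero_fun (n : ℕ) (y : Y κ) : Pn p n (fun _ => 0) y = 0 := by
  have := Pn_smul (p := p) n 0 (fun _ => 0) y
  simpa using this

lemma Pn_sum {ι : Type*} (s : Finset ι) (n : ℕ) (F : ι → Y κ → ℝ) (y : Y κ) :
    Pn p n (fun z => ∑ a ∈ s, F a z) y = ∑ a ∈ s, Pn p n (F a) y := by
  classical
  induction s using Finset.induction_on with
  | empty => simp [Pn_zero_fun]
  | insert a s ha ih => simp only [Finset.sum_insert ha, Pn_add_fun, ih]

lemma Pn_abs_le (hp : PV p) (n : ℕ) {F : Y κ → ℝ} {c : ℝ} (h : ∀ z, |F z| ≤ c) (y : Y κ) :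
    |Pn p n F y| ≤ c :=
  abs_le.mpr ⟨le_Pn hp n (fun z => (abs_le.mp (h z)).1) y,
    Pn_le hp n (fun z => (abs_le.mp (h z)).2) y⟩

lemma Pn_sub_abs_le (hp : PV p) (n : ℕ) {F F' : Y κ → ℝ} {c : ℝ} (h : ∀ z, |F z - F' z| ≤ c)
    (y : Y κ) : |Pn p n F y - Pn p n F' y| ≤ c := by
  rw [← Pn_sub_fun]; exact Pn_abs_le hp n h y

lemma Pn_freeze (n : ℕ) (F : Y κ → Y κ → ℝ) (y : Y κ) :
    Pn p n (fun z => F z (shn n z)) y = Pn p n (fun z => F z y) y := by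
  induction n generalizing y F with
  | zero => rfl
  | succ n ih =>
    simp only [Pn_succ, shn_succ']
    refine Finset.sum_congr rfl fun i _ => ?_
    rw [ih (fun z y => F z (ssh y)), ssh_scons]

lemma Pn_comp (hp : PV p) (n : ℕ) (K : Y κ → ℝ) (y : Y κ) :
    Pn p n (fun z => K (shn n z)) y = K y := by
  rw [Pn_freeze n (fun _ y => K y), Pn_const hp]

lemma Pn_mul_comp (n : ℕ) (F K : Y κ → ℝ) (y : Y κ) :
    Pn p n (fun z => F z * K (shn n z)) y = K y * Pn p n F y := by
  rw [Pn_freeze n (fun z y => F z * K y)]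
  simp only [mul_comm _ (K y)]
  rw [Pn_smul]

lemma Pn_osc (hp : PV p) (k N : ℕ) {F : Y κ → ℝ} {ε : ℝ}
    (h : ∀ z z', Agree (k + N) z z' → |F z - F z'| ≤ ε) {y y' : Y κ} (hy : Agree N y y') :
    |Pn p k F y - Pn p k F y'| ≤ ε := by
  induction k generalizing N y y' with
  | zero => exact h y y' (by simpa using hy)
  | succ k ih =>
    rw [Pn_succ, Pn_succ, ← Finset.sum_sub_distrib]
    refine (Finset.abs_sum_le_sum_abs _ _).trans ?_
    calc ∑ i, |p i * Pn p k F (scons i y) - p i * Pn p k F (scons i y')|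
        ≤ ∑ i, p i * ε := by
          refine Finset.sum_le_sum fun i _ => ?_
          rw [← mul_sub, abs_mul, abs_of_pos (hp.pos i)]
          refine mul_le_mul_of_nonneg_left (ih (N + 1) (fun z z' hz => h z z' ?_) (hy.scons i))
            (hp.pos i).le
          exact hz.mono (by omega)
      _ = ε := by rw [← Finset.sum_mul, hp.sum, one_mul]

/-- one-sided cocycle -/
def hc (h : Y κ → SL2) : ℕ → Y κ → SL2
  | 0, _ => 1
  | n + 1, z => hc h n (ssh z) * h z

lemma hc_zero (h : Y κ → SL2) (z : Y κ) : hc h 0 z = 1 := rfl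

lemma hc_one (h : Y κ → SL2) (z : Y κ) : hc h 1 z = h z := by simp [hc]

lemma hc_succ (h : Y κ → SL2) (n : ℕ) (z : Y κ) : hc h (n + 1) z = hc h n (ssh z) * h z := rfl

lemma hc_succ' (h : Y κ → SL2) (n : ℕ) (z : Y κ) : hc h (n + 1) z = h (shn n z) * hc h n z := by
  induction n generalizing z with
  | zero => simp [hc, shn_zero]
  | succ n ih => rw [hc_succ, ih, hc_succ, shn_succ, mul_assoc]

lemma hc_add (h : Y κ → SL2) (m n : ℕ) (z : Y κ) :
    hc h (m + n) z = hc h n (shn m z) * hc h m z := by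
  induction n with
  | zero => simp [hc]
  | succ n ih => rw [← Nat.add_assoc, hc_succ', ih, hc_succ', shn_shn, mul_assoc, Nat.add_comm m n]

lemma nm_hc_le (h : Y κ → SL2) {C : ℝ} (hC : ∀ z, nm (h z) ≤ C) (n : ℕ) (z : Y κ) :
    nm (hc h n z) ≤ C ^ n := by
  induction n generalizing z with
  | zero => simp [hc, nm_one]
  | succ n ih =>
    rw [hc_succ, pow_succ]
    exact (nm_mul _ _).trans (mul_le_mul (ih _) (hC z) (nm_nonneg _)
      ((nm_nonneg _).trans (ih z)))

lemma log_nm_hc_le (h : Y κ → SL2) {C : ℝ} (hC : ∀ z, nm (h z) ≤ C) (n : ℕ) (z : Y κ) :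
    Real.log (nm (hc h n z)) ≤ n * Real.log C := by
  rw [← Real.log_pow]
  exact Real.log_le_log (nm_pos _) (nm_hc_le h hC n z)

/-- density principle -/
lemma dense_induction (D : Set (Y κ)) (hne : D.Nonempty) (hs : ∀ i, ∀ y ∈ D, scons i y ∈ D)
    (hcl : ∀ y, (∀ N, ∃ y' ∈ D, Agree N y y') → y ∈ D) (y : Y κ) : y ∈ D := by
  refine hcl y fun N => ?_
  induction N generalizing y with
  | zero => obtain ⟨y', hy'⟩ := hne; exact ⟨y', hy', fun n hn => by omega⟩
  | succ N ih =>
    obtain ⟨y', hy', ha⟩ := ih (ssh y)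
    refine ⟨scons (y 0) y', hs _ _ hy', ?_⟩
    have := ha.scons (y 0)
    rwa [scons_ssh] at this

/-- ultrafilter -/
abbrev UF : Filter ℕ := (Filter.hyperfilter ℕ : Filter ℕ)

lemma uf_of_atTop {P : ℕ → Prop} (h : ∀ᶠ n in Filter.atTop, P n) : ∀ᶠ n in UF, P n := by
  rw [← Nat.cofinite_eq_atTop] at h
  exact Filter.hyperfilter_le_cofinite h

lemma uf_le_atTop : UF ≤ Filter.atTop := by
  rw [← Nat.cofinite_eq_atTop]; exact Filter.hyperfilter_le_cofinite

lemma exists_ulim_of_compact {X : Type*} [TopologicalSpace X] {K : Set X} (hK : IsCompact K)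
    (a : ℕ → X) (ha : ∀ n, a n ∈ K) : ∃ x ∈ K, Filter.Tendsto a UF (nhds x) := by
  have := hK.ultrafilter_le_nhds ((Filter.hyperfilter ℕ).map a) (by
    rw [Filter.le_principal_iff]
    exact Filter.mem_map.mpr (Filter.univ_mem' ha))
  exact this

lemma exists_Y_lim (a : ℕ → Y κ) : ∃ y, ∀ N, ∀ᶠ n in UF, Agree N (a n) y := by
  obtain ⟨y, -, hy⟩ := exists_ulim_of_compact (isCompact_univ (X := Y κ)) a (fun _ => trivial)
  refine ⟨y, fun N => ?_⟩
  rw [tendsto_pi_nhds] at hy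
  have h1 : ∀ k, ∀ᶠ n in UF, a n k = y k := fun k => by
    have := hy k
    rw [nhds_discrete, Filter.tendsto_pure] at this
    exact this
  have h2 : ∀ᶠ n in UF, ∀ k ∈ Finset.range N, a n k = y k :=
    (Filter.eventually_all_finset (Finset.range N)).mpr fun k _ => h1 k
  filter_upwards [h2] with n hn k hk
  exact hn k (Finset.mem_range.mpr hk)

/-- normalization -/
def nrm (u : Q) : Q := ⟨(‖u.1‖)⁻¹ • u.1, smul_ne_zero (inv_ne_zero (Q_norm_pos u).ne') u.2⟩

lemma nrm_norm (u : Q) : ‖(nrm u).1‖ = 1 := by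
  simp [nrm, norm_smul, (Q_norm_pos u).ne']

lemma dd_nrm (u : Q) : dd u (nrm u) = 0 := by
  unfold dd
  have : wdg u.1 (nrm u).1 = 0 := by simp [wdg, nrm]; ring
  simp [this]

lemma dd_of_unit (u v : Q) (hu : ‖u.1‖ = 1) (hv : ‖v.1‖ = 1) : dd u v ≤ ‖u.1 - v.1‖ := by
  unfold dd
  rw [hu, hv, one_mul, div_one]
  have : wdg u.1 v.1 = wdg (u.1 - v.1) v.1 := by simp [wdg]; ring
  rw [this]
  refine (abs_wdg_le _ _).trans ?_
  rw [hv, mul_one]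

lemma exists_Q_lim (a : ℕ → Q) : ∃ v, ∀ ε > 0, ∀ᶠ n in UF, dd (a n) v ≤ ε := by
  obtain ⟨v, hv, hlim⟩ := exists_ulim_of_compact (isCompact_sphere (0 : E2) 1)
    (fun n => (nrm (a n)).1) (fun n => by simp [nrm_norm])
  have hv1 : ‖v‖ = 1 := by simpa using hv
  have hv0 : v ≠ 0 := fun h => by simp [h] at hv1
  refine ⟨⟨v, hv0⟩, fun ε hε => ?_⟩
  filter_upwards [hlim (Metric.ball_mem_nhds v hε)] with n hn
  have h1 := dd_triangle (a n) (nrm (a n)) ⟨v, hv0⟩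
  rw [dd_nrm] at h1
  have h2 := dd_of_unit (nrm (a n)) ⟨v, hv0⟩ (nrm_norm _) hv1
  have h3 : ‖(nrm (a n)).1 - v‖ < ε := by
    have : dist (nrm (a n)).1 v < ε := hn
    rwa [dist_eq_norm] at this
  have h4 : dd (nrm (a n)) ⟨v, hv0⟩ ≤ ‖(nrm (a n)).1 - v‖ := h2
  linarith

/-- ultralimit of real sequences -/
def ulim (a : ℕ → ℝ) : ℝ := UF.limUnder a

lemma tendsto_ulim {a : ℕ → ℝ} {C : ℝ} (h : ∀ n, |a n| ≤ C) :
    Filter.Tendsto a UF (nhds (ulim a)) := by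
  obtain ⟨x, -, hx⟩ := exists_ulim_of_compact (isCompact_Icc (a := -C) (b := C)) a
    (fun n => abs_le.mp (h n))
  exact tendsto_nhds_limUnder ⟨x, hx⟩

end Sym

/-! ### Part 3: large deviations -/
section LD
variable {κ : ℕ} {p : Fin κ → ℝ}

lemma exp_quad {x : ℝ} (hx : |x| ≤ 1) : Real.exp x ≤ 1 + x + x ^ 2 := by
  have := Real.abs_exp_sub_one_sub_id_le hx
  linarith [(abs_le.mp this).2]

lemma ld_mul (hp : PV p) (X : ℕ → Y κ → ℝ)
    (hsub : ∀ m n z, X (m + n) z ≤ X m z + X n (shn m z)) (s : ℝ) (hs : 0 < s) (a b : ℕ) (q r : ℝ)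
    (hq : ∀ y, Pn p a (fun z => Real.exp (s * X a z)) y ≤ q)
    (hr : ∀ y, Pn p b (fun z => Real.exp (s * X b z)) y ≤ r) (hq0 : 0 ≤ q) (y : Y κ) :
    Pn p (a + b) (fun z => Real.exp (s * X (a + b) z)) y ≤ q * r := by
  calc Pn p (a + b) (fun z => Real.exp (s * X (a + b) z)) y
      ≤ Pn p (a + b) (fun z => Real.exp (s * X a z) * Real.exp (s * X b (shn a z))) y := by
        refine Pn_mono hp _ (fun z => ?_) y
        rw [← Real.exp_add, Real.exp_le_exp, ← mul_add]
        exact mul_le_mul_of_nonneg_left (hsub a b z) hs.le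
    _ = Pn p b (fun w => Real.exp (s * X b w) * Pn p a (fun z => Real.exp (s * X a z)) w) y := by
        rw [Nat.add_comm, Pn_add]
        congr 1
        funext w
        exact Pn_mul_comp a (fun z => Real.exp (s * X a z)) (fun w => Real.exp (s * X b w)) w
    _ ≤ Pn p b (fun w => q * Real.exp (s * X b w)) y := by
        refine Pn_mono hp _ (fun z => ?_) y
        rw [mul_comm]
        exact mul_le_mul_of_nonneg_right (hq z) (Real.exp_pos _).le
    _ = q * Pn p b (fun w => Real.exp (s * X b w)) y := Pn_smul _ _ _ _
    _ ≤ q * r := mul_le_mul_of_nonneg_left (hr y) hq0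

/-- large deviation lemma -/
lemma ld_lemma (hp : PV p) (X : ℕ → Y κ → ℝ)
    (hsub : ∀ m n z, X (m + n) z ≤ X m z + X n (shn m z)) (h0 : ∀ z, X 0 z ≤ 0)
    (B : ℝ) (hB : 0 ≤ B) (N : ℕ) (hN : 0 < N) (hXN : ∀ z, |X N z| ≤ N * B) (hX1 : ∀ z, X 1 z ≤ B)
    (a : ℝ) (ha : 0 < a) (hm : ∀ y, Pn p N (X N) y ≤ - (N * a)) :
    ∃ s c K : ℝ, 0 < s ∧ 0 < c ∧ c < 1 ∧ 0 < K ∧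
      ∀ n y, Pn p n (fun z => Real.exp (s * X n z)) y ≤ K * c ^ n := by
  have hN' : (0 : ℝ) < N := by exact_mod_cast hN
  have hN1 : (1 : ℝ) ≤ N := by exact_mod_cast hN
  -- choose s
  set D : ℝ := N * B + 1 + a with hD
  have hDpos : 0 < D := by positivity
  have hDN : N * B ≤ D := by linarith
  set s : ℝ := a / (2 * D ^ 2) with hsdef
  have hs : 0 < s := by positivity
  have hD1 : 1 ≤ D := by have : 0 ≤ N * B := by positivity
                         linarith
  have hsD2 : s * D ^ 2 = a / 2 := by rw [hsdef]; field_simp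
  have hsD : s * D ≤ 1 := by
    rw [hsdef, div_mul_eq_mul_div, div_le_one (by positivity)]
    nlinarith [show a ≤ D by have : 0 ≤ N * B := by positivity
                             linarith]
  set ρ : ℝ := 1 - s * (a / 2) with hρ
  have hρlt : ρ < 1 := by rw [hρ]; nlinarith
  have hsa : s * a ≤ 1 := by
    refine le_trans (mul_le_mul_of_nonneg_left ?_ hs.le) hsD
    have : 0 ≤ N * B := by positivity
    linarith
  have hρ0 : 0 < ρ := by rw [hρ]; linarith
  have hblock : ∀ y, Pn p N (fun z => Real.exp (s * X N z)) y ≤ ρ := by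
    intro y
    calc Pn p N (fun z => Real.exp (s * X N z)) y
        ≤ Pn p N (fun z => (1 + s ^ 2 * D ^ 2) + s * X N z) y := by
          refine Pn_mono hp _ (fun z => ?_) y
          have h1 : |X N z| ≤ D := (hXN z).trans hDN
          have h2 : |s * X N z| ≤ 1 := by
            rw [abs_mul, abs_of_pos hs]
            exact (mul_le_mul_of_nonneg_left h1 hs.le).trans hsD
          have h3 := exp_quad h2
          have h4 : (X N z) ^ 2 ≤ D ^ 2 := by
            rw [← sq_abs]; exact pow_le_pow_left₀ (abs_nonneg _) h1 2
          nlinarith [mul_le_mul_of_nonneg_left h4 (sq_nonneg s)]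
      _ = (1 + s ^ 2 * D ^ 2) + s * Pn p N (X N) y := by
          rw [Pn_add_fun, Pn_const hp, Pn_smul]
      _ ≤ (1 + s ^ 2 * D ^ 2) + s * (- (N * a)) := by
          have := mul_le_mul_of_nonneg_left (hm y) hs.le
          linarith
      _ ≤ ρ := by
          have h1 : s ^ 2 * D ^ 2 = s * (a / 2) := by rw [← hsD2]; ring
          rw [h1, hρ]
          nlinarith [mul_le_mul_of_nonneg_left hN1 (mul_nonneg hs.le ha.le)]
  set c : ℝ := ρ ^ ((N : ℝ)⁻¹) with hc
  have hc0 : 0 < c := Real.rpow_pos_of_pos hρ0 _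
  have hc1 : c < 1 := Real.rpow_lt_one hρ0.le hρlt (by positivity)
  have hcN : c ^ N = ρ := by rw [hc]; exact Real.rpow_inv_natCast_pow hρ0.le hN.ne'
  set E : ℝ := Real.exp (s * B) with hE
  have hE1 : 1 ≤ E := Real.one_le_exp (by positivity)
  have hstep : ∀ r y, Pn p r (fun z => Real.exp (s * X r z)) y ≤ E ^ r := by
    intro r
    induction r with
    | zero =>
      intro y
      rw [Pn_zero, pow_zero, Real.exp_le_one_iff]
      exact mul_nonpos_of_nonneg_of_nonpos hs.le (h0 y)
    | succ r ih =>
      intro y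
      rw [pow_succ]
      refine ld_mul hp X hsub s hs r 1 _ _ ih (fun y => ?_) (by positivity) y
      refine Pn_le hp 1 (fun z => ?_) y
      exact Real.exp_le_exp.mpr (mul_le_mul_of_nonneg_left (hX1 z) hs.le)
  have hmain : ∀ m r y, Pn p (m * N + r) (fun z => Real.exp (s * X (m * N + r) z)) y
      ≤ ρ ^ m * E ^ r := by
    intro m
    induction m with
    | zero => intro r y; simpa using hstep r y
    | succ m ih =>
      intro r y
      have e : (m + 1) * N + r = N + (m * N + r) := by ring
      rw [e, pow_succ', mul_assoc]
      exact ld_mul hp X hsub s hs N (m * N + r) _ _ hblock (ih r) hρ0.le y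
  refine ⟨s, c, (c ^ N)⁻¹ * E ^ N, hs, hc0, hc1, by positivity, fun n y => ?_⟩
  have h1 := hmain (n / N) (n % N) y
  have hn : n / N * N + n % N = n := by rw [mul_comm]; exact Nat.div_add_mod n N
  rw [hn] at h1
  refine h1.trans ?_
  have hmod : n % N ≤ N := (Nat.mod_lt n hN).le
  have h2 : E ^ (n % N) ≤ E ^ N := pow_le_pow_right₀ hE1 hmod
  have h3 : ρ ^ (n / N) ≤ (c ^ N)⁻¹ * c ^ n := by
    rw [← hcN, ← pow_mul, le_inv_mul_iff₀ (by positivity), ← pow_add]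
    apply pow_le_pow_of_le_one hc0.le hc1.le
    have := Nat.div_add_mod n N
    omega
  calc ρ ^ (n / N) * E ^ (n % N) ≤ ((c ^ N)⁻¹ * c ^ n) * E ^ N :=
        mul_le_mul h3 h2 (by positivity) (by positivity)
    _ = _ := by ring

/-- norms grow uniformly -/
lemma inv_nm_small (hp : PV p) (g : Y κ → SL2) (C0 : ℝ) (hC0 : ∀ z, nm (g z) ≤ C0)
    (L C : ℝ) (hL : 0 < L)
    (hlow : ∀ n y, n * L - C ≤ Pn p n (fun z => Real.log (nm (hc g n z))) y)
    (hup : ∀ ε > 0, ∃ n0 : ℕ, ∀ n ≥ n0, ∀ y,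
      Pn p n (fun z => Real.log (nm (hc g n z))) y ≤ n * (L + ε)) :
    ∀ ε > 0, ∃ n0 : ℕ, ∀ n ≥ n0, ∀ y, Pn p n (fun z => (nm (hc g n z))⁻¹) y ≤ ε := by
  intro ε hε
  set δ : ℝ := ε * L / 16 with hδ
  have hδ0 : 0 < δ := by positivity
  obtain ⟨n1, hn1⟩ := hup δ hδ0
  set N := n1 + 1 with hN
  have hC1 : 0 ≤ Real.log C0 := by
    have h := hlow 0 
    rcases isEmpty_or_nonempty (Y κ) with he | ⟨⟨y⟩⟩
    · have : κ ≠ 0 := by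
        rintro rfl
        have := hp.sum
        simp at this
      exact absurd he (not_isEmpty_iff.mpr ⟨fun _ => ⟨0, Nat.pos_of_ne_zero this⟩⟩)
    · exact Real.log_nonneg ((one_le_nm _).trans (hC0 y))
  have hN' : (0 : ℝ) < N := by rw [hN]; positivity
  obtain ⟨s, c, K, hs, hc0, hc1, hK, hld⟩ := ld_lemma hp
    (fun n z => Real.log (nm (hc g n z)) - n * (L + 2 * δ))
    (fun m n z => by
      have h1 : Real.log (nm (hc g (m + n) z)) ≤
          Real.log (nm (hc g m z)) + Real.log (nm (hc g n (shn m z))) := by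
        rw [← Real.log_mul (nm_pos _).ne' (nm_pos _).ne', hc_add, mul_comm (nm _)]
        exact Real.log_le_log (nm_pos _) (nm_mul _ _)
      push_cast
      linarith)
    (fun z => by simp [hc_zero, nm_one])
    (Real.log C0 + (L + 2 * δ)) (by positivity) N (by omega)
    (fun z => by
      have h1 := log_nm_hc_le g hC0 N z
      have h2 : 0 ≤ Real.log (nm (hc g N z)) := Real.log_nonneg (one_le_nm _)
      have h3 : 0 ≤ (N : ℝ) * (L + 2 * δ) := by positivity
      have h4 : 0 ≤ (N : ℝ) * Real.log C0 := by positivity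
      rw [abs_le]
      constructor <;> nlinarith)
    (fun z => by
      have h1 := log_nm_hc_le g hC0 1 z
      simp only [Nat.cast_one, one_mul] at h1 ⊢
      linarith)
    δ hδ0 (fun y => by
      rw [Pn_sub_fun, Pn_const hp]
      have := hn1 N (by omega) y
      linarith)
  have hineq : ∀ (n : ℕ) (hn : 0 < n) y, Pn p n (fun z => (nm (hc g n z))⁻¹) y ≤
      2 / L * (2 * δ + C * (n : ℝ)⁻¹ + (K / s) * (n : ℝ)⁻¹) + Real.exp (- (L / 2)) ^ n := by
    intro n hn y
    have hn' : (0 : ℝ) < n := by exact_mod_cast hn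
    calc Pn p n (fun z => (nm (hc g n z))⁻¹) y
        ≤ Pn p n (fun z => (2 / L * (L + 2 * δ) + Real.exp (- (L / 2)) ^ n) +
          ((2 / L * (s * n)⁻¹) * Real.exp (s * (Real.log (nm (hc g n z)) - n * (L + 2 * δ))) -
            (2 / L * (n : ℝ)⁻¹) * Real.log (nm (hc g n z)))) y := by
          refine Pn_mono hp _ (fun z => ?_) y
          set l := Real.log (nm (hc g n z)) with hl
          have hl0 : 0 ≤ l := Real.log_nonneg (one_le_nm _)
          have e1 : (nm (hc g n z))⁻¹ = Real.exp (-l) := by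
            rw [Real.exp_neg, hl, Real.exp_log (nm_pos _)]
          rw [e1, ← Real.exp_nat_mul]
          have hx := Real.add_one_le_exp (s * (l - n * (L + 2 * δ)))
          set ex := Real.exp (s * (l - n * (L + 2 * δ))) with hex
          have hex0 : 0 < ex := Real.exp_pos _
          -- l - n (L+2δ) ≤ ex / s
          have hkey : 0 ≤ (L + 2 * δ) + (s * n)⁻¹ * ex - (n : ℝ)⁻¹ * l := by
            have : (L + 2 * δ) + (s * n)⁻¹ * ex - (n : ℝ)⁻¹ * l
              = (s * n)⁻¹ * (ex - s * (l - n * (L + 2 * δ))) := by field_simp; ring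
            rw [this]
            apply mul_nonneg (by positivity); linarith
          have hre : 2 / L * (L + 2 * δ) + Real.exp (n * -(L / 2)) +
              (2 / L * (s * n)⁻¹ * ex - 2 / L * (n : ℝ)⁻¹ * l)
              = 2 / L * ((L + 2 * δ) + (s * n)⁻¹ * ex - (n : ℝ)⁻¹ * l) +
                Real.exp (n * -(L / 2)) := by ring
          rw [hre]
          rcases le_total (n * (L / 2)) l with h | h
          · have h5 : Real.exp (-l) ≤ Real.exp (n * -(L / 2)) :=
              Real.exp_le_exp.mpr (by linarith)
            have : 0 ≤ 2 / L * ((L + 2 * δ) + (s * n)⁻¹ * ex - (n : ℝ)⁻¹ * l) :=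
              mul_nonneg (by positivity) hkey
            linarith
          · have h5 : Real.exp (-l) ≤ 1 := Real.exp_le_one_iff.mpr (by linarith)
            have h6 : (n : ℝ)⁻¹ * l ≤ L / 2 := by
              rw [inv_mul_le_iff₀ hn']; exact h
            have h7 : L / 2 ≤ (L + 2 * δ) + (s * n)⁻¹ * ex - (n : ℝ)⁻¹ * l := by
              have : 0 ≤ (s * n)⁻¹ * ex := by positivity
              linarith
            have h8 := mul_le_mul_of_nonneg_left h7 (show 0 ≤ 2 / L by positivity)
            have h9 : 2 / L * (L / 2) = 1 := by field_simp
            have := Real.exp_pos (n * -(L / 2))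
            linarith
      _ = (2 / L * (L + 2 * δ) + Real.exp (- (L / 2)) ^ n) +
          ((2 / L * (s * n)⁻¹) * Pn p n (fun z =>
              Real.exp (s * (Real.log (nm (hc g n z)) - n * (L + 2 * δ)))) y -
            (2 / L * (n : ℝ)⁻¹) * Pn p n (fun z => Real.log (nm (hc g n z))) y) := by
          rw [Pn_add_fun, Pn_sub_fun, Pn_const hp, Pn_smul, Pn_smul]
      _ ≤ (2 / L * (L + 2 * δ) + Real.exp (- (L / 2)) ^ n) +
          ((2 / L * (s * n)⁻¹) * K - (2 / L * (n : ℝ)⁻¹) * (n * L - C)) := by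
          have h1 := mul_le_mul_of_nonneg_left (hlow n y)
            (show 0 ≤ 2 / L * (n : ℝ)⁻¹ by positivity)
          have h2 : Pn p n (fun z =>
              Real.exp (s * (Real.log (nm (hc g n z)) - n * (L + 2 * δ)))) y ≤ K := by
            refine (hld n y).trans ?_
            have : c ^ n ≤ 1 := pow_le_one₀ hc0.le hc1.le
            nlinarith
          have h3 := mul_le_mul_of_nonneg_left h2
            (show 0 ≤ 2 / L * (s * n)⁻¹ by positivity)
          linarith
      _ = _ := by field_simp; ring
  have hlim : Filter.Tendsto (fun n : ℕ => 2 / L * (2 * δ + C * (n : ℝ)⁻¹ + (K / s) * (n : ℝ)⁻¹) +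
      Real.exp (- (L / 2)) ^ n) Filter.atTop
      (nhds (2 / L * (2 * δ + C * 0 + (K / s) * 0) + 0)) := by
    have hi : Filter.Tendsto (fun n : ℕ => (n : ℝ)⁻¹) Filter.atTop (nhds 0) :=
      tendsto_inv_atTop_nhds_zero_nat
    have he : Filter.Tendsto (fun n : ℕ => Real.exp (- (L / 2)) ^ n) Filter.atTop (nhds 0) :=
      tendsto_pow_atTop_nhds_zero_of_lt_one (Real.exp_pos _).le
        (by rw [Real.exp_lt_one_iff]; linarith)
    exact (((hi.const_mul C).const_add (2 * δ)).add (hi.const_mul (K / s))).const_mul (2 / L)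
      |>.add he
  have hlt : 2 / L * (2 * δ + C * 0 + (K / s) * 0) + 0 < ε := by
    have : 2 / L * (2 * δ + C * 0 + (K / s) * 0) + 0 = ε / 4 := by
      rw [hδ]; field_simp; ring
    linarith
  have hev := (hlim.eventually (gt_mem_nhds hlt)).and (Filter.eventually_gt_atTop 0)
  obtain ⟨n0, hn0⟩ := Filter.eventually_atTop.mp hev
  exact ⟨n0, fun n hn y => (hineq n (hn0 n hn).2 y).trans (hn0 n hn).1.le⟩

end LD

/-! ### Part 4: families of functionals -/

/-- Lipschitz test functions -/
def Lip (C : ℝ) (f : Q → ℝ) : Prop := 0 ≤ C ∧ ∀ u v, |f u - f v| ≤ C * dd u v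

lemma Lip.const (c : ℝ) : Lip 0 (fun _ => c) := ⟨le_rfl, fun u v => by simp⟩

lemma Lip.add {C C' : ℝ} {f f' : Q → ℝ} (h : Lip C f) (h' : Lip C' f') :
    Lip (C + C') (fun u => f u + f' u) :=
  ⟨add_nonneg h.1 h'.1, fun u v => by
    have h1 := h.2 u v
    have h2 := h'.2 u v
    have h3 := abs_add_le (f u - f v) (f' u - f' v)
    rw [show f u + f' u - (f v + f' v) = (f u - f v) + (f' u - f' v) by ring]
    linarith⟩

lemma Lip.smul {C : ℝ} {f : Q → ℝ} (h : Lip C f) (c : ℝ) : Lip (|c| * C) (fun u => c * f u) :=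
  ⟨mul_nonneg (abs_nonneg _) h.1, fun u v => by
    rw [← mul_sub, abs_mul, mul_assoc]
    exact mul_le_mul_of_nonneg_left (h.2 u v) (abs_nonneg _)⟩

lemma Lip.neg {C : ℝ} {f : Q → ℝ} (h : Lip C f) : Lip C (fun u => - f u) :=
  ⟨h.1, fun u v => by
    rw [show - f u - - f v = -(f u - f v) by ring, abs_neg]; exact h.2 u v⟩

lemma Lip.mono {C C' : ℝ} {f : Q → ℝ} (h : Lip C f) (hC : C ≤ C') : Lip C' f :=
  ⟨h.1.trans hC, fun u v => (h.2 u v).trans (mul_le_mul_of_nonneg_right hC (dd_nonneg _ _))⟩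

lemma Lip.comp {C : ℝ} {f : Q → ℝ} (h : Lip C f) (g : SL2) :
    Lip (C * nm g ^ 2) (fun u => f (act g u)) :=
  ⟨mul_nonneg h.1 (sq_nonneg _), fun u v => (h.2 _ _).trans (by
    rw [mul_assoc]
    exact mul_le_mul_of_nonneg_left (dd_act_le g u v) h.1)⟩

lemma Lip.dd (v : Q) : Lip 1 (fun u => dd u v) :=
  ⟨zero_le_one, fun u w => by rw [one_mul]; exact abs_dd_sub_le u w v⟩

lemma Lip.phi (g : SL2) : Lip (nm g ^ 2) (fun u => phi g u) :=
  ⟨sq_nonneg _, fun u w => abs_phi_sub_le g u w⟩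

lemma Lip.bdd {C : ℝ} {f : Q → ℝ} (h : Lip C f) (u : Q) : |f u| ≤ |f (eb 0)| + C := by
  have h1 := h.2 u (eb 0)
  have h2 := mul_le_mul_of_nonneg_left (dd_le_one u (eb 0)) h.1
  have h3 := abs_add_le (f u - f (eb 0)) (f (eb 0))
  rw [sub_add_cancel] at h3
  linarith

/-- bump function -/
def chi (R : ℝ) (v u : Q) : ℝ := max 0 (1 - dd u v / R)

lemma chi_nonneg (R : ℝ) (v u : Q) : 0 ≤ chi R v u := le_max_left _ _

lemma chi_le_one {R : ℝ} (hR : 0 < R) (v u : Q) : chi R v u ≤ 1 :=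
  max_le zero_le_one (by have : 0 ≤ dd u v / R := div_nonneg (dd_nonneg _ _) hR.le
                         linarith)

lemma chi_self (R : ℝ) (v : Q) : chi R v v = 1 := by simp [chi, dd_self]

lemma chi_eq_zero {R : ℝ} (hR : 0 < R) (v u : Q) (h : R ≤ dd u v) : chi R v u = 0 := by
  unfold chi
  have : 1 ≤ dd u v / R := (one_le_div hR).mpr h
  exact max_eq_left (by linarith)

lemma chi_ge_half {R : ℝ} (hR : 0 < R) (v u : Q) (h : dd u v ≤ R) : 1 / 2 ≤ chi (2 * R) v u := by
  unfold chi
  refine le_trans ?_ (le_max_right _ _)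
  have : dd u v / (2 * R) ≤ 1 / 2 := by rw [div_le_iff₀ (by positivity)]; linarith
  linarith

lemma chi_mono {R R' : ℝ} (hR : 0 < R) (h : R ≤ R') (v u : Q) : chi R v u ≤ chi R' v u := by
  unfold chi
  refine max_le_max le_rfl ?_
  have := div_le_div_of_nonneg_left (dd_nonneg u v) hR h
  linarith

lemma chi_of_dd_zero {R : ℝ} (v u : Q) (h : dd u v = 0) : chi R v u = 1 := by simp [chi, h]

lemma Lip.chi {R : ℝ} (hR : 0 < R) (v : Q) : Lip R⁻¹ (fun u => chi R v u) :=
  ⟨by positivity, fun u w => by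
    have h0 := abs_max_sub_max_le_abs (1 - _root_.dd u v / R) (1 - _root_.dd w v / R) 0
    rw [max_comm _ 0, max_comm _ 0] at h0
    refine (show |_root_.chi R v u - _root_.chi R v w| ≤ _ from h0).trans ?_
    · rw [show (1 - _root_.dd u v / R) - (1 - _root_.dd w v / R)
        = R⁻¹ * (_root_.dd w v - _root_.dd u v) by ring, abs_mul, abs_of_pos (inv_pos.mpr hR)]
      have := abs_dd_sub_le w u v
      rw [dd_comm w u] at this
      exact mul_le_mul_of_nonneg_left this (by positivity)⟩

lemma chi_lip_v {R : ℝ} (hR : 0 < R) (v v' u : Q) : |chi R v u - chi R v' u| ≤ R⁻¹ * dd v v' := by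
  have e : ∀ v, chi R v u = chi R u v := fun v => by unfold chi; rw [dd_comm]
  rw [e, e]; exact (Lip.chi hR u).2 v v'

section Fam
variable {κ : ℕ} {p : Fin κ → ℝ}

/-- stationary families -/
structure SF (p : Fin κ → ℝ) (g : Y κ → SL2) (ω : ℕ → ℝ) (η : Y κ → (Q → ℝ) → ℝ) : Prop where
  const : ∀ y c, η y (fun _ => c) = c
  add : ∀ y f f' C C', Lip C f → Lip C' f' → η y (fun u => f u + f' u) = η y f + η y f'
  smul : ∀ y c f C, Lip C f → η y (fun u => c * f u) = c * η y f
  mono : ∀ y f f' C C', Lip C f → Lip C' f' → (∀ u, f u ≤ f' u) → η y f ≤ η y f'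
  cont : ∀ y y' N f C, Lip C f → Agree N y y' → |η y f - η y' f| ≤ C * ω N
  stat : ∀ y f C, Lip C f → η y f = Pn p 1 (fun z => η z (fun u => f (act (g z) u))) y
  lim : Filter.Tendsto ω Filter.atTop (nhds 0)

/-- regular cocycles -/
structure Good (h : Y κ → SL2) (C0 : ℝ) (ω : ℕ → ℝ) : Prop where
  bd : ∀ z, nm (h z) ≤ C0
  hol : ∀ n N z z', Agree (n + N) z z' → ‖toEuc (hc h n z' * (hc h n z)⁻¹) - 1‖ ≤ ω N

lemma PV.ne (hp : PV p) : Nonempty (Y κ) := by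
  have : κ ≠ 0 := by
    rintro rfl
    have := hp.sum
    simp at this
  exact ⟨fun _ => ⟨0, Nat.pos_of_ne_zero this⟩⟩

lemma Good.dd {h : Y κ → SL2} {C0 : ℝ} {ω : ℕ → ℝ} (hg : Good h C0 ω) {n N : ℕ} {z z' : Y κ}
    (ha : Agree (n + N) z z') (u : Q) : dd (act (hc h n z) u) (act (hc h n z') u) ≤ ω N :=
  (dd_one_le _ _ _).trans (hg.hol n N z z' ha)

lemma Good.nonneg {h : Y κ → SL2} {C0 : ℝ} {ω : ℕ → ℝ} (hg : Good h C0 ω) (hp : PV p) (N : ℕ) :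
    0 ≤ ω N := by
  obtain ⟨z⟩ := hp.ne
  exact (dd_nonneg _ _).trans (hg.dd (n := 0) (N := N) (z := z) (z' := z) (fun _ _ => rfl) (eb 0))

lemma Good.one_le {h : Y κ → SL2} {C0 : ℝ} {ω : ℕ → ℝ} (hg : Good h C0 ω) (hp : PV p) :
    1 ≤ C0 := by
  obtain ⟨z⟩ := hp.ne
  exact (one_le_nm _).trans (hg.bd z)

lemma gd_of_mul (g h : SL2) : gd h g ≤ ‖toEuc (h * g⁻¹) - 1‖ * nm g := by
  have : toEuc h - toEuc g = (toEuc (h * g⁻¹) - 1) * toEuc g := by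
    rw [sub_mul, one_mul, ← toEuc_mul, inv_mul_cancel_right]
  unfold gd; rw [this]; exact norm_mul_le _ _

lemma Good.gd {h : Y κ → SL2} {C0 : ℝ} {ω : ℕ → ℝ} (hg : Good h C0 ω) {N : ℕ} {z z' : Y κ}
    (ha : Agree (1 + N) z z') : gd (h z') (h z) ≤ ω N * C0 := by
  have h1 := hg.hol 1 N z z' ha
  rw [hc_one, hc_one] at h1
  exact (gd_of_mul _ _).trans (mul_le_mul h1 (hg.bd z) (nm_nonneg _) ((norm_nonneg _).trans h1))

/-- approximate families -/
def Fam (p : Fin κ → ℝ) (h : Y κ → SL2) (n M : ℕ) (y : Y κ) (f : Q → ℝ) : ℝ :=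
  (n : ℝ)⁻¹ * ∑ k ∈ Finset.range n, Pn p k (fun z => gav M (fun u => f (act (hc h k z) u))) y

lemma Fam_const (hp : PV p) (h : Y κ → SL2) {n M : ℕ} (hn : 0 < n) (hM : 0 < M) (y : Y κ) (c : ℝ) :
    Fam p h n M y (fun _ => c) = c := by
  have hn' : (n : ℝ) ≠ 0 := by exact_mod_cast hn.ne'
  simp [Fam, gav_const M hM, Pn_const hp]; field_simp

lemma Fam_add (h : Y κ → SL2) (n M : ℕ) (y : Y κ) (f f' : Q → ℝ) :
    Fam p h n M y (fun u => f u + f' u) = Fam p h n M y f + Fam p h n M y f' := by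
  simp only [Fam, gav_add, Pn_add_fun, Finset.sum_add_distrib, mul_add]

lemma Fam_smul (h : Y κ → SL2) (n M : ℕ) (y : Y κ) (c : ℝ) (f : Q → ℝ) :
    Fam p h n M y (fun u => c * f u) = c * Fam p h n M y f := by
  simp only [Fam, gav_smul, Pn_smul, ← Finset.mul_sum]; ring

lemma Fam_mono (hp : PV p) (h : Y κ → SL2) (n M : ℕ) (y : Y κ) (f f' : Q → ℝ)
    (hf : ∀ u, f u ≤ f' u) : Fam p h n M y f ≤ Fam p h n M y f' := by
  unfold Fam
  refine mul_le_mul_of_nonneg_left (Finset.sum_le_sum fun k _ => ?_) (by positivity)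
  exact Pn_mono hp k (fun z => gav_mono M _ _ fun u => hf _) y

lemma Fam_bdd (hp : PV p) (h : Y κ → SL2) {n M : ℕ} (hn : 0 < n) (hM : 0 < M) (y : Y κ)
    {f : Q → ℝ} {B : ℝ} (hB : ∀ u, |f u| ≤ B) : |Fam p h n M y f| ≤ B := by
  rw [abs_le]
  constructor
  · rw [← Fam_const hp h hn hM y (-B)]
    exact Fam_mono hp h n M y _ _ fun u => (abs_le.mp (hB u)).1
  · rw [← Fam_const hp h hn hM y B]
    exact Fam_mono hp h n M y _ _ fun u => (abs_le.mp (hB u)).2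

lemma Fam_sub_le (hp : PV p) (h : Y κ → SL2) {n M : ℕ} (hn : 0 < n) (hM : 0 < M) (y : Y κ)
    {f f' : Q → ℝ} {B : ℝ} (hB : ∀ u, |f u - f' u| ≤ B) :
    |Fam p h n M y f - Fam p h n M y f'| ≤ B := by
  have e : Fam p h n M y (fun u => f u + (-1) * f' u) = Fam p h n M y f - Fam p h n M y f' := by
    rw [Fam_add, Fam_smul]; ring
  rw [← e]
  refine Fam_bdd hp h hn hM y fun u => ?_
  have := hB u
  rwa [show f u + (-1) * f' u = f u - f' u by ring]

lemma gav_sub_abs_le {M : ℕ} (hM : 0 < M) {f f' : Q → ℝ} {B : ℝ} (hB : ∀ u, |f u - f' u| ≤ B) :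
    |gav M f - gav M f'| ≤ B := by
  rw [abs_le]
  have h1 : gav M f ≤ gav M (fun u => f' u + B) := gav_mono M _ _ fun u => by
    linarith [(abs_le.mp (hB u)).2]
  have h2 : gav M f' ≤ gav M (fun u => f u + B) := gav_mono M _ _ fun u => by
    linarith [(abs_le.mp (hB u)).1]
  rw [gav_add, gav_const M hM] at h1 h2
  constructor <;> linarith

lemma gav_abs_le {M : ℕ} (hM : 0 < M) {f : Q → ℝ} {B : ℝ} (hB : ∀ u, |f u| ≤ B) :
    |gav M f| ≤ B := by
  have := gav_sub_abs_le (f' := fun _ => 0) hM (fun u => by simpa using hB u)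
  rwa [gav_const M hM, sub_zero] at this

lemma Fam_cont (hp : PV p) {h : Y κ → SL2} {C0 : ℝ} {ω : ℕ → ℝ} (hg : Good h C0 ω) {n M : ℕ}
    (hn : 0 < n) (hM : 0 < M) {y y' : Y κ} {N : ℕ} {f : Q → ℝ} {C : ℝ} (hf : Lip C f)
    (ha : Agree N y y') : |Fam p h n M y f - Fam p h n M y' f| ≤ C * ω N := by
  have hn' : (0 : ℝ) < n := by exact_mod_cast hn
  unfold Fam
  rw [← mul_sub, ← Finset.sum_sub_distrib, abs_mul, abs_of_pos (inv_pos.mpr hn'),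
    inv_mul_le_iff₀ hn']
  refine (Finset.abs_sum_le_sum_abs _ _).trans ?_
  refine (Finset.sum_le_sum (g := fun _ => C * ω N) fun k _ => ?_).trans (by simp)
  refine Pn_osc hp k N (fun z z' hz => ?_) ha
  refine gav_sub_abs_le hM fun u => (hf.2 _ _).trans ?_
  exact mul_le_mul_of_nonneg_left (hg.dd hz u) hf.1

lemma Fam_stat (hp : PV p) (h : Y κ → SL2) {n M : ℕ} (hn : 0 < n) (hM : 0 < M) (y : Y κ)
    {f : Q → ℝ} {B : ℝ} (hB : ∀ u, |f u| ≤ B) :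
    |Fam p h n M y f - Pn p 1 (fun z => Fam p h n M z (fun u => f (act (h z) u))) y|
      ≤ (n : ℝ)⁻¹ * (2 * B) := by
  have hn' : (0 : ℝ) < n := by exact_mod_cast hn
  set T : ℕ → ℝ := fun k => Pn p k (fun z => gav M (fun u => f (act (hc h k z) u))) y with hT
  have e : Pn p 1 (fun z => Fam p h n M z (fun u => f (act (h z) u))) y
      = (n : ℝ)⁻¹ * ∑ k ∈ Finset.range n, T (k + 1) := by
    unfold Fam
    rw [Pn_smul, Pn_sum]
    congr 1
    refine Finset.sum_congr rfl fun k _ => ?_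
    rw [hT]
    simp only
    rw [Nat.add_comm k 1, Pn_add]
    congr 1
    funext w
    rw [← Pn_freeze k (fun z w => gav M (fun u => f (act (h w) (act (hc h k z) u))))]
    congr 1
    funext z
    rw [Nat.add_comm 1 k, hc_succ']
    simp only [act_mul]
  rw [e]
  have e2 : Fam p h n M y f = (n : ℝ)⁻¹ * ∑ k ∈ Finset.range n, T k := rfl
  rw [e2, ← mul_sub, ← Finset.sum_sub_distrib, Finset.sum_range_sub', abs_mul,
    abs_of_pos (inv_pos.mpr hn')]
  refine mul_le_mul_of_nonneg_left ?_ (by positivity)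
  have hb : ∀ k, |T k| ≤ B := fun k => Pn_abs_le hp k (fun z => gav_abs_le hM fun u => hB _) y
  have := abs_sub (T 0) (T n)
  linarith [hb 0, hb n]

lemma Pn_tendsto {l : Filter ℕ} (n : ℕ) {F : ℕ → Y κ → ℝ} {F' : Y κ → ℝ}
    (h : ∀ z, Filter.Tendsto (fun j => F j z) l (nhds (F' z))) (y : Y κ) :
    Filter.Tendsto (fun j => Pn p n (F j) y) l (nhds (Pn p n F' y)) := by
  induction n generalizing y with
  | zero => exact h y
  | succ n ih =>
    simp only [Pn_succ]
    exact tendsto_finsetSum _ fun i _ => (ih _).const_mul _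

/-- limit family -/
def flim (p : Fin κ → ℝ) (h : ℕ → Y κ → SL2) (n : ℕ → ℕ) (y : Y κ) (f : Q → ℝ) : ℝ :=
  ulim (fun j => Fam p (h j) (n j) (j + 1) y f)

/-- data for the limit family -/
structure LD (p : Fin κ → ℝ) (h : ℕ → Y κ → SL2) (g : Y κ → SL2) (C0 : ℝ) (ω δ : ℕ → ℝ)
    (n : ℕ → ℕ) : Prop where
  pv : PV p
  good : ∀ j, Good (h j) C0 ω
  goodg : Good g C0 ω
  conv : ∀ j z, gd (h j z) (g z) ≤ δ j
  δlim : Filter.Tendsto δ Filter.atTop (nhds 0)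
  ωlim : Filter.Tendsto ω Filter.atTop (nhds 0)
  nlarge : ∀ j, j < n j

variable {h : ℕ → Y κ → SL2} {g : Y κ → SL2} {C0 : ℝ} {ω δ : ℕ → ℝ} {n : ℕ → ℕ}

lemma flim_tendsto (D : LD p h g C0 ω δ n) (y : Y κ) {f : Q → ℝ} {C : ℝ} (hf : Lip C f) :
    Filter.Tendsto (fun j => Fam p (h j) (n j) (j + 1) y f) UF (nhds (flim p h n y f)) :=
  tendsto_ulim (C := |f (eb 0)| + C) fun j =>
    Fam_bdd D.pv _ (by have := D.nlarge j; omega) (by omega) y hf.bdd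

lemma LD.ninv (D : LD p h g C0 ω δ n) : Filter.Tendsto (fun j => ((n j : ℕ) : ℝ)⁻¹) UF (nhds 0) := by
  have h1 : Filter.Tendsto n Filter.atTop Filter.atTop :=
    Filter.tendsto_atTop_mono (fun j => (D.nlarge j).le) Filter.tendsto_id
  exact (tendsto_inv_atTop_nhds_zero_nat.comp h1).mono_left uf_le_atTop

lemma flim_SF (D : LD p h g C0 ω δ n) : SF p g ω (flim p h n) where
  const y c := by
    have h1 := flim_tendsto D y (Lip.const c)
    have h2 : (fun j => Fam p (h j) (n j) (j + 1) y (fun _ => c)) = fun _ => c := by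
      funext j
      exact Fam_const D.pv _ (by have := D.nlarge j; omega) (by omega) y c
    rw [h2] at h1
    exact tendsto_nhds_unique h1 tendsto_const_nhds
  add y f f' C C' hf hf' := by
    have h1 := flim_tendsto D y (hf.add hf')
    simp only [Fam_add] at h1
    exact tendsto_nhds_unique h1 ((flim_tendsto D y hf).add (flim_tendsto D y hf'))
  smul y c f C hf := by
    have h1 := flim_tendsto D y (hf.smul c)
    simp only [Fam_smul] at h1
    exact tendsto_nhds_unique h1 ((flim_tendsto D y hf).const_mul c)
  mono y f f' C C' hf hf' hle :=
    le_of_tendsto_of_tendsto' (flim_tendsto D y hf) (flim_tendsto D y hf')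
      fun j => Fam_mono D.pv _ _ _ y _ _ hle
  cont y y' N f C hf ha :=
    le_of_tendsto ((flim_tendsto D y hf).sub (flim_tendsto D y' hf)).abs
      (Filter.Eventually.of_forall fun j =>
        Fam_cont D.pv (D.good j) (by have := D.nlarge j; omega) (by omega) hf ha)
  lim := D.ωlim
  stat y f C hf := by
    have h1 := flim_tendsto D y hf
    have h2 : Filter.Tendsto (fun j => Pn p 1 (fun z => Fam p (h j) (n j) (j + 1) z
        (fun u => f (act (g z) u))) y) UF
        (nhds (Pn p 1 (fun z => flim p h n z (fun u => f (act (g z) u))) y)) :=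
      Pn_tendsto 1 (fun z => flim_tendsto D z (hf.comp (g z))) y
    refine tendsto_nhds_unique h1 ?_
    have h3 : Filter.Tendsto (fun j => ((n j : ℕ) : ℝ)⁻¹ * (2 * (|f (eb 0)| + C))
        + C * (δ j * C0)) UF (nhds (0 * (2 * (|f (eb 0)| + C)) + C * (0 * C0))) :=
      (D.ninv.mul_const _).add (((D.δlim.mono_left uf_le_atTop).mul_const _).const_mul _)
    have h4 : Filter.Tendsto (fun j => Fam p (h j) (n j) (j + 1) y f - Pn p 1 (fun z =>
        Fam p (h j) (n j) (j + 1) z (fun u => f (act (g z) u))) y) UF (nhds 0) := by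
      refine squeeze_zero_norm (fun j => ?_) (by simpa using h3)
      have hn : 0 < n j := by have := D.nlarge j; omega
      have a1 := Fam_stat D.pv (h j) hn (show 0 < j + 1 by omega) y hf.bdd
      have a2 : |Pn p 1 (fun z => Fam p (h j) (n j) (j + 1) z (fun u => f (act (h j z) u))) y -
          Pn p 1 (fun z => Fam p (h j) (n j) (j + 1) z (fun u => f (act (g z) u))) y|
          ≤ C * (δ j * C0) := by
        refine Pn_sub_abs_le D.pv 1 (fun z => ?_) y
        refine Fam_sub_le D.pv (h j) hn (by omega) z fun u => (hf.2 _ _).trans ?_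
        refine mul_le_mul_of_nonneg_left ((dd_act_act_le _ _ _).trans ?_) hf.1
        exact mul_le_mul (D.conv j z) (D.goodg.bd z) (nm_nonneg _)
          ((gd_nonneg _ _).trans (D.conv j z))
      rw [Real.norm_eq_abs]
      refine le_trans ?_ (add_le_add a1 a2)
      refine le_trans (le_of_eq ?_) (abs_add_le _ _)
      congr 1; ring
    have h5 := h4.add h2
    simpa using h5

end Fam

/-! ### Part 4, continued: values -/
section Val
variable {κ : ℕ} {p : Fin κ → ℝ}

/-- the k-th increment -/
def incr (h : Y κ → SL2) (M k : ℕ) (z : Y κ) : ℝ :=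
  gav M (fun u => phi (h (shn k z)) (act (hc h k z) u))

lemma phi_hc_sum (h : Y κ → SL2) (n : ℕ) (z : Y κ) (u : Q) :
    phi (hc h n z) u = ∑ k ∈ Finset.range n, phi (h (shn k z)) (act (hc h k z) u) := by
  induction n with
  | zero => simp [hc_zero, phi_one]
  | succ n ih => rw [hc_succ', phi_mul, ih, Finset.sum_range_succ]

lemma gav_sum (M : ℕ) {ι : Type*} (s : Finset ι) (f : ι → Q → ℝ) :
    gav M (fun u => ∑ a ∈ s, f a u) = ∑ a ∈ s, gav M (f a) := by
  unfold gav
  rw [Finset.sum_comm, Finset.mul_sum]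

lemma gav_phi_hc (h : Y κ → SL2) (M n : ℕ) (z : Y κ) :
    gav M (fun u => phi (hc h n z) u) = ∑ k ∈ Finset.range n, incr h M k z := by
  simp only [phi_hc_sum, gav_sum, incr]

lemma incr_bdd {h : Y κ → SL2} {C0 : ℝ} (hC0 : ∀ z, nm (h z) ≤ C0) {M : ℕ} (hM : 0 < M) (k : ℕ)
    (z : Y κ) : |incr h M k z| ≤ Real.log C0 :=
  gav_abs_le hM fun u => (abs_phi_le _ _).trans (Real.log_le_log (nm_pos _) (hC0 _))

lemma incr_osc {h : Y κ → SL2} {C0 : ℝ} {ω : ℕ → ℝ} (hg : Good h C0 ω) {M : ℕ} (hM : 0 < M)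
    (k N : ℕ) {z z' : Y κ} (ha : Agree (k + (N + 1)) z z') :
    |incr h M k z - incr h M k z'| ≤ 2 * C0 ^ 2 * ω N := by
  refine gav_sub_abs_le hM fun u => ?_
  have hω : dd (act (hc h k z) u) (act (hc h k z') u) ≤ ω N :=
    hg.dd (ha.mono (by omega)) u
  have hω0 : 0 ≤ ω N := (dd_nonneg _ _).trans hω
  have hC0 : 0 ≤ C0 := (nm_nonneg _).trans (hg.bd z)
  have hsq : ∀ w, nm (h w) ^ 2 ≤ C0 ^ 2 := fun w => pow_le_pow_left₀ (nm_nonneg _) (hg.bd w) 2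
  have h1 := abs_phi_sub_le (h (shn k z)) (act (hc h k z) u) (act (hc h k z') u)
  have h2 : nm (h (shn k z)) ^ 2 * dd (act (hc h k z) u) (act (hc h k z') u) ≤ C0 ^ 2 * ω N :=
    mul_le_mul (hsq _) hω (dd_nonneg _ _) (sq_nonneg _)
  have hs : Agree (1 + N) (shn k z) (shn k z') := by
    apply Agree.shn; exact ha.mono (by omega)
  have key : ∀ w w' : Y κ, Agree (1 + N) w w' → ∀ v, phi (h w) v - phi (h w') v ≤ C0 ^ 2 * ω N := by
    intro w w' hw v
    refine (phi_sub_gd_le _ _ _).trans ?_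
    have := hg.gd hw.symm
    calc gd (h w) (h w') * nm (h w') ≤ (ω N * C0) * C0 :=
          mul_le_mul this (hg.bd _) (nm_nonneg _) (by positivity)
      _ = _ := by ring
  have h3 := key _ _ hs (act (hc h k z') u)
  have h4 := key _ _ hs.symm (act (hc h k z') u)
  rw [abs_le] at h1 ⊢
  constructor <;> linarith [h1.1, h1.2]

lemma Fam_phi (h : Y κ → SL2) (n M : ℕ) (y : Y κ) :
    Fam p h n M y (fun u => phi (h y) u) =
      (n : ℝ)⁻¹ * ∑ k ∈ Finset.range n, Pn p k (incr h M k) y := by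
  unfold Fam
  congr 1
  refine Finset.sum_congr rfl fun k _ => ?_
  rw [← Pn_freeze k (fun z w => gav M (fun u => phi (h w) (act (hc h k z) u)))]
  rfl

/-- approximate value -/
def Val (p : Fin κ → ℝ) (h : Y κ → SL2) (n M : ℕ) (y0 : Y κ) : ℝ :=
  (n : ℝ)⁻¹ * Pn p n (fun z => gav M (fun u => phi (hc h n z) u)) y0

lemma Val_close (hp : PV p) {h : Y κ → SL2} {C0 : ℝ} {ω : ℕ → ℝ} (hg : Good h C0 ω) {n M : ℕ}
    (hn : 0 < n) (hM : 0 < M) (y0 y : Y κ) (m : ℕ) :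
    |Val p h n M y0 - Pn p (m + 1) (fun z => Fam p h n M z (fun u => phi (h z) u)) y|
      ≤ 2 * C0 ^ 2 * ω m + (n : ℝ)⁻¹ * ((m + 1 : ℕ) * (2 * Real.log C0)) := by
  have hn' : (0 : ℝ) < n := by exact_mod_cast hn
  have hC1 : 0 ≤ Real.log C0 := Real.log_nonneg (hg.one_le hp)
  have hω : 0 ≤ ω m := hg.nonneg hp m
  simp only [Fam_phi, Val, gav_phi_hc]
  rw [Pn_smul, Pn_sum, Pn_sum, ← mul_sub, ← Finset.sum_sub_distrib, abs_mul,
    abs_of_pos (inv_pos.mpr hn')]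
  have e : 2 * C0 ^ 2 * ω m + (n : ℝ)⁻¹ * ((m + 1 : ℕ) * (2 * Real.log C0)) =
      (n : ℝ)⁻¹ * (n * (2 * C0 ^ 2 * ω m) + (m + 1 : ℕ) * (2 * Real.log C0)) := by
    field_simp
  rw [e]
  refine mul_le_mul_of_nonneg_left ?_ (by positivity)
  refine (Finset.abs_sum_le_sum_abs _ _).trans ?_
  have hterm : ∀ k ∈ Finset.range n, |Pn p n (incr h M k) y0 - Pn p (m + 1) (Pn p k (incr h M k)) y|
      ≤ 2 * C0 ^ 2 * ω m + if n - (m + 1) ≤ k then 2 * Real.log C0 else 0 := by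
    intro k hk
    rw [Finset.mem_range] at hk
    split_ifs with hif
    · have b1 := Pn_abs_le hp n (incr_bdd hg.bd hM k) y0
      have b2 := Pn_abs_le hp (m + 1 + k) (incr_bdd hg.bd hM k) y
      rw [Pn_add] at b2
      have := abs_sub (Pn p n (incr h M k) y0) (Pn p (m + 1) (Pn p k (incr h M k)) y)
      have : 0 ≤ 2 * C0 ^ 2 * ω m := by positivity
      linarith
    · rw [add_zero]
      obtain ⟨l, hl⟩ : ∃ l, n = l + (m + 1 + k) := ⟨n - (m + 1 + k), by omega⟩
      rw [← Pn_add, hl, Pn_add l, ← Pn_const hp l (Pn p (m + 1 + k) (incr h M k) y) y0]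
      refine Pn_sub_abs_le hp l (fun w => ?_) y0
      refine Pn_osc hp (m + 1 + k) 0 (fun z z' hz => ?_) (fun _ hh => by omega)
      exact incr_osc hg hM k m (hz.mono (by omega))
  refine (Finset.sum_le_sum hterm).trans ?_
  rw [Finset.sum_add_distrib, Finset.sum_const, Finset.card_range, nsmul_eq_mul]
  refine add_le_add le_rfl ?_
  rw [← Finset.sum_filter, Finset.sum_const, nsmul_eq_mul]
  refine mul_le_mul_of_nonneg_right ?_ (by positivity)
  have hsub : (Finset.range n).filter (fun k => n - (m + 1) ≤ k) ⊆ Finset.Ico (n - (m + 1)) n := by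
    intro k hk
    simp only [Finset.mem_filter, Finset.mem_range] at hk
    exact Finset.mem_Ico.mpr ⟨hk.2, hk.1⟩
  have := Finset.card_le_card hsub
  rw [Nat.card_Ico] at this
  have h2 : ((Finset.range n).filter (fun k => n - (m + 1) ≤ k)).card ≤ m + 1 := by omega
  exact_mod_cast h2

/-- the value function of a family -/
def HH (g : Y κ → SL2) (η : Y κ → (Q → ℝ) → ℝ) (y : Y κ) : ℝ := η y (fun u => phi (g y) u)

/-- the family has value v -/
def HasVal (p : Fin κ → ℝ) (F : Y κ → ℝ) (v : ℝ) : Prop :=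
  ∃ e : ℕ → ℝ, Filter.Tendsto e Filter.atTop (nhds 0) ∧ ∀ m y, |Pn p (m + 1) F y - v| ≤ e m

variable {h : ℕ → Y κ → SL2} {g : Y κ → SL2} {C0 : ℝ} {ω δ : ℕ → ℝ} {n : ℕ → ℕ}

/-- value of the limit family -/
def vlim (p : Fin κ → ℝ) (h : ℕ → Y κ → SL2) (n : ℕ → ℕ) (y0 : Y κ) : ℝ :=
  ulim (fun j => Val p (h j) (n j) (j + 1) y0)

lemma Val_bdd (D : LD p h g C0 ω δ n) (y0 : Y κ) (j : ℕ) :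
    |Val p (h j) (n j) (j + 1) y0| ≤ Real.log C0 := by
  have hn : 0 < n j := by have := D.nlarge j; omega
  have hn' : (0 : ℝ) < n j := by exact_mod_cast hn
  unfold Val
  rw [abs_mul, abs_of_pos (inv_pos.mpr hn'), inv_mul_le_iff₀ hn']
  refine Pn_abs_le D.pv _ (fun z => gav_abs_le (by omega) fun u => ?_) y0
  exact (abs_phi_le _ _).trans (log_nm_hc_le _ (D.good j).bd _ _)

lemma vlim_tendsto (D : LD p h g C0 ω δ n) (y0 : Y κ) :
    Filter.Tendsto (fun j => Val p (h j) (n j) (j + 1) y0) UF (nhds (vlim p h n y0)) :=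
  tendsto_ulim (Val_bdd D y0)

lemma flim_val (D : LD p h g C0 ω δ n) (y0 : Y κ) :
    HasVal p (HH g (flim p h n)) (vlim p h n y0) := by
  refine ⟨fun m => 2 * C0 ^ 2 * ω m, by simpa using D.ωlim.const_mul (2 * C0 ^ 2), fun m y => ?_⟩
  have h1 : ∀ z, Filter.Tendsto (fun j => Fam p (h j) (n j) (j + 1) z (fun u => phi (h j z) u)) UF
      (nhds (HH g (flim p h n) z)) := by
    intro z
    have a1 : Filter.Tendsto (fun j => Fam p (h j) (n j) (j + 1) z (fun u => phi (g z) u)) UF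
      (nhds (HH g (flim p h n) z)) := flim_tendsto D z (Lip.phi (g z))
    have a2 : Filter.Tendsto (fun j => Fam p (h j) (n j) (j + 1) z (fun u => phi (h j z) u) -
        Fam p (h j) (n j) (j + 1) z (fun u => phi (g z) u)) UF (nhds 0) := by
      refine squeeze_zero_norm (a := fun j => δ j * C0) (fun j => ?_)
        (by simpa using (D.δlim.mono_left uf_le_atTop).mul_const C0)
      rw [Real.norm_eq_abs]
      refine Fam_sub_le D.pv (h j) (by have := D.nlarge j; omega) (by omega) z fun u => ?_
      have b1 := phi_sub_gd_le (h j z) (g z) u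
      have b2 := phi_sub_gd_le (g z) (h j z) u
      rw [gd_comm] at b2
      have b0 : 0 ≤ δ j := (gd_nonneg _ _).trans (D.conv j z)
      have c1 : gd (h j z) (g z) * nm (g z) ≤ δ j * C0 :=
        mul_le_mul (D.conv j z) (D.goodg.bd z) (nm_nonneg _) b0
      have c2 : gd (h j z) (g z) * nm (h j z) ≤ δ j * C0 :=
        mul_le_mul (D.conv j z) ((D.good j).bd z) (nm_nonneg _) b0
      rw [abs_le]; constructor <;> linarith
    simpa using a2.add a1
  have h2 := Pn_tendsto (p := p) (m + 1) h1 y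
  have h3 := (h2.sub (vlim_tendsto D y0)).abs
  have h4 : Filter.Tendsto (fun j => 2 * C0 ^ 2 * ω m +
      ((n j : ℕ) : ℝ)⁻¹ * ((m + 1 : ℕ) * (2 * Real.log C0))) UF
      (nhds (2 * C0 ^ 2 * ω m + 0 * ((m + 1 : ℕ) * (2 * Real.log C0)))) :=
    (D.ninv.mul_const _).const_add _
  rw [zero_mul, add_zero] at h4
  refine le_of_tendsto_of_tendsto' h3 h4 fun j => ?_
  rw [abs_sub_comm]
  exact Val_close D.pv (D.good j) (by have := D.nlarge j; omega) (by omega) y0 y m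

/-! general stationary families -/

variable {η : Y κ → (Q → ℝ) → ℝ} {w : ℕ → ℝ}

lemma SF.iter (S : SF p g w η) (k : ℕ) (y : Y κ) {f : Q → ℝ} {C : ℝ} (hf : Lip C f) :
    η y f = Pn p k (fun z => η z (fun u => f (act (hc g k z) u))) y := by
  induction k generalizing y with
  | zero => simp [Pn_zero, hc_zero, act_one]
  | succ k ih =>
    rw [ih y, Pn_add]
    congr 1
    funext x
    rw [S.stat x _ _ (hf.comp _)]
    simp only [Pn_one]
    refine Finset.sum_congr rfl fun i _ => ?_
    rw [hc_succ, ssh_scons]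
    simp only [act_mul]

lemma SF.sum (S : SF p g w η) {ι : Type*} (s : Finset ι) (y : Y κ) (f : ι → Q → ℝ) (C : ι → ℝ)
    (hf : ∀ a, Lip (C a) (f a)) :
    η y (fun u => ∑ a ∈ s, f a u) = ∑ a ∈ s, η y (f a) ∧
      Lip (∑ a ∈ s, C a) (fun u => ∑ a ∈ s, f a u) := by
  classical
  induction s using Finset.induction_on with
  | empty => simpa using ⟨S.const y 0, Lip.const 0⟩
  | insert a s ha ih =>
    simp only [Finset.sum_insert ha]
    exact ⟨by rw [S.add y _ _ _ _ (hf a) ih.2, ih.1], (hf a).add ih.2⟩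

lemma SF.value (S : SF p g w η) (T : ℕ) (y : Y κ) :
    Pn p T (fun z => η z (fun u => phi (hc g T z) u)) y =
      ∑ k ∈ Finset.range T, Pn p (k + 1) (HH g η) y := by
  have h1 : ∀ z, η z (fun u => phi (hc g T z) u) =
      ∑ k ∈ Finset.range T, η z (fun u => phi (g (shn k z)) (act (hc g k z) u)) := by
    intro z
    simp only [phi_hc_sum]
    exact (S.sum (Finset.range T) z _ _ fun k => (Lip.phi (g (shn k z))).comp (hc g k z)).1
  simp only [h1]
  rw [Pn_sum, ← Finset.sum_range_reflect]
  refine Finset.sum_congr rfl fun k hk => ?_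
  rw [Finset.mem_range] at hk
  have e : T = (k + 1) + (T - 1 - k) := by omega
  conv_lhs => rw [e, Pn_add]
  congr 1
  funext x
  have h2 := Pn_freeze (p := p) (T - 1 - k)
    (fun z w => η z (fun u => phi (g w) (act (hc g (T - 1 - k) z) u))) x
  have e2 : k + 1 + (T - 1 - k) - 1 - k = T - 1 - k := by omega
  rw [e2, h2]
  exact (S.iter _ x (Lip.phi (g x))).symm

lemma cesaro_small {e : ℕ → ℝ} (he : Filter.Tendsto e Filter.atTop (nhds 0)) {ε : ℝ} (hε : 0 < ε) :
    ∃ T0 : ℕ, ∀ T ≥ T0, ∑ k ∈ Finset.range T, e k ≤ ε * T := by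
  have h1 := he.cesaro
  obtain ⟨T0, hT0⟩ := Filter.eventually_atTop.mp (h1.eventually (gt_mem_nhds hε))
  refine ⟨T0 + 1, fun T hT => ?_⟩
  have h2 := hT0 T (by omega)
  have hT' : (0 : ℝ) < T := by exact_mod_cast (by omega : 0 < T)
  rw [inv_mul_lt_iff₀ hT'] at h2
  linarith

lemma HasVal.sum {F : Y κ → ℝ} {v : ℝ} (hv : HasVal p F v) {ε : ℝ} (hε : 0 < ε) :
    ∃ T0 : ℕ, ∀ T ≥ T0, ∀ y, |∑ k ∈ Finset.range T, Pn p (k + 1) F y - T * v| ≤ ε * T := by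
  obtain ⟨e, he, hb⟩ := hv
  obtain ⟨T0, hT0⟩ := cesaro_small he hε
  refine ⟨T0, fun T hT y => le_trans ?_ (hT0 T hT)⟩
  have : ∑ k ∈ Finset.range T, Pn p (k + 1) F y - T * v
      = ∑ k ∈ Finset.range T, (Pn p (k + 1) F y - v) := by
    rw [Finset.sum_sub_distrib]; simp
  rw [this]
  exact (Finset.abs_sum_le_sum_abs _ _).trans (Finset.sum_le_sum fun k _ => hb k y)

lemma HasVal.unique {F : Y κ → ℝ} {v v' : ℝ} (hv : HasVal p F v) (hv' : HasVal p F v')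
    (y : Y κ) : v = v' := by
  obtain ⟨e, he, hb⟩ := hv
  obtain ⟨e', he', hb'⟩ := hv'
  have h1 : Filter.Tendsto (fun m => Pn p (m + 1) F y) Filter.atTop (nhds v) := by
    rw [tendsto_iff_norm_sub_tendsto_zero]
    exact squeeze_zero (fun _ => norm_nonneg _) (fun m => hb m y) he
  have h2 : Filter.Tendsto (fun m => Pn p (m + 1) F y) Filter.atTop (nhds v') := by
    rw [tendsto_iff_norm_sub_tendsto_zero]
    exact squeeze_zero (fun _ => norm_nonneg _) (fun m => hb' m y) he'
  exact tendsto_nhds_unique h1 h2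

end Val

/-! ### Part 6: values and domination -/

section Dom
variable {κ : ℕ} {p : Fin κ → ℝ}
variable {h : ℕ → Y κ → SL2} {g : Y κ → SL2} {C0 : ℝ} {ω δ : ℕ → ℝ} {n : ℕ → ℕ}

/-- growth of the limit cocycle -/
structure Gr (p : Fin κ → ℝ) (g : Y κ → SL2) (L C : ℝ) : Prop where
  pos : 0 < L
  low : ∀ n y, n * L - C ≤ Pn p n (fun z => Real.log (nm (hc g n z))) y
  up : ∀ ε > 0, ∃ n0 : ℕ, ∀ n ≥ n0, ∀ y,
      Pn p n (fun z => Real.log (nm (hc g n z))) y ≤ n * (L + ε)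

lemma val_upper (D : LD p h g C0 ω δ n) (y0 : Y κ) (v : ℝ)
    (hv : ∀ j, Pn p (n j) (fun z => Real.log (nm (hc (h j) (n j) z))) y0 ≤ n j * v) :
    vlim p h n y0 ≤ v := by
  refine le_of_tendsto (vlim_tendsto D y0) (Filter.Eventually.of_forall fun j => ?_)
  have hn : 0 < n j := by have := D.nlarge j; omega
  have hn' : (0 : ℝ) < n j := by exact_mod_cast hn
  unfold Val
  rw [inv_mul_le_iff₀ hn']
  refine le_trans (Pn_mono D.pv _ (fun z => ?_) y0) (hv j)
  rw [← gav_const (j + 1) (by omega) (Real.log (nm (hc (h j) (n j) z)))]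
  exact gav_mono _ _ _ fun u => phi_le _ _

open Classical in
lemma phi_lower (g : SL2) {B r : ℝ} (hB : Real.log (nm g) ≤ B) (hr : 0 < r) (hr1 : r ≤ 1) :
    ∃ s, ∀ u, Real.log (nm g) - Real.log (2 / r) + (-(2 * B)) * (if dd u s ≤ r then 1 else 0)
      ≤ phi g u := by
  obtain ⟨s, e, h1, -⟩ := exists_se g
  refine ⟨s, fun u => ?_⟩
  have hl : 0 ≤ Real.log (2 / r) := Real.log_nonneg (by rw [le_div_iff₀ hr]; linarith)
  split_ifs with hu
  · have := neg_le_phi g u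
    linarith
  · push Not at hu
    have h2 := h1 u
    have hup := Q_norm_pos u
    have h3 : nm g / (2 / r) ≤ Real.exp (phi g u) := by
      rw [exp_phi, le_div_iff₀ hup]
      have : nm g * r * ‖u.1‖ ≤ nm g * dd u s * ‖u.1‖ := by
        have := nm_pos g
        gcongr
      have e : nm g / (2 / r) = nm g * r / 2 := by field_simp
      rw [e]; linarith
    have h4 := Real.log_le_log (by have := nm_pos g; positivity) h3
    rw [Real.log_exp, Real.log_div (nm_pos g).ne' (by positivity)] at h4
    linarith

lemma val_lower (D : LD p (fun _ => g) g C0 ω δ n) (y0 : Y κ) {L C : ℝ} (G : Gr p g L C) :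
    L ≤ vlim p (fun _ => g) n y0 := by
  have hl0 : 0 ≤ Real.log C0 := Real.log_nonneg (D.goodg.one_le D.pv)
  have key : ∀ r : ℝ, 0 < r → r ≤ 1 → L - 8 * Real.log C0 * r ≤ vlim p (fun _ => g) n y0 := by
    intro r hr hr1
    have hM : Filter.Tendsto (fun j : ℕ => (((j + 1 : ℕ) : ℝ))⁻¹) UF (nhds 0) := by
      refine Filter.Tendsto.mono_left ?_ uf_le_atTop
      exact (tendsto_inv_atTop_nhds_zero_nat (𝕜 := ℝ)).comp (Filter.tendsto_add_atTop_nat 1)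
    have h1 : Filter.Tendsto (fun j : ℕ => L - ((n j : ℕ) : ℝ)⁻¹ * (C + Real.log (2 / r))
        - 2 * Real.log C0 * (4 * r + (((j + 1 : ℕ) : ℝ))⁻¹)) UF
        (nhds (L - 0 * (C + Real.log (2 / r)) - 2 * Real.log C0 * (4 * r + 0))) :=
      ((D.ninv.mul_const _).const_sub _).sub ((hM.const_add _).const_mul _)
    have h2 := le_of_tendsto_of_tendsto' h1 (vlim_tendsto D y0) fun j => by
      have hn : 0 < n j := by have := D.nlarge j; omega
      have hn' : (0 : ℝ) < n j := by exact_mod_cast hn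
      unfold Val
      rw [le_inv_mul_iff₀ hn']
      have a1 : ∀ z, Real.log (nm (hc g (n j) z)) + (- Real.log (2 / r) - 2 * (n j * Real.log C0) *
          (4 * r + (((j + 1 : ℕ) : ℝ))⁻¹)) ≤ gav (j + 1) (fun u => phi (hc g (n j) z) u) := by
        intro z
        classical
        obtain ⟨s, hs⟩ := phi_lower (hc g (n j) z) (log_nm_hc_le g D.goodg.bd (n j) z) hr hr1
        refine le_trans ?_ (gav_mono (j + 1) _ _ hs)
        rw [gav_add, gav_smul, gav_const _ (by omega)]
        have := grid_bound (j + 1) (by omega) s r hr.le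
        have h5 : 0 ≤ 2 * (n j * Real.log C0) := by positivity
        have := mul_le_mul_of_nonneg_left this h5
        push_cast at this ⊢
        linarith
      have a2 := Pn_mono D.pv (n j) a1 y0
      rw [Pn_add_fun, Pn_const D.pv] at a2
      refine le_trans ?_ a2
      have a3 := G.low (n j) y0
      have e : (n j : ℝ) * (L - ((n j : ℕ) : ℝ)⁻¹ * (C + Real.log (2 / r))
        - 2 * Real.log C0 * (4 * r + (((j + 1 : ℕ) : ℝ))⁻¹)) = n j * L - C - Real.log (2 / r)
        - 2 * (n j * Real.log C0) * (4 * r + (((j + 1 : ℕ) : ℝ))⁻¹) := by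
        field_simp; ring
      rw [e]
      linarith
    linarith
  by_contra hcon
  push Not at hcon
  set d := L - vlim p (fun _ => g) n y0 with hd
  have hd0 : 0 < d := by linarith
  have h8 : 0 < 8 * Real.log C0 + 1 + d := by linarith
  have := key (d / (8 * Real.log C0 + 1 + d)) (by positivity)
    (by rw [div_le_one h8]; linarith)
  have h9 : 8 * Real.log C0 * (d / (8 * Real.log C0 + 1 + d)) < d := by
    rw [mul_div_assoc', div_lt_iff₀ h8]; nlinarith
  linarith

variable {η ηL : Y κ → (Q → ℝ) → ℝ} {w : ℕ → ℝ}

lemma SF.nonneg (S : SF p g w η) {f : Q → ℝ} {C : ℝ} (hf : Lip C f) (h : ∀ u, 0 ≤ f u) (y : Y κ) :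
    0 ≤ η y f := by
  rw [← S.const y 0]; exact S.mono y _ _ _ _ (Lip.const 0) hf h

lemma SF.le_const (S : SF p g w η) {f : Q → ℝ} {C c : ℝ} (hf : Lip C f) (h : ∀ u, f u ≤ c)
    (y : Y κ) : η y f ≤ c := by
  rw [← S.const y c]; exact S.mono y _ _ _ _ hf (Lip.const c) h

lemma SF.add_const (S : SF p g w η) {f : Q → ℝ} {C c : ℝ} (hf : Lip C f) (y : Y κ) :
    η y (fun u => f u + c) = η y f + c := by
  rw [S.add y _ _ _ _ hf (Lip.const c), S.const]

lemma SF.neg (S : SF p g w η) {f : Q → ℝ} {C : ℝ} (hf : Lip C f) (y : Y κ) :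
    η y (fun u => - f u) = - η y f := by
  have := S.smul y (-1) f C hf
  simpa using this

lemma dom_a (g : SL2) {f : Q → ℝ} {C : ℝ} (hf : Lip C f) (h0 : ∀ u, 0 ≤ f u) {M : ℕ} (hM : 0 < M) :
    ∃ s e, (∀ u, f e * dd u s + -(4 * C * (nm g)⁻¹) ≤ f (act g u)) ∧
      gav M (fun u => f (act g u)) ≤ f e + C * (8 * (nm g)⁻¹ + (M : ℝ)⁻¹) := by
  classical
  obtain ⟨s, e, -, h2⟩ := exists_se g
  have hn := nm_pos g
  have h1 := one_le_nm g
  have hC := hf.1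
  refine ⟨s, e, fun u => ?_, ?_⟩
  · have a1 := (abs_le.mp (hf.2 (act g u) e)).1
    have a2 : f (act g u) * dd u s ≤ f (act g u) := by
      have := mul_le_mul_of_nonneg_left (dd_le_one u s) (h0 (act g u))
      linarith
    have a3 : dd (act g u) e * dd u s ≤ 4 * (nm g)⁻¹ := by
      rw [← div_eq_mul_inv, le_div_iff₀ hn]
      have h3 := h2 u
      have : 0 ≤ dd (act g u) e * dd u s := mul_nonneg (dd_nonneg _ _) (dd_nonneg _ _)
      nlinarith
    have a4 := mul_le_mul_of_nonneg_right a1 (dd_nonneg u s)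
    have a5 := mul_le_mul_of_nonneg_left a3 hC
    nlinarith
  · have b1 : ∀ u, f (act g u) ≤ (f e + C * (4 * (nm g)⁻¹)) +
        C * (if dd u s ≤ (nm g)⁻¹ then 1 else 0) := by
      intro u
      have a1 := (abs_le.mp (hf.2 (act g u) e)).2
      have a2 : dd (act g u) e ≤ 4 * (nm g)⁻¹ + (if dd u s ≤ (nm g)⁻¹ then 1 else 0) := by
        split_ifs with hu
        · have := dd_le_one (act g u) e
          have : 0 ≤ 4 * (nm g)⁻¹ := by positivity
          linarith
        · push Not at hu
          rw [add_zero, ← div_eq_mul_inv, le_div_iff₀ hn]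
          have h3 := h2 u
          have h4 : 1 ≤ dd u s * nm g := by
            rw [inv_lt_iff_one_lt_mul₀ hn] at hu
            linarith
          have h5 := mul_le_mul_of_nonneg_left h4 (mul_nonneg (dd_nonneg (act g u) e) hn.le)
          nlinarith
      have := mul_le_mul_of_nonneg_left a2 hC
      linarith
    refine (gav_mono M _ _ b1).trans ?_
    rw [gav_add, gav_smul, gav_const _ hM]
    have := mul_le_mul_of_nonneg_left (grid_bound M hM s (nm g)⁻¹ (by positivity)) hC
    linarith

lemma dom (D : LD p (fun _ => g) g C0 ω δ n) {L CG : ℝ} (G : Gr p g L CG) (S : SF p g w η)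
    {c : ℝ} (hc0 : 0 < c) (hc : ∀ z v, c ≤ η z (fun u => dd u v)) (y : Y κ) {f : Q → ℝ} {C : ℝ}
    (hf : Lip C f) (h0 : ∀ u, 0 ≤ f u) : c * flim p (fun _ => g) n y f ≤ η y f := by
  have hC := hf.1
  have hc1 : c ≤ 1 := (hc y (eb 0)).trans (S.le_const (Lip.dd _) (fun u => dd_le_one _ _) y)
  set q : ℕ → ℝ := fun T => Pn p T (fun z => (nm (_root_.hc g T z))⁻¹) y with hq
  have hq0 : ∀ T, 0 ≤ q T := fun T => le_Pn D.pv _ (fun z => inv_nonneg.mpr (nm_nonneg _)) y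
  have hqlim : Filter.Tendsto q Filter.atTop (nhds 0) := by
    rw [Metric.tendsto_atTop]
    intro ε hε
    obtain ⟨n0, hn0⟩ := inv_nm_small D.pv g C0 D.goodg.bd L CG G.pos G.low G.up (ε / 2) (by linarith)
    refine ⟨n0, fun T hT => ?_⟩
    rw [Real.dist_eq, sub_zero, abs_of_nonneg (hq0 T)]
    have := hn0 T hT y
    simp only [hq]; linarith
  have step : ∀ (M : ℕ), 0 < M → ∀ T, c * Pn p T (fun z => gav M (fun u => f (act (_root_.hc g T z) u))) y
      ≤ η y f + 12 * C * q T + C * (M : ℝ)⁻¹ := by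
    intro M hM T
    have b1 : ∀ z, c * gav M (fun u => f (act (_root_.hc g T z) u)) ≤
        η z (fun u => f (act (_root_.hc g T z) u)) + (12 * C * (nm (_root_.hc g T z))⁻¹ + C * (M : ℝ)⁻¹) := by
      intro z
      obtain ⟨s, e, h1, h2⟩ := dom_a (_root_.hc g T z) hf h0 hM
      have hq := inv_pos.mpr (nm_pos (_root_.hc g T z))
      have hMi : 0 ≤ (M : ℝ)⁻¹ := by positivity
      have a1 := S.mono z _ _ _ _ (((Lip.dd s).smul (f e)).add (Lip.const _))
        (hf.comp (_root_.hc g T z)) h1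
      rw [S.add_const ((Lip.dd s).smul (f e)), S.smul z _ _ _ (Lip.dd s)] at a1
      have a2 := mul_le_mul_of_nonneg_left (hc z s) (h0 e)
      have a3 := mul_le_mul_of_nonneg_left h2 hc0.le
      have a4 : c * (C * (8 * (nm (_root_.hc g T z))⁻¹ + (M : ℝ)⁻¹)) ≤
        1 * (C * (8 * (nm (_root_.hc g T z))⁻¹ + (M : ℝ)⁻¹)) :=
        mul_le_mul_of_nonneg_right hc1 (by positivity)
      linarith
    have b2 := Pn_mono D.pv T b1 y
    rw [Pn_smul, Pn_add_fun, Pn_add_fun, Pn_smul, Pn_const D.pv, ← S.iter T y hf] at b2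
    linarith
  have step2 : ∀ ε > 0, c * flim p (fun _ => g) n y f ≤ η y f + 12 * C * ε := by
    intro ε hε
    have hM : Filter.Tendsto (fun j : ℕ => (((j + 1 : ℕ) : ℝ))⁻¹) UF (nhds 0) := by
      refine Filter.Tendsto.mono_left ?_ uf_le_atTop
      exact (tendsto_inv_atTop_nhds_zero_nat (𝕜 := ℝ)).comp (Filter.tendsto_add_atTop_nat 1)
    have h1 := (hM.const_mul C).const_add (η y f + 12 * C * ε)
    rw [mul_zero, add_zero] at h1
    refine le_of_tendsto_of_tendsto ((flim_tendsto D y hf).const_mul c) h1 ?_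
    obtain ⟨T0, hT0⟩ := cesaro_small hqlim hε
    have : ∀ᶠ j in UF, T0 ≤ j := uf_of_atTop (Filter.eventually_ge_atTop T0)
    filter_upwards [this] with j hj
    have hn : 0 < n j := by have := D.nlarge j; omega
    have hn' : (0 : ℝ) < n j := by exact_mod_cast hn
    unfold Fam
    rw [mul_left_comm, inv_mul_le_iff₀ hn', Finset.mul_sum]
    refine (Finset.sum_le_sum fun k _ => step (j + 1) (by omega) k).trans ?_
    have e : ∑ i ∈ Finset.range (n j), (η y f + 12 * C * q i + C * (((j + 1 : ℕ) : ℝ))⁻¹)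
        = n j * (η y f + C * (((j + 1 : ℕ) : ℝ))⁻¹) + 12 * C * ∑ i ∈ Finset.range (n j), q i := by
      simp only [Finset.sum_add_distrib, ← Finset.mul_sum, Finset.sum_const, Finset.card_range,
        nsmul_eq_mul]
      ring
    rw [e]
    have := mul_le_mul_of_nonneg_left (hT0 (n j) (by have := D.nlarge j; omega))
      (show 0 ≤ 12 * C by linarith)
    linarith
  refine le_of_forall_pos_le_add fun ε hε => ?_
  refine (step2 (ε / (12 * C + 1)) (by positivity)).trans ?_
  have : 12 * C * (ε / (12 * C + 1)) ≤ ε := by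
    rw [mul_div_assoc', div_le_iff₀ (by positivity)]; nlinarith
  linarith

/-! ### atoms -/

lemma SF.atom_lim (S : SF p g w η) {z : ℕ → Y κ} {v : ℕ → Q} {e : ℕ → ℝ}
    (he : Filter.Tendsto e UF (nhds 0)) (hz : ∀ k, η (z k) (fun u => dd u (v k)) ≤ e k) {y : Y κ}
    (hy : ∀ N, ∀ᶠ k in UF, Agree N (z k) y) : ∃ v, η y (fun u => dd u v) = 0 := by
  obtain ⟨v0, hv0⟩ := exists_Q_lim v
  refine ⟨v0, le_antisymm ?_ (S.nonneg (Lip.dd v0) (fun u => dd_nonneg _ _) y)⟩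
  refine le_of_forall_pos_le_add fun ε hε => ?_
  obtain ⟨N, hN⟩ := (S.lim.eventually (gt_mem_nhds (show 0 < ε / 3 by linarith))).exists
  have h1 := he.eventually (gt_mem_nhds (show 0 < ε / 3 by linarith))
  obtain ⟨k, hk1, hk2, hk3⟩ := (h1.and ((hv0 (ε / 3) (by linarith)).and (hy N))).exists
  have a1 : η y (fun u => dd u v0) ≤ η y (fun u => dd u (v k) + ε / 3) :=
    S.mono y _ _ _ _ (Lip.dd v0) ((Lip.dd (v k)).add (Lip.const _)) fun u => by
      have := dd_triangle u (v k) v0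
      linarith
  rw [S.add_const (Lip.dd (v k))] at a1
  have a2 := (abs_le.mp (S.cont _ _ N _ _ (Lip.dd (v k)) hk3)).1
  have a3 := hz k
  linarith

lemma SF.atoms (S : SF p g w η) (hp : PV p)
    (hs : ∀ c > 0, ∃ z v, η z (fun u => dd u v) < c) :
    ∃ V : Y κ → Q, ∀ y, η y (fun u => dd u (V y)) = 0 := by
  have hM : Filter.Tendsto (fun j : ℕ => ((j : ℝ) + 1)⁻¹) UF (nhds 0) := by
    refine Filter.Tendsto.mono_left ?_ uf_le_atTop
    simpa using (tendsto_one_div_add_atTop_nhds_zero_nat (𝕜 := ℝ))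
  suffices h : ∀ y, ∃ v, η y (fun u => dd u v) = 0 by choose V hV using h; exact ⟨V, hV⟩
  refine dense_induction {y | ∃ v, η y (fun u => dd u v) = 0} ?_ ?_ ?_
  · choose z v hzv using fun k : ℕ => hs ((k : ℝ) + 1)⁻¹ (by positivity)
    obtain ⟨y, hy⟩ := exists_Y_lim z
    exact ⟨y, S.atom_lim hM (fun k => (hzv k).le) hy⟩
  · rintro i y ⟨v, hv⟩
    refine ⟨act (g (scons i y))⁻¹ v, le_antisymm ?_ (S.nonneg (Lip.dd _) (fun u => dd_nonneg _ _) _)⟩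
    rw [S.stat y _ _ (Lip.dd v), Pn_one] at hv
    have h1 : ∀ i ∈ Finset.univ, 0 ≤ p i * η (scons i y) (fun u => dd (act (g (scons i y)) u) v) :=
      fun i _ => mul_nonneg (hp.pos i).le
        (S.nonneg ((Lip.dd v).comp (g (scons i y))) (fun u => dd_nonneg _ _) _)
    have h2 := (Finset.sum_eq_zero_iff_of_nonneg h1).mp hv i (Finset.mem_univ _)
    have h3 : η (scons i y) (fun u => dd (act (g (scons i y)) u) v) = 0 :=
      (mul_eq_zero.mp h2).resolve_left (hp.pos i).ne'
    have h4 := S.mono (scons i y) (fun u => dd u (act (g (scons i y))⁻¹ v))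
      (fun u => nm (g (scons i y)) ^ 2 * dd (act (g (scons i y)) u) v) _ _ (Lip.dd _)
      (((Lip.dd v).comp (g (scons i y))).smul _) (fun u => by
        have := dd_le_act (g (scons i y)) u (act (g (scons i y))⁻¹ v)
        rwa [act_act_inv] at this)
    rw [S.smul _ _ _ _ ((Lip.dd v).comp (g (scons i y))), h3, mul_zero] at h4
    exact h4
  · intro y hy
    choose z hz ha using hy
    choose v hv using hz
    refine S.atom_lim (e := fun _ => 0) tendsto_const_nhds (fun k => (hv k).le) (y := y) fun N => ?_
    exact uf_of_atTop ((Filter.eventually_ge_atTop N).mono fun k hk => ((ha k).mono hk).symm)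

/-- invariant sections -/
structure Sec (g : Y κ → SL2) (w : ℕ → ℝ) (V : Y κ → Q) : Prop where
  hol : ∀ N z z', Agree N z z' → dd (V z) (V z') ≤ w N
  eq : ∀ z, dd (act (g z) (V z)) (V (ssh z)) = 0
  lim : Filter.Tendsto w Filter.atTop (nhds 0)

lemma SF.eval (S : SF p g w η) {V : Y κ → Q} (hV : ∀ y, η y (fun u => dd u (V y)) = 0)
    {f : Q → ℝ} {C : ℝ} (hf : Lip C f) (y : Y κ) : η y f = f (V y) := by
  have h1 := S.mono y f (fun u => C * dd u (V y) + f (V y)) _ _ hf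
    (((Lip.dd (V y)).smul C).add (Lip.const _)) (fun u => by
      linarith [(abs_le.mp (hf.2 u (V y))).2])
  have h2 := S.mono y (fun u => (-C) * dd u (V y) + f (V y)) f _ _
    (((Lip.dd (V y)).smul (-C)).add (Lip.const _)) hf (fun u => by
      linarith [(abs_le.mp (hf.2 u (V y))).1])
  rw [S.add_const ((Lip.dd (V y)).smul _), S.smul _ _ _ _ (Lip.dd _), hV] at h1 h2
  linarith

lemma SF.sec (S : SF p g w η) (hp : PV p) {V : Y κ → Q}
    (hV : ∀ y, η y (fun u => dd u (V y)) = 0) : Sec g w V where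
  lim := S.lim
  hol N z z' ha := by
    have h1 := S.cont z z' N _ _ (Lip.dd (V z')) ha
    rw [S.eval hV (Lip.dd _), hV, sub_zero, one_mul] at h1
    exact (le_abs_self _).trans h1
  eq z := by
    have hv := hV (ssh z)
    rw [S.stat _ _ _ (Lip.dd (V (ssh z))), Pn_one] at hv
    have h1 : ∀ i ∈ Finset.univ, 0 ≤ p i * η (scons i (ssh z))
        (fun u => dd (act (g (scons i (ssh z))) u) (V (ssh z))) :=
      fun i _ => mul_nonneg (hp.pos i).le
        (S.nonneg ((Lip.dd _).comp _) (fun u => dd_nonneg _ _) _)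
    have h2 := (Finset.sum_eq_zero_iff_of_nonneg h1).mp hv (z 0) (Finset.mem_univ _)
    rw [scons_ssh] at h2
    have h3 := (mul_eq_zero.mp h2).resolve_left (hp.pos _).ne'
    rwa [S.eval hV ((Lip.dd _).comp _)] at h3

lemma dd_congr {u v : Q} (h : dd u v = 0) (x : Q) : dd u x = dd v x := by
  have := abs_dd_sub_le u v x
  rw [h] at this
  linarith [abs_nonpos_iff.mp this]

lemma phi_congr {u v : Q} (h : dd u v = 0) (g : SL2) : phi g u = phi g v := by
  have := abs_phi_sub_le g u v
  rw [h, mul_zero] at this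
  linarith [abs_nonpos_iff.mp this]

lemma act_congr {u v : Q} (h : dd u v = 0) (g : SL2) : dd (act g u) (act g v) = 0 := by
  have := dd_act_le g u v
  rw [h, mul_zero] at this
  exact le_antisymm this (dd_nonneg _ _)

lemma Sec.iter {V : Y κ → Q} (K : Sec g w V) (T : ℕ) (z : Y κ) :
    dd (act (hc g T z) (V z)) (V (shn T z)) = 0 := by
  induction T with
  | zero => rw [hc_zero, act_one, shn_zero, dd_self]
  | succ T ih =>
    rw [hc_succ', act_mul, dd_congr (act_congr ih _), shn_succ']
    exact K.eq _

/-- derivative along a section -/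
def bb (g : Y κ → SL2) (V : Y κ → Q) (y : Y κ) : ℝ := phi (g y) (V y)

lemma Sec.phi {V : Y κ → Q} (K : Sec g w V) (T : ℕ) (z : Y κ) :
    phi (hc g T z) (V z) = ∑ k ∈ Finset.range T, bb g V (shn k z) := by
  rw [phi_hc_sum]
  exact Finset.sum_congr rfl fun k _ => phi_congr (K.iter k z) _

end Dom

/-! ### Part 7: structure of the limit family -/

section Ph2
variable {κ : ℕ} {p : Fin κ → ℝ}
variable {h : ℕ → Y κ → SL2} {g : Y κ → SL2} {C0 : ℝ} {ω δ : ℕ → ℝ} {n : ℕ → ℕ}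
variable {η ηL : Y κ → (Q → ℝ) → ℝ} {w wL : ℕ → ℝ} {V : Y κ → Q}

lemma HasVal.comb {F F' : Y κ → ℝ} {v v' : ℝ} (h : HasVal p F v) (h' : HasVal p F' v') (a b : ℝ) :
    HasVal p (fun y => a * F y + b * F' y) (a * v + b * v') := by
  obtain ⟨e, he, hb⟩ := h
  obtain ⟨e', he', hb'⟩ := h'
  refine ⟨fun m => |a| * e m + |b| * e' m, by
    simpa using (he.const_mul |a|).add (he'.const_mul |b|), fun m y => ?_⟩
  rw [Pn_add_fun, Pn_smul, Pn_smul]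
  have h1 := mul_le_mul_of_nonneg_left (hb m y) (abs_nonneg a)
  have h2 := mul_le_mul_of_nonneg_left (hb' m y) (abs_nonneg b)
  rw [← abs_mul] at h1 h2
  have h3 := abs_add_le (a * (Pn p (m + 1) F y - v)) (b * (Pn p (m + 1) F' y - v'))
  rw [show a * Pn p (m + 1) F y + b * Pn p (m + 1) F' y - (a * v + b * v') =
    a * (Pn p (m + 1) F y - v) + b * (Pn p (m + 1) F' y - v') by ring]
  linarith

/-- remainder family -/
def rem (t : ℝ) (η ηL : Y κ → (Q → ℝ) → ℝ) (y : Y κ) (f : Q → ℝ) : ℝ :=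
  (1 - t)⁻¹ * (η y f - t * ηL y f)

lemma rem_SF (S : SF p g w η) (SL : SF p g w ηL) {t : ℝ} (ht0 : 0 ≤ t) (ht1 : t < 1)
    (hdom : ∀ y f C, Lip C f → (∀ u, 0 ≤ f u) → t * ηL y f ≤ η y f) :
    SF p g (fun N => (1 - t)⁻¹ * ((1 + t) * w N)) (rem t η ηL) where
  const y c := by
    have : 1 - t ≠ 0 := by linarith
    unfold rem; rw [S.const, SL.const]; field_simp
  add y f f' C C' hf hf' := by
    unfold rem; rw [S.add y f f' C C' hf hf', SL.add y f f' C C' hf hf']; ring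
  smul y c f C hf := by
    unfold rem; rw [S.smul y c f C hf, SL.smul y c f C hf]; ring
  mono y f f' C C' hf hf' hle := by
    have h1 := hdom y (fun u => f' u + -f u) _ (hf'.add hf.neg) (fun u => by linarith [hle u])
    rw [S.add y _ _ _ _ hf' hf.neg, SL.add y _ _ _ _ hf' hf.neg, S.neg hf, SL.neg hf] at h1
    unfold rem
    refine mul_le_mul_of_nonneg_left ?_ (inv_nonneg.mpr (by linarith))
    linarith
  cont y y' N f C hf ha := by
    unfold rem
    have h1 := S.cont y y' N f C hf ha
    have h2 := mul_le_mul_of_nonneg_left (SL.cont y y' N f C hf ha) ht0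
    rw [← abs_of_nonneg ht0, ← abs_mul, abs_of_nonneg ht0] at h2
    rw [← mul_sub, abs_mul, abs_of_nonneg (inv_nonneg.mpr (show 0 ≤ 1 - t by linarith)),
      mul_left_comm]
    refine mul_le_mul_of_nonneg_left ?_ (inv_nonneg.mpr (by linarith))
    have h3 := abs_sub (η y f - η y' f) (t * (ηL y f - ηL y' f))
    rw [show η y f - t * ηL y f - (η y' f - t * ηL y' f) = (η y f - η y' f) -
      t * (ηL y f - ηL y' f) by ring]
    linarith
  stat y f C hf := by
    unfold rem
    rw [S.stat y f C hf, SL.stat y f C hf, Pn_smul, Pn_sub_fun, Pn_smul]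
  lim := by simpa using (S.lim.const_mul (1 + t)).const_mul (1 - t)⁻¹

/-- the maximal common part -/
lemma exists_max (S : SF p g w η) (SL : SF p g w ηL) (y0 : Y κ) :
    ∃ t : ℝ, 0 ≤ t ∧ t ≤ 1 ∧ (∀ y f C, Lip C f → (∀ u, 0 ≤ f u) → t * ηL y f ≤ η y f) ∧
      ∀ t', t < t' → ¬ (∀ y f C, Lip C f → (∀ u, 0 ≤ f u) → t' * ηL y f ≤ η y f) := by
  set A : Set ℝ := {t | ∀ y f C, Lip C f → (∀ u, 0 ≤ f u) → t * ηL y f ≤ η y f} with hA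
  have h1 : ∀ t ∈ A, t ≤ 1 := fun t ht => by
    have := ht y0 (fun _ => 1) 0 (Lip.const 1) (fun _ => zero_le_one)
    rwa [S.const, SL.const, mul_one] at this
  have h0 : (0 : ℝ) ∈ A := fun y f C hf h => by rw [zero_mul]; exact S.nonneg hf h y
  have hb : BddAbove A := ⟨1, h1⟩
  refine ⟨sSup A, le_csSup hb h0, csSup_le ⟨0, h0⟩ h1, fun y f C hf h => ?_, fun t' ht' hc => ?_⟩
  · rcases (SL.nonneg hf h y).eq_or_lt with h2 | h2
    · rw [← h2, mul_zero]; exact S.nonneg hf h y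
    · rw [← le_div_iff₀ h2]
      refine csSup_le ⟨0, h0⟩ fun t ht => ?_
      rw [le_div_iff₀ h2]; exact ht y f C hf h
  · exact absurd (le_csSup hb hc) (not_le.mpr ht')

lemma chi_osc (SL : SF p g wL ηL) (K : Sec g w V) {R : ℝ} (hR : 0 < R) {N : ℕ} {y y' : Y κ}
    (ha : Agree N y y') :
    ηL y (fun u => chi R (V y) u) ≤ ηL y' (fun u => chi R (V y') u) + R⁻¹ * (w N + wL N) := by
  have h1 := (abs_le.mp (SL.cont y y' N _ _ (Lip.chi hR (V y)) ha)).2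
  have h2 := SL.mono y' (fun u => chi R (V y) u) (fun u => chi R (V y') u + R⁻¹ * w N) _ _
    (Lip.chi hR _) ((Lip.chi hR _).add (Lip.const _)) (fun u => by
      have h3 := (abs_le.mp (chi_lip_v hR (V y) (V y') u)).2
      have h4 := mul_le_mul_of_nonneg_left (K.hol N y y' ha) (inv_nonneg.mpr hR.le)
      linarith)
  rw [SL.add_const (Lip.chi hR _)] at h2
  linarith

lemma chi_push (hC0 : 1 ≤ C0) (hbd : ∀ z, nm (g z) ≤ C0) (K : Sec g w V) {R : ℝ} (hR : 0 < R)
    (z : Y κ) (u : Q) : chi R (V (ssh z)) (act (g z) u) ≤ chi (C0 ^ 2 * R) (V z) u := by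
  unfold chi
  refine max_le_max le_rfl ?_
  have h1 := dd_le_act (g z) u (V z)
  rw [dd_comm (act (g z) u), dd_congr (K.eq z), dd_comm _ (act (g z) u)] at h1
  have h2 : nm (g z) ^ 2 ≤ C0 ^ 2 := by have := nm_nonneg (g z); gcongr; exact hbd z
  have h3 := mul_le_mul_of_nonneg_right h2 (dd_nonneg (act (g z) u) (V (ssh z)))
  have h4 : dd u (V z) / (C0 ^ 2 * R) ≤ dd (act (g z) u) (V (ssh z)) / R := by
    rw [div_le_div_iff₀ (by positivity) hR]
    nlinarith
  linarith

/-- atoms are uniformly positive once present -/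
lemma atom_all (hp : PV p) (hC0 : 1 ≤ C0) (hbd : ∀ z, nm (g z) ≤ C0) (SL : SF p g wL ηL)
    (K : Sec g w V) {τ : ℝ} (hτ : 0 < τ)
    (hbig : ∀ R > 0, ∃ y, τ ≤ ηL y (fun u => chi R (V y) u)) :
    ∃ α : ℝ, 0 < α ∧ α ≤ 1 ∧ ∀ y, ∀ R > 0, α ≤ ηL y (fun u => chi R (V y) u) := by
  set A : Set ℝ := {a | ∀ R > 0, ∃ y, a ≤ ηL y (fun u => chi R (V y) u)} with hA
  have h1 : ∀ a ∈ A, a ≤ 1 := fun a ha => by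
    obtain ⟨y, hy⟩ := ha 1 one_pos
    exact hy.trans (SL.le_const (Lip.chi one_pos _) (fun u => chi_le_one one_pos _ _) y)
  have hb : BddAbove A := ⟨1, h1⟩
  set α := sSup A with hα
  have hτα : τ ≤ α := le_csSup hb hbig
  have hlow : ∀ ε > 0, ∀ R > 0, ∃ y, α - ε ≤ ηL y (fun u => chi R (V y) u) := by
    intro ε hε R hR
    obtain ⟨a, ha, hlt⟩ := exists_lt_of_lt_csSup (⟨τ, hbig⟩ : A.Nonempty) (show α - ε < sSup A by linarith)
    obtain ⟨y, hy⟩ := ha R hR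
    exact ⟨y, hlt.le.trans hy⟩
  have hup : ∀ ε > 0, ∃ R > 0, ∀ y, ηL y (fun u => chi R (V y) u) ≤ α + ε := by
    intro ε hε
    by_contra hcon
    push Not at hcon
    have : α + ε ∈ A := fun R hR => by
      obtain ⟨y, hy⟩ := hcon R hR; exact ⟨y, hy.le⟩
    linarith [le_csSup hb this]
  have hchim : ∀ {R R' : ℝ}, 0 < R → R ≤ R' → ∀ y v, ηL y (fun u => chi R v u) ≤
      ηL y (fun u => chi R' v u) := fun hR hRR y v =>
    SL.mono y _ _ _ _ (Lip.chi hR _) (Lip.chi (hR.trans_le hRR) _) fun u => chi_mono hR hRR _ _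
  have hlim0 : ∀ R : ℝ, 0 < R → ∀ ε > 0, ∃ N, R⁻¹ * (w N + wL N) ≤ ε := by
    intro R hR ε hε
    have := (K.lim.add SL.lim).const_mul R⁻¹
    rw [add_zero, mul_zero] at this
    obtain ⟨N, hN⟩ := (this.eventually (gt_mem_nhds hε)).exists
    exact ⟨N, hN.le⟩
  refine ⟨α, hτ.trans_le hτα, csSup_le ⟨τ, hbig⟩ h1, fun y => ?_⟩
  refine dense_induction {y | ∀ R > 0, α ≤ ηL y (fun u => chi R (V y) u)} ?_ ?_ ?_ y
  · choose z hz using fun k : ℕ => hlow ((k : ℝ) + 1)⁻¹ (by positivity) ((k : ℝ) + 1)⁻¹ (by positivity)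
    obtain ⟨y, hy⟩ := exists_Y_lim z
    refine ⟨y, fun R hR => le_of_forall_pos_le_add fun ε hε => ?_⟩
    obtain ⟨N, hN⟩ := hlim0 R hR (ε / 2) (by linarith)
    have hM : Filter.Tendsto (fun j : ℕ => ((j : ℝ) + 1)⁻¹) UF (nhds 0) := by
      refine Filter.Tendsto.mono_left ?_ uf_le_atTop
      simpa using (tendsto_one_div_add_atTop_nhds_zero_nat (𝕜 := ℝ))
    obtain ⟨k, hk1, hk2, hk3⟩ := ((hM.eventually (gt_mem_nhds (show 0 < ε / 2 by linarith))).and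
      ((hM.eventually (gt_mem_nhds hR)).and (hy N))).exists
    have a1 := chi_osc SL K hR hk3
    have a2 := hchim (R := ((k : ℝ) + 1)⁻¹) (by positivity) hk2.le (z k) (V (z k))
    have a3 := hz k
    linarith
  · intro i y hy R hR
    have hC2 : (0 : ℝ) < C0 ^ 2 := by positivity
    refine le_of_mul_le_mul_left (le_of_forall_pos_le_add fun ε hε => ?_) (hp.pos i)
    obtain ⟨R1, hR1, hR1b⟩ := hup ε hε
    set R2 := min R R1 / C0 ^ 2 with hR2
    have hR2p : 0 < R2 := div_pos (lt_min hR hR1) hC2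
    have hR2e : C0 ^ 2 * R2 = min R R1 := by rw [hR2]; field_simp
    have b1 := hy R2 hR2p
    rw [SL.stat y _ _ (Lip.chi hR2p _), Pn_one] at b1
    have b2 : ∀ i, ηL (scons i y) (fun u => chi R2 (V y) (act (g (scons i y)) u)) ≤
        ηL (scons i y) (fun u => chi (min R R1) (V (scons i y)) u) := fun i => by
      refine SL.mono _ _ _ _ _ ((Lip.chi hR2p _).comp _) (Lip.chi (lt_min hR hR1) _) fun u => ?_
      have := chi_push hC0 hbd K hR2p (scons i y) u
      rwa [hR2e, ssh_scons] at this
    have b3 : ∑ k, p k * ηL (scons k y) (fun u => chi R2 (V y) (act (g (scons k y)) u)) ≤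
        ∑ k, (p k * (α + ε) + if k = i then p i *
          (ηL (scons i y) (fun u => chi R (V (scons i y)) u) - (α + ε)) else 0) := by
      refine Finset.sum_le_sum fun k _ => ?_
      split_ifs with hk
      · subst hk
        have := (b2 k).trans (hchim (lt_min hR hR1) (min_le_left R R1) _ _)
        have := mul_le_mul_of_nonneg_left this (hp.pos k).le
        linarith
      · have := ((b2 k).trans (hchim (lt_min hR hR1) (min_le_right R R1) _ _)).trans (hR1b _)
        have := mul_le_mul_of_nonneg_left this (hp.pos k).le
        linarith
    rw [Finset.sum_add_distrib, ← Finset.sum_mul, hp.sum, Finset.sum_ite_eq' Finset.univ i,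
      if_pos (Finset.mem_univ _)] at b3
    have hpi := hp.pos i
    nlinarith
  · intro y hy R hR
    refine le_of_forall_pos_le_add fun ε hε => ?_
    obtain ⟨N, hN⟩ := hlim0 R hR ε hε
    obtain ⟨y', hy', ha⟩ := hy N
    have a1 := chi_osc SL K hR ha.symm
    have a2 := hy' R hR
    linarith

lemma atom_dom (SL : SF p g wL ηL) {α : ℝ} (hα : 0 < α)
    (hall : ∀ y, ∀ R > 0, α ≤ ηL y (fun u => chi R (V y) u)) (y : Y κ) {f : Q → ℝ} {C : ℝ}
    (hf : Lip C f) (h0 : ∀ u, 0 ≤ f u) : α * f (V y) ≤ ηL y f := by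
  have hC := hf.1
  have key : ∀ R > 0, α * (f (V y) - C * R) ≤ ηL y f := by
    intro R hR
    rcases le_or_gt 0 (f (V y) - C * R) with hs | hs
    · have h1 := SL.mono y (fun u => (f (V y) - C * R) * chi R (V y) u) f _ _
        ((Lip.chi hR _).smul _) hf (fun u => by
          rcases le_or_gt R (dd u (V y)) with hd | hd
          · rw [chi_eq_zero hR _ _ hd, mul_zero]; exact h0 u
          · have a1 := (abs_le.mp (hf.2 u (V y))).1
            have a2 := mul_le_mul_of_nonneg_left hd.le hC
            have a3 := mul_le_mul_of_nonneg_left (chi_le_one hR (V y) u) hs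
            linarith)
      rw [SL.smul _ _ _ _ (Lip.chi hR _)] at h1
      have := mul_le_mul_of_nonneg_left (hall y R hR) hs
      linarith
    · have := SL.nonneg hf h0 y
      nlinarith
  refine le_of_forall_pos_le_add fun ε hε => ?_
  have hpos : 0 < α * C + 1 := by positivity
  have := key (ε / (α * C + 1)) (by positivity)
  have h2 : α * C * (ε / (α * C + 1)) ≤ ε := by
    rw [mul_div_assoc', div_le_iff₀ hpos]; nlinarith
  nlinarith

lemma phi_pair (h : SL2) (u v v' : Q) (hv : dd (act h v) v' = 0) {R B : ℝ} (hR : 0 < R) (hR1 : R ≤ 1)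
    (hB : Real.log (nm h) ≤ B) :
    phi h u + phi h v ≤ Real.log R⁻¹ + 4 * B * chi (2 * R) v' (act h u) := by
  have hl : 0 ≤ Real.log R⁻¹ := Real.log_nonneg ((one_le_inv₀ hR).mpr hR1)
  have hB0 : 0 ≤ B := (Real.log_nonneg (one_le_nm h)).trans hB
  rcases le_or_gt (dd (act h u) v') R with hd | hd
  · have h1 := chi_ge_half hR _ _ hd
    have h2 := phi_le h u
    have h3 := phi_le h v
    nlinarith
  · have h1 := dd_act_exp h u v
    rw [dd_comm (act h u), dd_congr hv, dd_comm v'] at h1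
    have h2 : R < Real.exp (- phi h u - phi h v) := by
      have := mul_le_mul_of_nonneg_right (dd_le_one u v) (Real.exp_pos (- phi h u - phi h v)).le
      linarith
    have h3 := Real.log_lt_log hR h2
    rw [Real.log_exp] at h3
    rw [Real.log_inv]
    have := mul_nonneg (mul_nonneg (by norm_num : (0 : ℝ) ≤ 4) hB0) (chi_nonneg (2 * R) v' (act h u))
    linarith

/-- conclusion of the second phase -/
structure Ph2 (p : Fin κ → ℝ) (g : Y κ → SL2) (η ηL : Y κ → (Q → ℝ) → ℝ) (w : ℕ → ℝ) (V : Y κ → Q)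
    (t ℓ : ℝ) : Prop where
  t0 : 0 ≤ t
  t1 : t < 1
  eq : ∀ y f C, Lip C f → η y f = t * ηL y f + (1 - t) * f (V y)
  sec : Sec g w V
  val : HasVal p (bb g V) ℓ
  neg : ℓ < 0
  small : ∀ τ > 0, ∃ R > 0, ∀ y, ηL y (fun u => chi R (V y) u) ≤ τ

lemma phase2 (D : LD p h g C0 ω δ n) (DL : LD p (fun _ => g) g C0 ω δ n) {L CG : ℝ}
    (G : Gr p g L CG) (y0 : Y κ) {v : ℝ} (hv : v < L) (hval : vlim p h n y0 ≤ v) :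
    ∃ w V t ℓ, Ph2 p g (flim p h n) (flim p (fun _ => g) n) w V t ℓ := by
  have S := flim_SF D
  have SL := flim_SF DL
  have hvη := flim_val D y0
  have hvL := flim_val DL y0
  have hLlow := val_lower DL y0 G
  set η := flim p h n
  set ηL := flim p (fun _ => g) n
  set v1 := vlim p h n y0
  set v2 := vlim p (fun _ => g) n y0
  have hp := D.pv
  have hbd := D.goodg.bd
  have hC0 := D.goodg.one_le hp
  have hl0 : 0 ≤ Real.log C0 := Real.log_nonneg hC0
  obtain ⟨t, ht0, ht1, hdom, hmax⟩ := exists_max S SL y0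
  have ht : t < 1 := by
    refine lt_of_le_of_ne ht1 fun hte => ?_
    subst hte
    have e1 : ∀ y f C, Lip C f → ηL y f ≤ η y f := by
      intro y f C hf
      have h1 := hdom y (fun u => f u + (|f (eb 0)| + C)) _ (hf.add (Lip.const _)) (fun u => by
        linarith [(abs_le.mp (hf.bdd u)).1])
      rw [SL.add_const hf, S.add_const hf] at h1
      linarith
    have e2 : HH g η = HH g ηL := by
      funext y
      refine le_antisymm ?_ (e1 y _ _ (Lip.phi (g y)))
      have h1 := e1 y _ _ (Lip.phi (g y)).neg
      rw [SL.neg (Lip.phi (g y)), S.neg (Lip.phi (g y))] at h1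
      exact neg_le_neg_iff.mp h1
    rw [e2] at hvη
    have := hvη.unique hvL y0
    linarith
  have h1t : 0 < 1 - t := by linarith
  have S' := rem_SF S SL ht0 ht hdom
  have hre : ∀ y f, η y f = t * ηL y f + (1 - t) * rem t η ηL y f := by
    intro y f; unfold rem; field_simp; ring
  obtain ⟨V, hV⟩ := S'.atoms hp (by
    intro c hc
    by_contra hcon
    push Not at hcon
    refine hmax (t + (1 - t) * c) (by nlinarith) fun y f C hf h0 => ?_
    have h1 := dom DL G S' hc hcon y hf h0
    rw [hre y f]
    have := mul_le_mul_of_nonneg_left h1 h1t.le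
    change (1 - t) * (c * ηL y f) ≤ _ at this
    linarith)
  have K := S'.sec hp hV
  set w' : ℕ → ℝ := fun N => (1 - t)⁻¹ * ((1 + t) * ω N)
  have hbb : bb g V = fun y => (1 - t)⁻¹ * HH g η y + (-((1 - t)⁻¹ * t)) * HH g ηL y := by
    funext y
    have := S'.eval hV (Lip.phi (g y)) y
    unfold bb HH
    rw [← this]; unfold rem; ring
  have hℓ := hvη.comb hvL (1 - t)⁻¹ (-((1 - t)⁻¹ * t))
  rw [← hbb] at hℓ
  set ℓ := (1 - t)⁻¹ * v1 + -((1 - t)⁻¹ * t) * v2 with hℓdef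
  have hℓe : (1 - t) * ℓ = v1 - t * v2 := by rw [hℓdef]; field_simp; ring
  have hℓL : ℓ < L := by
    have : (1 - t) * ℓ < (1 - t) * L := by rw [hℓe]; nlinarith
    exact lt_of_mul_lt_mul_left this h1t.le
  have hsmall : ∀ τ > 0, ∃ R > 0, ∀ y, ηL y (fun u => chi R (V y) u) ≤ τ := by
    intro τ hτ
    by_contra hcon
    push Not at hcon
    obtain ⟨α, hα, hα1, hall⟩ := atom_all hp hC0 hbd SL K hτ (fun R hR => by
      obtain ⟨y, hy⟩ := hcon R hR; exact ⟨y, hy.le⟩)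
    set ε := α * (L - ℓ) / 4 with hε
    have hε0 : 0 < ε := by have := sub_pos.mpr hℓL; positivity
    obtain ⟨T1, hT1⟩ := hvL.sum hε0
    obtain ⟨T2, hT2⟩ := hℓ.sum hε0
    obtain ⟨T3, hT3⟩ := G.up ε hε0
    set T := T1 + T2 + T3 + 1 with hT
    have hTp : (0 : ℝ) < T := by rw [hT]; positivity
    have a1 := (abs_le.mp (hT1 T (by omega) y0)).1
    have a2 := (abs_le.mp (hT2 T (by omega) y0)).2
    have a3 := hT3 T (by omega) y0
    rw [← SL.value] at a1
    have a4 : ∑ k ∈ Finset.range T, Pn p (k + 1) (bb g V) y0 =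
        Pn p T (fun z => phi (hc g T z) (V z)) y0 := by
      have : bb g V = HH g (rem t η ηL) := by
        funext y; exact (S'.eval hV (Lip.phi (g y)) y).symm
      rw [this, ← S'.value]
      congr 1; funext z; exact S'.eval hV (Lip.phi _) z
    rw [a4] at a2
    have a5 : ∀ z, ηL z (fun u => phi (hc g T z) u) ≤
        α * phi (hc g T z) (V z) + (1 - α) * Real.log (nm (hc g T z)) := by
      intro z
      have := atom_dom SL hα hall z ((Lip.phi (hc g T z)).neg.add (Lip.const (Real.log (nm (hc g T z)))))
        (fun u => by linarith [phi_le (hc g T z) u])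
      rw [SL.add_const (Lip.phi _).neg, SL.neg (Lip.phi _)] at this
      linarith
    have a6 := Pn_mono hp T a5 y0
    rw [Pn_add_fun, Pn_smul, Pn_smul] at a6
    have b1 := mul_le_mul_of_nonneg_left a2 hα.le
    have b2 := mul_le_mul_of_nonneg_left a3 (show 0 ≤ 1 - α by linarith)
    have b3 := mul_le_mul_of_nonneg_left hLlow hTp.le
    have c1 : (T : ℝ) * (α * (L - ℓ)) ≤ T * (2 * ε) := by nlinarith
    have c2 := le_of_mul_le_mul_left c1 hTp
    linarith
  refine ⟨w', V, t, ℓ, ht0, ht, fun y f C hf => ?_, K, hℓ, ?_, hsmall⟩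
  · rw [hre y f, S'.eval hV hf]
  · by_contra hcon
    push Not at hcon
    set ε := L / 8 with hε
    have hL := G.pos
    have hε0 : 0 < ε := by positivity
    set τ := L / (8 * (4 * Real.log C0 + 1)) with hτ
    have hτ0 : 0 < τ := by positivity
    obtain ⟨R', hR', hR'b⟩ := hsmall τ hτ0
    set R := min 1 (R' / 2) with hR
    have hRp : 0 < R := lt_min one_pos (by linarith)
    have hR1 : R ≤ 1 := min_le_left _ _
    have hR2 : 2 * R ≤ R' := by have := min_le_right 1 (R' / 2); linarith
    have hχ : ∀ y, ηL y (fun u => chi (2 * R) (V y) u) ≤ τ := fun y =>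
      (SL.mono y _ _ _ _ (Lip.chi (by positivity) _) (Lip.chi hR' _)
        (fun u => chi_mono (by positivity) hR2 _ _)).trans (hR'b y)
    obtain ⟨T1, hT1⟩ := hvL.sum hε0
    obtain ⟨T2, hT2⟩ := hℓ.sum hε0
    obtain ⟨T3, hT3⟩ := exists_nat_gt (8 * Real.log R⁻¹ / L)
    set T := T1 + T2 + T3 + 1 with hT
    have hTp : (0 : ℝ) < T := by rw [hT]; positivity
    have hT3' : Real.log R⁻¹ ≤ T * (L / 8) := by
      rw [div_lt_iff₀ hL] at hT3
      have : (T3 : ℝ) ≤ T := by exact_mod_cast (by omega : T3 ≤ T)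
      nlinarith
    have a1 := (abs_le.mp (hT1 T (by omega) y0)).1
    have a2 := (abs_le.mp (hT2 T (by omega) y0)).1
    rw [← SL.value] at a1
    have a4 : ∑ k ∈ Finset.range T, Pn p (k + 1) (bb g V) y0 =
        Pn p T (fun z => phi (hc g T z) (V z)) y0 := by
      have : bb g V = HH g (rem t η ηL) := by
        funext y; exact (S'.eval hV (Lip.phi (g y)) y).symm
      rw [this, ← S'.value]
      congr 1; funext z; exact S'.eval hV (Lip.phi _) z
    rw [a4] at a2
    have h2R : 0 < 2 * R := by positivity
    have a5 : ∀ z, ηL z (fun u => phi (hc g T z) u) + phi (hc g T z) (V z) ≤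
        4 * (T * Real.log C0) * ηL z (fun u => chi (2 * R) (V (shn T z)) (act (hc g T z) u))
          + Real.log R⁻¹ := by
      intro z
      have := SL.mono z (fun u => phi (hc g T z) u + phi (hc g T z) (V z))
        (fun u => 4 * (T * Real.log C0) * chi (2 * R) (V (shn T z)) (act (hc g T z) u)
          + Real.log R⁻¹) _ _ ((Lip.phi _).add (Lip.const _))
        ((((Lip.chi h2R _).comp _).smul _).add (Lip.const _)) (fun u => by
          have := phi_pair (hc g T z) u (V z) (V (shn T z)) (K.iter T z) hRp hR1
            (log_nm_hc_le g hbd T z)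
          linarith)
      rw [SL.add_const (Lip.phi _), SL.add_const (((Lip.chi h2R _).comp _).smul _),
        SL.smul _ _ _ _ ((Lip.chi h2R _).comp _)] at this
      exact this
    have a6 := Pn_mono hp T a5 y0
    rw [Pn_add_fun, Pn_add_fun, Pn_smul, Pn_const hp,
      Pn_freeze T (fun z y => ηL z (fun u => chi (2 * R) (V y) (act (hc g T z) u))),
      ← SL.iter T y0 (Lip.chi h2R (V y0))] at a6
    have b1 : 4 * (T * Real.log C0) * ηL y0 (fun u => chi (2 * R) (V y0) u) ≤ T * (L / 8) := by
      have c1 := mul_le_mul_of_nonneg_left (hχ y0) (show 0 ≤ 4 * (T * Real.log C0) by positivity)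
      have c2 : 4 * Real.log C0 * τ ≤ L / 8 := by
        rw [hτ, mul_div_assoc', div_le_div_iff₀ (by positivity) (by norm_num)]
        nlinarith
      have c3 := mul_le_mul_of_nonneg_left c2 hTp.le
      linarith
    have b3 := mul_le_mul_of_nonneg_left hLlow hTp.le
    have b4 := mul_nonneg hTp.le hcon
    nlinarith

end Ph2

/-! ### Part 8: escape of mass estimate -/

section Ph3
variable {κ : ℕ} {p : Fin κ → ℝ}

/-- backward trajectory of the section -/
def sb (G : Y κ → SL2) (V : Y κ → Q) (k : ℕ) (x : Y κ) : Q := act (hc G k x)⁻¹ (V (shn k x))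

lemma sb_zero (G : Y κ → SL2) (V : Y κ → Q) (x : Y κ) : sb G V 0 x = V x := by
  simp [sb, hc_zero, act_one, shn_zero]

lemma sb_step (G : Y κ → SL2) (V : Y κ → Q) (k : ℕ) (x : Y κ) :
    act (G x) (sb G V (k + 1) x) = sb G V k (ssh x) := by
  unfold sb
  rw [hc_succ, mul_inv_rev, act_mul, act_act_inv, shn_succ]

/-- log contraction -/
def XX (g : Y κ → SL2) (V : Y κ → Q) (β : ℝ) (k : ℕ) (z : Y κ) : ℝ :=
  ∑ i ∈ Finset.range k, (2 * bb g V (shn i z) + β)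

lemma XX_succ (g : Y κ → SL2) (V : Y κ → Q) (β : ℝ) (k : ℕ) (z : Y κ) :
    XX g V β (k + 1) z = XX g V β k (ssh z) + (2 * bb g V z + β) := by
  unfold XX
  rw [Finset.sum_range_succ', shn_zero]
  simp only [shn_succ]

lemma XX_add (g : Y κ → SL2) (V : Y κ → Q) (β : ℝ) (m n : ℕ) (z : Y κ) :
    XX g V β (m + n) z = XX g V β m z + XX g V β n (shn m z) := by
  unfold XX
  rw [Finset.sum_range_add]
  simp only [shn_shn, Nat.add_comm]

/-- local setting for a perturbation -/
structure Loc (G g : Y κ → SL2) (V : Y κ → Q) (w : ℕ → ℝ) (C0 d β R : ℝ) : Prop where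
  C1 : 1 ≤ C0
  bdG : ∀ z, nm (G z) ≤ C0
  bdg : ∀ z, nm (g z) ≤ C0
  cl : ∀ z, gd (G z) (g z) ≤ d
  sec : Sec g w V
  R0 : 0 < R
  dR : d * C0 ≤ R
  hβ : 4 * C0 ^ 4 * R + 2 * (d * C0) ≤ β

variable {G g : Y κ → SL2} {V : Y κ → Q} {w : ℕ → ℝ} {C0 d β R : ℝ}

lemma loc_back1 (C1 : 1 ≤ C0) (bdG : ∀ z, nm (G z) ≤ C0) (bdg : ∀ z, nm (g z) ≤ C0)
    (cl : ∀ z, gd (G z) (g z) ≤ d) (sec : Sec g w V) (x : Y κ) (u : Q) :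
    dd u (V x) ≤ C0 ^ 2 * (dd (act (G x) u) (V (ssh x)) + d * C0) := by
  have h1 := dd_le_act (G x) u (V x)
  have h2 := dd_triangle (act (G x) u) (V (ssh x)) (act (G x) (V x))
  have h3 := dd_triangle (V (ssh x)) (act (g x) (V x)) (act (G x) (V x))
  rw [dd_comm (V (ssh x)) (act (g x) (V x)), sec.eq, zero_add, dd_comm (act (g x) (V x)) (act (G x) (V x))] at h3
  have h4 : gd (G x) (g x) * nm (g x) ≤ d * C0 :=
    mul_le_mul (cl x) (bdg x) (nm_nonneg _) ((gd_nonneg _ _).trans (cl x))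
  have h5 := dd_act_act_le (G x) (g x) (V x)
  have h6 : nm (G x) ^ 2 ≤ C0 ^ 2 := by have := nm_nonneg (G x); gcongr; exact bdG x
  calc dd u (V x) ≤ _ := h1
    _ ≤ _ := mul_le_mul h6 (by linarith) (dd_nonneg _ _) (by positivity)

lemma Loc.back1 (A : Loc G g V w C0 d β R) (x : Y κ) (u : Q)
    (hu : dd (act (G x) u) (V (ssh x)) ≤ R) : dd u (V x) ≤ 2 * C0 ^ 2 * R := by
  have h1 := loc_back1 A.C1 A.bdG A.bdg A.cl A.sec x u
  have h2 := A.dR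
  have : C0 ^ 2 * (dd (act (G x) u) (V (ssh x)) + d * C0) ≤ C0 ^ 2 * (R + R) := by gcongr
  linarith

lemma Loc.expand (A : Loc G g V w C0 d β R) (x : Y κ) (u v : Q) (hu : dd u (V x) ≤ 2 * C0 ^ 2 * R)
    (hv : dd v (V x) ≤ 2 * C0 ^ 2 * R) :
    dd u v ≤ dd (act (G x) u) (act (G x) v) * Real.exp (2 * bb g V x + β) := by
  have key : ∀ u, dd u (V x) ≤ 2 * C0 ^ 2 * R →
      phi (G x) u ≤ bb g V x + 2 * C0 ^ 4 * R + d * C0 := by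
    intro u hu
    have h1 := phi_sub_gd_le (G x) (g x) u
    have h4 : gd (G x) (g x) * nm (g x) ≤ d * C0 :=
      mul_le_mul (A.cl x) (A.bdg x) (nm_nonneg _) ((gd_nonneg _ _).trans (A.cl x))
    have h2 := phi_sub_le (g x) u (V x)
    have h6 : nm (g x) ^ 2 ≤ C0 ^ 2 := by have := nm_nonneg (g x); gcongr; exact A.bdg x
    have h7 : nm (g x) ^ 2 * dd u (V x) ≤ C0 ^ 2 * (2 * C0 ^ 2 * R) :=
      mul_le_mul h6 hu (dd_nonneg _ _) (by positivity)
    unfold bb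
    nlinarith
  have h1 := key u hu
  have h2 := key v hv
  have h3 := A.hβ
  rw [dd_act_exp, mul_assoc, ← Real.exp_add]
  have : 1 ≤ Real.exp (-phi (G x) u - phi (G x) v + (2 * bb g V x + β)) :=
    Real.one_le_exp (by linarith)
  nlinarith [dd_nonneg u v]

lemma Loc.back (A : Loc G g V w C0 d β R) (k : ℕ) (x : Y κ) (u : Q)
    (h0 : dd (act (hc G k x) u) (V (shn k x)) ≤ R)
    (h : ∀ m, 1 ≤ m → m ≤ k → dd (act (hc G m x) u) (V (shn m x)) ≤ R ∧
      dd (sb G V (k - m) (shn m x)) (V (shn m x)) ≤ R) :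
    dd u (sb G V k x) ≤ R * Real.exp (XX g V β k x) ∧
      (1 ≤ k → dd u (V x) ≤ 2 * C0 ^ 2 * R) := by
  induction k generalizing x u with
  | zero =>
    rw [hc_zero, act_one, shn_zero] at h0
    rw [sb_zero]
    simp only [XX, Finset.range_zero, Finset.sum_empty, Real.exp_zero, mul_one]
    exact ⟨h0, fun h => by omega⟩
  | succ k ih =>
    have h1 := h 1 le_rfl (by omega)
    rw [hc_one, shn_one, Nat.add_sub_cancel] at h1
    have hs := h1.2
    rw [← sb_step] at hs
    have hu0 := A.back1 x u h1.1
    have hs0 := A.back1 x _ hs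
    refine ⟨?_, fun _ => hu0⟩
    have h2 := (ih (ssh x) (act (G x) u) (by
        rw [hc_succ, act_mul, shn_succ] at h0; exact h0) (fun m hm1 hm2 => by
        have := h (m + 1) (by omega) (by omega)
        rw [hc_succ, act_mul, shn_succ, Nat.add_sub_add_right] at this
        exact this)).1
    have h3 := A.expand x u _ hu0 hs0
    rw [sb_step] at h3
    rw [XX_succ, Real.exp_add, ← mul_assoc]
    exact h3.trans (mul_le_mul_of_nonneg_right h2 (Real.exp_pos _).le)

/-- first exit event -/
def EE (G : Y κ → SL2) (V : Y κ → Q) (r : ℝ) (k : ℕ) (x : Y κ) : Prop :=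
  r < dd (sb G V k x) (V x) ∧ ∀ m < k, dd (sb G V m (shn (k - m) x)) (V (shn (k - m) x)) ≤ r

lemma Loc.cases (A : Loc G g V w C0 d β R) (K0 : ℕ)
    (hK0 : ∀ k ≤ K0, ∀ x, dd (sb G V k x) (V x) ≤ R / 2) (t : ℕ) (z : Y κ) (u : Q)
    (hu : dd (act (hc G t z) u) (V (shn t z)) ≤ R) :
    (1 / 4 ≤ Real.exp (XX g V β t z)) ∨ (dd u (sb G V t z) ≤ R / 4) ∨
    (∃ k ≤ t, k ≤ K0 ∧ R / 4 ≤ dd (act (hc G (t - k) z) u) (V (shn (t - k) z)) ∧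
      dd (act (hc G (t - k) z) u) (V (shn (t - k) z)) ≤ 2 * C0 ^ 2 * R) ∨
    (∃ k ≤ t, K0 < k ∧ 1 / 4 ≤ Real.exp (XX g V β k (shn (t - k) z))) ∨
    (∃ k ≤ t, EE G V (R / 2) k (shn (t - k) z) ∧
      R / 4 ≤ dd (act (hc G (t - k) z) u) (V (shn (t - k) z)) ∧
      dd (act (hc G (t - k) z) u) (V (shn (t - k) z)) ≤ 2 * C0 ^ 2 * R) := by
  have hR := A.R0
  by_cases hex : ∃ k, 1 ≤ k ∧ k ≤ t ∧ ¬ (dd (act (hc G (t - k) z) u) (V (shn (t - k) z)) ≤ R ∧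
      dd (sb G V k (shn (t - k) z)) (V (shn (t - k) z)) ≤ R / 2)
  · classical
    obtain ⟨hk1, hkt, hk⟩ := Nat.find_spec hex
    have hmin := fun m (hm : m < Nat.find hex) => Nat.find_min hex hm
    set k := Nat.find hex with hkdef
    have hin : ∀ m, m < k → dd (act (hc G (t - m) z) u) (V (shn (t - m) z)) ≤ R ∧
        dd (sb G V m (shn (t - m) z)) (V (shn (t - m) z)) ≤ R / 2 := by
      intro m hm
      rcases Nat.eq_zero_or_pos m with rfl | hm0
      · rw [sb_zero, dd_self]; exact ⟨hu, by linarith⟩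
      · have := hmin m hm
        push Not at this
        by_contra hcon
        exact hcon (by
          have h5 := this hm0 (by omega)
          by_contra hc2
          rw [not_and] at hc2
          have h6 : dd (act (hc G (t - m) z) u) (V (shn (t - m) z)) ≤ R := by
            by_contra h7
            exact hmin m hm ⟨hm0, by omega, fun h => h7 h.1⟩
          exact (hc2 h6) (by
            by_contra h7
            exact hmin m hm ⟨hm0, by omega, fun h => h7 h.2⟩))
    set x := shn (t - k) z with hx
    set u' := act (hc G (t - k) z) u with hu'
    have hact : ∀ m ≤ k, act (hc G m x) u' = act (hc G (t - (k - m)) z) u := by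
      intro m hm
      rw [hu', ← act_mul, hx, ← hc_add]
      congr 2; omega
    have hsh : ∀ m ≤ k, shn m x = shn (t - (k - m)) z := by
      intro m hm
      rw [hx, shn_shn]; congr 1; omega
    have hb := A.back k x u' (by
      rw [hact k le_rfl, hsh k le_rfl]; simpa using hu) (fun m hm1 hm2 => by
      rw [hact m hm2, hsh m hm2]
      have := hin (k - m) (by omega)
      exact ⟨this.1, this.2.trans (by linarith)⟩)
    have hb2 := hb.2 hk1
    have hb1 := hb.1
    rw [not_and_or] at hk
    by_cases hs : dd (sb G V k x) (V x) ≤ R / 2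
    · have hur : R < dd u' (V x) := by
        rcases hk with hk | hk
        · exact not_le.mp hk
        · exact absurd hs hk
      rcases le_or_gt k K0 with hkK | hkK
      · exact Or.inr (Or.inr (Or.inl ⟨k, hkt, hkK, by linarith, hb2⟩))
      · refine Or.inr (Or.inr (Or.inr (Or.inl ⟨k, hkt, hkK, ?_⟩)))
        have := dd_triangle u' (sb G V k x) (V x)
        nlinarith
    · push Not at hs
      have hkK : K0 < k := by
        by_contra hcon
        push Not at hcon
        linarith [hK0 k hcon x]
      rcases le_or_gt (R / 4) (dd u' (V x)) with hr | hr
      · refine Or.inr (Or.inr (Or.inr (Or.inr ⟨k, hkt, ⟨hs, fun m hm => ?_⟩, hr, hb2⟩)))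
        have := (hin m hm).2
        rw [hsh (k - m) (by omega)]
        rwa [show t - (k - (k - m)) = t - m by omega]
      · refine Or.inr (Or.inr (Or.inr (Or.inl ⟨k, hkt, hkK, ?_⟩)))
        have := dd_triangle (sb G V k x) u' (V x)
        rw [dd_comm (sb G V k x) u'] at this
        nlinarith
  · push Not at hex
    have hin : ∀ m, m ≤ t → dd (act (hc G (t - m) z) u) (V (shn (t - m) z)) ≤ R ∧
        dd (sb G V m (shn (t - m) z)) (V (shn (t - m) z)) ≤ R / 2 := by
      intro m hm
      rcases Nat.eq_zero_or_pos m with rfl | hm0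
      · rw [sb_zero, dd_self]; exact ⟨hu, by linarith⟩
      · exact hex m hm0 hm
    have hb := (A.back t z u hu (fun m hm1 hm2 => by
      have := hin (t - m) (by omega)
      rw [show t - (t - m) = m by omega] at this
      exact ⟨this.1, this.2.trans (by linarith)⟩)).1
    rcases le_or_gt (1 / 4) (Real.exp (XX g V β t z)) with h1 | h1
    · exact Or.inl h1
    · exact Or.inr (Or.inl (by nlinarith))

lemma first_sum (P : ℕ → Prop) [DecidablePred fun k => P k ∧ ∀ m < k, ¬ P m] (n : ℕ) :
    ∑ k ∈ Finset.range n, (if P k ∧ ∀ m < k, ¬ P m then (1 : ℝ) else 0) ≤ 1 := by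
  rw [Finset.sum_boole]
  have : (Finset.filter (fun k => P k ∧ ∀ m < k, ¬ P m) (Finset.range n)).card ≤ 1 := by
    rw [Finset.card_le_one]
    intro a ha b hb
    rw [Finset.mem_filter] at ha hb
    rcases lt_trichotomy a b with h | h | h
    · exact absurd ha.2.1 (hb.2.2 a h)
    · exact h
    · exact absurd hb.2.1 (ha.2.2 b h)
  exact_mod_cast this

open Classical in
lemma EE_sum (hp : PV p) (G : Y κ → SL2) (V : Y κ → Q) (r : ℝ) (n : ℕ) (y : Y κ) :
    ∑ k ∈ Finset.range n, Pn p k (fun x => if EE G V r k x then (1 : ℝ) else 0) y ≤ 1 := by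
  have h1 : ∀ k ∈ Finset.range n, Pn p k (fun x => if EE G V r k x then (1 : ℝ) else 0) y =
      Pn p n (fun z => if EE G V r k (shn (n - k) z) then (1 : ℝ) else 0) y := by
    intro k hk
    have hk' : k < n := Finset.mem_range.mp hk
    conv_rhs => rw [show n = k + (n - k) by omega, Pn_add]
    congr 1
    funext x
    rw [show k + (n - k) - k = n - k by omega]
    exact (Pn_comp hp (n - k) (fun x => if EE G V r k x then (1 : ℝ) else 0) x).symm
  rw [Finset.sum_congr rfl h1, ← Pn_sum]
  refine Pn_le hp n (fun z => ?_) y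
  refine le_trans (Finset.sum_le_sum fun k hk => ?_)
    (first_sum (fun m => r < dd (sb G V m (shn (n - m) z)) (V (shn (n - m) z))) n)
  have hk' : k < n := Finset.mem_range.mp hk
  refine le_of_eq (if_congr ?_ rfl rfl)
  unfold EE
  refine and_congr Iff.rfl (forall_congr' fun m => forall_congr' fun hm => ?_)
  rw [shn_shn, show k - m + (n - k) = n - m by omega, not_lt]

/-- annulus bump -/
def ann (a b : ℝ) (v u : Q) : ℝ := 2 * chi b v u + (-2) * chi a v u

lemma ann_nonneg {a b : ℝ} (ha : 0 < a) (hab : a ≤ b) (v u : Q) : 0 ≤ ann a b v u := by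
  have := chi_mono ha hab v u; unfold ann; linarith

lemma ann_ge {a b : ℝ} (ha : 0 < a) (hb : 0 < b) (v u : Q) (h1 : a ≤ dd u v) (h2 : dd u v ≤ b) :
    1 ≤ ann a (2 * b) v u := by
  have := chi_ge_half hb v u h2
  unfold ann; rw [chi_eq_zero ha v u h1]; linarith

lemma Lip.ann {a b : ℝ} (ha : 0 < a) (hb : 0 < b) (v : Q) :
    Lip (2 * b⁻¹ + 2 * a⁻¹) (fun u => ann a b v u) := by
  have := ((Lip.chi hb v).smul 2).add ((Lip.chi ha v).smul (-2))
  simpa [_root_.ann] using this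

lemma ann_lip_v {a b : ℝ} (ha : 0 < a) (hb : 0 < b) (v v' u : Q) :
    ann a b v u ≤ ann a b v' u + (2 * b⁻¹ + 2 * a⁻¹) * dd v v' := by
  have h1 := (abs_le.mp (chi_lip_v hb v v' u)).2
  have h2 := (abs_le.mp (chi_lip_v ha v v' u)).1
  unfold ann; linarith

end Ph3

/-! ### Part 9: conclusion of the abstract argument -/

section Ph4
variable {κ : ℕ} {p : Fin κ → ℝ}
variable {G g : Y κ → SL2} {V : Y κ → Q} {w : ℕ → ℝ} {C0 d β R : ℝ}

lemma Pn_comp_le (hp : PV p) {t k : ℕ} (hk : k ≤ t) (K : Y κ → ℝ) (y : Y κ) :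
    Pn p t (fun z => K (shn (t - k) z)) y = Pn p k K y := by
  conv_lhs => rw [show t = k + (t - k) by omega, Pn_add]
  congr 1
  funext x
  rw [show k + (t - k) - k = t - k by omega]
  exact Pn_comp hp (t - k) K x

lemma Pn_freeze_le {t k : ℕ} (hk : k ≤ t) (K : Y κ → Y κ → ℝ) (y : Y κ) :
    Pn p t (fun z => K z (shn (t - k) z)) y = Pn p k (fun x => Pn p (t - k) (fun z => K z x) x) y := by
  conv_lhs => rw [show t = k + (t - k) by omega, Pn_add]
  congr 1
  funext x
  rw [show k + (t - k) - k = t - k by omega]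
  exact Pn_freeze (t - k) K x

lemma Pn_bb_sum (hp : PV p) (F : Y κ → ℝ) (N : ℕ) (y : Y κ) :
    Pn p N (fun z => ∑ i ∈ Finset.range N, F (shn i z)) y
      = ∑ k ∈ Finset.range N, Pn p (k + 1) F y := by
  rw [Pn_sum, ← Finset.sum_range_reflect]
  refine Finset.sum_congr rfl fun k hk => ?_
  have hk' := Finset.mem_range.mp hk
  have := Pn_comp_le hp (t := N) (k := k + 1) (by omega) F y
  rw [← this, show N - 1 - k = N - (k + 1) by omega]

lemma XX_ld (hp : PV p) (C1 : 1 ≤ C0) (bdg : ∀ z, nm (g z) ≤ C0) {ℓ : ℝ}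
    (val : HasVal p (bb g V) ℓ) (neg : ℓ < 0) :
    ∃ s c K : ℝ, 0 < s ∧ 0 < c ∧ c < 1 ∧ 0 < K ∧
      ∀ n y, Pn p n (fun z => Real.exp (s * XX g V (-ℓ / 2) n z)) y ≤ K * c ^ n := by
  obtain ⟨T0, hT0⟩ := val.sum (ε := -ℓ / 4) (by linarith)
  have hl : 0 ≤ Real.log C0 := Real.log_nonneg C1
  have hbb : ∀ z, |bb g V z| ≤ Real.log C0 := fun z =>
    (abs_phi_le _ _).trans (Real.log_le_log (nm_pos _) (bdg z))
  set B := 2 * Real.log C0 + (-ℓ / 2) with hB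
  have hterm : ∀ z, |2 * bb g V z + -ℓ / 2| ≤ B := fun z => by
    have := abs_le.mp (hbb z)
    rw [abs_le]; constructor <;> linarith
  refine ld_lemma hp (XX g V (-ℓ / 2)) (fun m n z => (XX_add _ _ _ m n z).le)
    (fun z => by simp [XX]) B (by linarith) (T0 + 1) (by omega) (fun z => ?_) (fun z => ?_) (-ℓ)
    (by linarith) (fun y => ?_)
  · unfold XX
    refine (Finset.abs_sum_le_sum_abs _ _).trans ?_
    refine (Finset.sum_le_sum fun i _ => hterm _).trans ?_
    simp
  · unfold XX
    simp only [Finset.range_one, Finset.sum_singleton]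
    exact (abs_le.mp (hterm _)).2
  · have h1 := hT0 (T0 + 1) (by omega) y
    rw [← Pn_bb_sum hp] at h1
    have h2 : Pn p (T0 + 1) (XX g V (-ℓ / 2) (T0 + 1)) y = 2 * Pn p (T0 + 1)
        (fun z => ∑ i ∈ Finset.range (T0 + 1), bb g V (shn i z)) y + ((T0 + 1 : ℕ) : ℝ) * (-ℓ / 2) := by
      rw [← Pn_smul, ← Pn_const hp (T0 + 1) (((T0 + 1 : ℕ) : ℝ) * (-ℓ / 2)) y, ← Pn_add_fun]
      congr 1
      funext z
      unfold XX
      rw [Finset.sum_add_distrib, ← Finset.mul_sum]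
      simp
    rw [h2]
    have := (abs_le.mp h1).2
    nlinarith

lemma geom_bound {c : ℝ} (h0 : 0 < c) (h1 : c < 1) (N : ℕ) :
    ∑ k ∈ Finset.range N, c ^ k ≤ (1 - c)⁻¹ := by
  rw [← tsum_geometric_of_lt_one h0.le h1]
  exact (summable_geometric_of_lt_one h0.le h1).sum_le_tsum _ (fun i _ => by positivity)

lemma geom_tail {c : ℝ} (h0 : 0 < c) (h1 : c < 1) (K0 N : ℕ) :
    ∑ k ∈ Finset.range N, (if K0 < k then c ^ k else 0) ≤ c ^ K0 * (1 - c)⁻¹ := by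
  refine le_trans ?_ (mul_le_mul_of_nonneg_left (geom_bound h0 h1 (N - K0)) (by positivity))
  rw [Finset.mul_sum, ← Finset.sum_filter]
  simp only [← pow_add]
  rw [← Finset.sum_Ico_eq_sum_range (fun k => c ^ k)]
  refine Finset.sum_le_sum_of_subset_of_nonneg (fun k hk => ?_) (fun i _ _ => by positivity)
  simp only [Finset.mem_filter, Finset.mem_range] at hk
  simp only [Finset.mem_Ico]; omega

open Classical in
lemma Loc.fam (hp : PV p) (A : Loc G g V w C0 d β R) (K0 : ℕ)
    (hK0 : ∀ k ≤ K0, ∀ x, dd (sb G V k x) (V x) ≤ R / 2) {s c K : ℝ} (hs : 0 < s) (hc0 : 0 < c)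
    (hc1 : c < 1) (hK : 0 < K)
    (hld : ∀ n y, Pn p n (fun z => Real.exp (s * XX g V β n z)) y ≤ K * c ^ n)
    {n M : ℕ} (hn : 0 < n) (hM : 0 < M) {Fm : ℝ}
    (hF : ∀ x, Fam p G n M x (fun u => ann (R / 4) (2 * (2 * C0 ^ 2 * R)) (V x) u) ≤ Fm) (y : Y κ) :
    Fam p G n M y (fun u => chi R (V y) u) ≤
      Real.exp (s * Real.log 4) * K * (1 - c)⁻¹ * (n : ℝ)⁻¹ + (R + (M : ℝ)⁻¹)
      + Real.exp (s * Real.log 4) * K * (c ^ K0 * (1 - c)⁻¹) + (K0 + 2) * Fm := by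
  have hR := A.R0
  have hC1 := A.C1
  have hn' : (0 : ℝ) < n := by exact_mod_cast hn
  set Cq := Real.exp (s * Real.log 4) * K with hCq
  have hCq0 : 0 < Cq := by positivity
  have hc1' : 0 < 1 - c := by linarith
  set q : ℕ → Y κ → ℝ := fun k x => Real.exp (s * Real.log 4) * Real.exp (s * XX g V β k x) with hq
  have hq0 : ∀ k x, 0 ≤ q k x := fun k x => by positivity
  have hq1 : ∀ k x, 1 / 4 ≤ Real.exp (XX g V β k x) → 1 ≤ q k x := by
    intro k x hx
    simp only [hq]
    rw [← Real.exp_add, ← mul_add]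
    refine Real.one_le_exp (mul_nonneg hs.le ?_)
    have := Real.log_le_log (by norm_num) hx
    rw [Real.log_exp, one_div, Real.log_inv] at this
    linarith
  have hqP : ∀ k x, Pn p k (q k) x ≤ Cq * c ^ k := by
    intro k x
    simp only [hq]
    rw [Pn_smul, hCq, mul_assoc]
    exact mul_le_mul_of_nonneg_left (hld k x) (by positivity)
  set F : Y κ → Q → ℝ := fun x u => ann (R / 4) (2 * (2 * C0 ^ 2 * R)) (V x) u with hFdef
  have hC2 : 1 ≤ C0 ^ 2 := one_le_pow₀ hC1
  have hCR : R ≤ C0 ^ 2 * R := le_mul_of_one_le_left hR.le hC2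
  have hF0 : ∀ x u, 0 ≤ F x u := fun x u => ann_nonneg (by linarith) (by linarith) _ _
  have hF1 : ∀ x u, R / 4 ≤ dd u (V x) → dd u (V x) ≤ 2 * C0 ^ 2 * R → 1 ≤ F x u :=
    fun x u h1 h2 => ann_ge (by linarith) (by linarith) _ _ h1 h2
  set ck : ℕ → Y κ → ℝ := fun k x => (if k ≤ K0 then 1 else 0) + (if EE G V (R / 2) k x then 1 else 0)
    with hck
  have hck0 : ∀ k x, 0 ≤ ck k x := fun k x => by
    simp only [hck]; split_ifs <;> norm_num
  -- pointwise bound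
  have hpt : ∀ t z u, chi R (V (shn t z)) (act (hc G t z) u) ≤
      q t z + (if dd u (sb G V t z) ≤ R / 4 then 1 else 0)
      + ∑ k ∈ Finset.range (t + 1), (if K0 < k then q k (shn (t - k) z) else 0)
      + ∑ k ∈ Finset.range (t + 1), ck k (shn (t - k) z) * F (shn (t - k) z) (act (hc G (t - k) z) u) := by
    intro t z u
    have e1 := hq0 t z
    have e2 : (0 : ℝ) ≤ (if dd u (sb G V t z) ≤ R / 4 then 1 else 0) := by split_ifs <;> norm_num
    have e3k : ∀ k ∈ Finset.range (t + 1), (0 : ℝ) ≤ (if K0 < k then q k (shn (t - k) z) else 0) := by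
      intro k _; split_ifs
      · exact hq0 _ _
      · exact le_rfl
    have e3 := Finset.sum_nonneg e3k
    have e4k : ∀ k ∈ Finset.range (t + 1), 0 ≤ ck k (shn (t - k) z) * F (shn (t - k) z) (act (hc G (t - k) z) u) :=
      fun k _ => mul_nonneg (hck0 _ _) (hF0 _ _)
    have e4 := Finset.sum_nonneg e4k
    rcases lt_or_ge R (dd (act (hc G t z) u) (V (shn t z))) with h | h
    · rw [chi_eq_zero hR _ _ h.le]; positivity
    refine (chi_le_one hR _ _).trans ?_
    rcases A.cases K0 hK0 t z u h with h | h | ⟨k, hk, hk2, ha, hb⟩ | ⟨k, hk, hk2, h⟩ | ⟨k, hk, hk2, ha, hb⟩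
    · linarith [hq1 _ _ h]
    · rw [if_pos h]; linarith
    · have h5 := Finset.single_le_sum e4k (Finset.mem_range.mpr (Nat.lt_succ_of_le hk))
      have h6 := hF1 _ _ ha hb
      have h7 : 1 ≤ ck k (shn (t - k) z) := by
        simp only [hck]; rw [if_pos hk2]; split_ifs <;> norm_num
      have := one_le_mul_of_one_le_of_one_le h7 h6
      linarith
    · have h5 := Finset.single_le_sum e3k (Finset.mem_range.mpr (Nat.lt_succ_of_le hk))
      rw [if_pos hk2] at h5
      linarith [hq1 _ _ h]
    · have h5 := Finset.single_le_sum e4k (Finset.mem_range.mpr (Nat.lt_succ_of_le hk))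
      have h6 := hF1 _ _ ha hb
      have h7 : 1 ≤ ck k (shn (t - k) z) := by
        simp only [hck]; rw [if_pos hk2]; split_ifs <;> norm_num
      have := one_le_mul_of_one_le_of_one_le h7 h6
      linarith
  -- grid average
  have hgav : ∀ t z, gav M (fun u => chi R (V (shn t z)) (act (hc G t z) u)) ≤
      q t z + (R + (M : ℝ)⁻¹)
      + ∑ k ∈ Finset.range (t + 1), (if K0 < k then q k (shn (t - k) z) else 0)
      + ∑ k ∈ Finset.range (t + 1),
        ck k (shn (t - k) z) * gav M (fun u => F (shn (t - k) z) (act (hc G (t - k) z) u)) := by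
    intro t z
    refine (gav_mono M _ _ (hpt t z)).trans ?_
    rw [gav_add, gav_add, gav_add, gav_const M hM, gav_const M hM, gav_sum]
    simp only [gav_smul]
    have := grid_bound M hM (sb G V t z) (R / 4) (by linarith)
    linarith
  set a : ℕ → Y κ → ℝ := fun i x => Pn p i (fun z => gav M (fun u => F x (act (hc G i z) u))) x with ha
  have ha0 : ∀ i x, 0 ≤ a i x := fun i x => le_Pn hp i (fun z => by
    have := gav_mono M (fun _ => 0) (fun u => F x (act (hc G i z) u)) (fun u => hF0 _ _)
    rwa [gav_const M hM] at this) x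
  have hasum : ∀ x, ∑ i ∈ Finset.range n, a i x ≤ n * Fm := by
    intro x
    have := hF x
    unfold Fam at this
    rwa [inv_mul_le_iff₀ hn'] at this
  have hFm : 0 ≤ Fm := by
    have := (Finset.sum_nonneg fun i (_ : i ∈ Finset.range n) => ha0 i y).trans (hasum y)
    exact nonneg_of_mul_nonneg_right this hn'
  -- time t
  have hPt : ∀ t, Pn p t (fun z => gav M (fun u => chi R (V y) (act (hc G t z) u))) y ≤
      Cq * c ^ t + (R + (M : ℝ)⁻¹) + Cq * (c ^ K0 * (1 - c)⁻¹)
      + ∑ k ∈ Finset.range (t + 1), Pn p k (fun x => ck k x * a (t - k) x) y := by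
    intro t
    rw [← Pn_freeze t (fun z y => gav M (fun u => chi R (V y) (act (hc G t z) u))) y]
    refine (Pn_mono hp t (hgav t) y).trans ?_
    rw [Pn_add_fun, Pn_add_fun, Pn_add_fun, Pn_const hp, Pn_sum, Pn_sum]
    have t1 := hqP t y
    have t2 : ∑ k ∈ Finset.range (t + 1), Pn p t (fun z => if K0 < k then q k (shn (t - k) z) else 0) y
        ≤ Cq * (c ^ K0 * (1 - c)⁻¹) := by
      refine le_trans ?_ (mul_le_mul_of_nonneg_left (geom_tail hc0 hc1 K0 (t + 1)) hCq0.le)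
      rw [Finset.mul_sum]
      refine Finset.sum_le_sum fun k hk => ?_
      have hk' := Finset.mem_range.mp hk
      split_ifs
      · rw [Pn_comp_le hp (by omega)]; exact hqP k y
      · rw [Pn_const hp, mul_zero]
    have t3 : ∀ k ∈ Finset.range (t + 1), Pn p t (fun z => ck k (shn (t - k) z) *
        gav M (fun u => F (shn (t - k) z) (act (hc G (t - k) z) u))) y
        = Pn p k (fun x => ck k x * a (t - k) x) y := by
      intro k hk
      have hk' := Finset.mem_range.mp hk
      rw [Pn_freeze_le (by omega) (fun z x => ck k x * gav M (fun u => F x (act (hc G (t - k) z) u)))]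
      simp only [Pn_smul, ha]
    rw [Finset.sum_congr rfl t3]
    linarith
  -- total
  unfold Fam
  rw [inv_mul_le_iff₀ hn']
  refine (Finset.sum_le_sum fun t _ => hPt t).trans ?_
  rw [Finset.sum_add_distrib, Finset.sum_add_distrib, Finset.sum_add_distrib]
  have s1 : ∑ t ∈ Finset.range n, Cq * c ^ t ≤ Cq * (1 - c)⁻¹ := by
    rw [← Finset.mul_sum]; exact mul_le_mul_of_nonneg_left (geom_bound hc0 hc1 n) hCq0.le
  have s4 : ∑ t ∈ Finset.range n, ∑ k ∈ Finset.range (t + 1), Pn p k (fun x => ck k x * a (t - k) x) y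
      ≤ n * ((K0 + 2) * Fm) := by
    rw [Finset.sum_range_diag_flip n (fun k i => Pn p k (fun x => ck k x * a i x) y)]
    have h1 : ∀ k ∈ Finset.range n, ∑ i ∈ Finset.range (n - k), Pn p k (fun x => ck k x * a i x) y
        ≤ (n * Fm) * Pn p k (ck k) y := by
      intro k hk
      rw [← Pn_sum, ← Pn_smul]
      refine Pn_mono hp k (fun x => ?_) y
      rw [← Finset.mul_sum, mul_comm]
      refine mul_le_mul_of_nonneg_right ?_ (hck0 k x)
      refine le_trans (Finset.sum_le_sum_of_subset_of_nonneg (fun i hi => ?_) (fun i _ _ => ha0 i x)) (hasum x)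
      simp only [Finset.mem_range] at hi ⊢; omega
    refine (Finset.sum_le_sum h1).trans ?_
    rw [← Finset.mul_sum]
    have h2 : ∑ k ∈ Finset.range n, Pn p k (ck k) y ≤ K0 + 2 := by
      simp only [hck, Pn_add_fun, Pn_const hp]
      rw [Finset.sum_add_distrib]
      have h3 := EE_sum hp G V (R / 2) n y
      have h4 : ∑ k ∈ Finset.range n, (if k ≤ K0 then (1 : ℝ) else 0) ≤ K0 + 1 := by
        rw [Finset.sum_boole]
        have : ((Finset.range n).filter (fun k => k ≤ K0)).card ≤ (Finset.range (K0 + 1)).card :=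
          Finset.card_le_card (fun k hk => by
            simp only [Finset.mem_filter, Finset.mem_range] at hk ⊢; omega)
        rw [Finset.card_range] at this
        exact_mod_cast this
      linarith
    have := mul_le_mul_of_nonneg_left h2 (mul_nonneg hn'.le hFm)
    linarith
  simp only [Finset.sum_const, Finset.card_range, nsmul_eq_mul]
  have e : (n : ℝ) * (Cq * (1 - c)⁻¹ * (n : ℝ)⁻¹ + (R + (M : ℝ)⁻¹) + Cq * (c ^ K0 * (1 - c)⁻¹)
      + (K0 + 2) * Fm) = Cq * (1 - c)⁻¹ + n * (R + (M : ℝ)⁻¹) + n * (Cq * (c ^ K0 * (1 - c)⁻¹))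
      + n * ((K0 + 2) * Fm) := by
    field_simp
  rw [e]
  linarith

end Ph4

section Ph5
variable {κ : ℕ} {p : Fin κ → ℝ}
variable {h : ℕ → Y κ → SL2} {g : Y κ → SL2} {C0 : ℝ} {ω δ : ℕ → ℝ} {n : ℕ → ℕ}
  {V : Y κ → Q} {w : ℕ → ℝ}

lemma LD.δ0 (D : LD p h g C0 ω δ n) (j : ℕ) : 0 ≤ δ j := by
  obtain ⟨z⟩ := D.pv.ne
  exact (gd_nonneg _ _).trans (D.conv j z)

lemma sb_close (D : LD p h g C0 ω δ n) (sec : Sec g w V) (k : ℕ) :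
    ∃ E, ∀ j x, dd (sb (h j) V k x) (V x) ≤ δ j * E := by
  have hC1 := D.goodg.one_le D.pv
  induction k with
  | zero => exact ⟨0, fun j x => by rw [sb_zero, dd_self, mul_zero]⟩
  | succ k ih =>
    obtain ⟨E, hE⟩ := ih
    refine ⟨C0 ^ 2 * (E + C0), fun j x => ?_⟩
    have h1 := loc_back1 hC1 (D.good j).bd D.goodg.bd (D.conv j) sec x (sb (h j) V (k + 1) x)
    rw [sb_step] at h1
    have h2 := hE j (ssh x)
    calc _ ≤ _ := h1
      _ ≤ C0 ^ 2 * (δ j * E + δ j * C0) := by gcongr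
      _ = _ := by ring

lemma ann_uniform (D : LD p h g C0 ω δ n) (sec : Sec g w V) {a b τ τ' : ℝ} (ha : 0 < a) (hb : 0 < b)
    (hτ : τ' < τ) (hle : ∀ x, flim p h n x (fun u => ann a b (V x) u) ≤ τ') :
    ∀ᶠ j in UF, ∀ x, Fam p (h j) (n j) (j + 1) x (fun u => ann a b (V x) u) ≤ τ := by
  by_contra hcon
  rw [Filter.not_eventually, Ultrafilter.frequently_iff_eventually] at hcon
  obtain ⟨y0⟩ := D.pv.ne
  have hch : ∀ j, ∃ x, (¬ ∀ x, Fam p (h j) (n j) (j + 1) x (fun u => ann a b (V x) u) ≤ τ) →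
      τ < Fam p (h j) (n j) (j + 1) x (fun u => ann a b (V x) u) := by
    intro j
    by_cases hj : ∀ x, Fam p (h j) (n j) (j + 1) x (fun u => ann a b (V x) u) ≤ τ
    · exact ⟨y0, fun h => absurd hj h⟩
    · push Not at hj
      obtain ⟨x, hx⟩ := hj
      exact ⟨x, fun _ => hx⟩
  choose xs hxs using hch
  obtain ⟨x, hx⟩ := exists_Y_lim xs
  set C := 2 * b⁻¹ + 2 * a⁻¹ with hC
  have hL := fun v => Lip.ann ha hb v
  have hlim : Filter.Tendsto (fun N => C * ω N + C * w N) Filter.atTop (nhds (C * 0 + C * 0)) :=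
    (D.ωlim.const_mul C).add (sec.lim.const_mul C)
  rw [mul_zero, add_zero] at hlim
  obtain ⟨N, hN⟩ := (hlim.eventually_lt_const (show (0 : ℝ) < (τ - τ') / 2 by linarith)).exists
  have h1 := (flim_tendsto D x (hL (V x))).eventually_lt_const
    (show flim p h n x (fun u => ann a b (V x) u) < τ' + (τ - τ') / 2 by linarith [hle x])
  obtain ⟨j, hj1, hj2, hj3⟩ := (h1.and ((hx N).and hcon)).exists
  have hb1 := hxs j hj3
  have hn : 0 < n j := by have := D.nlarge j; omega
  have h2 := (abs_le.mp (Fam_cont D.pv (D.good j) hn (Nat.succ_pos j) (hL (V x)) hj2)).2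
  have h3 : Fam p (h j) (n j) (j + 1) (xs j) (fun u => ann a b (V (xs j)) u) ≤
      Fam p (h j) (n j) (j + 1) (xs j) (fun u => ann a b (V x) u) + C * w N := by
    rw [← Fam_const D.pv (h j) hn (Nat.succ_pos j) (xs j) (C * w N), ← Fam_add]
    refine Fam_mono D.pv _ _ _ _ _ _ fun u => ?_
    have e1 := ann_lip_v ha hb (V (xs j)) (V x) u
    have e2 := mul_le_mul_of_nonneg_left (sec.hol N _ _ hj2) (hL (V x)).1
    rw [← hC] at e1
    linarith
  simp only [Nat.succ_eq_add_one] at h2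
  linarith

lemma Ph2.contra (D : LD p h g C0 ω δ n) (DL : LD p (fun _ => g) g C0 ω δ n) {t ℓ : ℝ}
    (P : Ph2 p g (flim p h n) (flim p (fun _ => g) n) w V t ℓ) (y : Y κ) : False := by
  have hC1 := D.goodg.one_le D.pv
  have hC0 : 0 < C0 := by linarith
  obtain ⟨s, c, K, hs, hc0, hc1, hK, hld⟩ := XX_ld D.pv hC1 D.goodg.bd P.val P.neg
  have ht := P.t1
  have hneg := P.neg
  set β := -ℓ / 2 with hβ
  have hβ0 : 0 < β := by rw [hβ]; linarith
  set θ := 1 - t with hθ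
  have hθ0 : 0 < θ := by rw [hθ]; linarith
  set Cq := Real.exp (s * Real.log 4) * K with hCq
  -- K0
  have hK0lim : Filter.Tendsto (fun k : ℕ => Cq * (c ^ k * (1 - c)⁻¹)) Filter.atTop (nhds (Cq * (0 * (1 - c)⁻¹))) :=
    ((tendsto_pow_atTop_nhds_zero_of_lt_one hc0.le hc1).mul_const _).const_mul _
  rw [zero_mul, mul_zero] at hK0lim
  obtain ⟨K0, hK0⟩ := (hK0lim.eventually_lt_const (show (0 : ℝ) < θ / 4 by linarith)).exists
  have hK2 : (0 : ℝ) < K0 + 2 := by positivity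
  set τ := θ / (12 * (K0 + 2)) with hτ
  have hτ0 : 0 < τ := by positivity
  obtain ⟨Rτ, hRτ, hsm⟩ := P.small τ hτ0
  set R := min (β / (8 * C0 ^ 4)) (min (θ / 8) (Rτ / (4 * C0 ^ 2))) with hR
  have hR0 : 0 < R := by rw [hR]; refine lt_min (by positivity) (lt_min (by positivity) (by positivity))
  have hR1 : 8 * C0 ^ 4 * R ≤ β := by
    have : R ≤ β / (8 * C0 ^ 4) := min_le_left _ _
    rwa [le_div_iff₀ (by positivity), mul_comm] at this
  have hR2 : R ≤ θ / 8 := (min_le_right _ _).trans (min_le_left _ _)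
  have hR3 : 4 * C0 ^ 2 * R ≤ Rτ := by
    have : R ≤ Rτ / (4 * C0 ^ 2) := (min_le_right _ _).trans (min_le_right _ _)
    rwa [le_div_iff₀ (by positivity), mul_comm] at this
  have hC2 : 1 ≤ C0 ^ 2 := one_le_pow₀ hC1
  have hCR : R ≤ C0 ^ 2 * R := le_mul_of_one_le_left hR0.le hC2
  have ha : 0 < R / 4 := by linarith
  have hb : 0 < 2 * (2 * C0 ^ 2 * R) := by positivity
  have SL := flim_SF DL
  -- limit annulus estimate
  have hann : ∀ x, flim p h n x (fun u => ann (R / 4) (2 * (2 * C0 ^ 2 * R)) (V x) u) ≤ 2 * τ := by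
    intro x
    rw [P.eq x _ _ (Lip.ann ha hb (V x))]
    have e0 : ann (R / 4) (2 * (2 * C0 ^ 2 * R)) (V x) (V x) = 0 := by
      unfold ann; rw [chi_self, chi_self]; ring
    rw [e0, mul_zero, add_zero]
    have e1 : flim p (fun _ => g) n x (fun u => ann (R / 4) (2 * (2 * C0 ^ 2 * R)) (V x) u)
        ≤ 2 * flim p (fun _ => g) n x (fun u => chi Rτ (V x) u) := by
      rw [← SL.smul x 2 _ _ (Lip.chi hRτ (V x))]
      refine SL.mono x _ _ _ _ (Lip.ann ha hb (V x)) ((Lip.chi hRτ (V x)).smul 2) fun u => ?_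
      have e2 := chi_mono hb (show 2 * (2 * C0 ^ 2 * R) ≤ Rτ by linarith) (V x) u
      have e3 := chi_nonneg (R / 4) (V x) u
      unfold ann; linarith
    have e2 := SL.nonneg (Lip.ann ha hb (V x)) (fun u => ann_nonneg ha (by linarith) (V x) u) x
    have e3 := hsm x
    have : t * flim p (fun _ => g) n x (fun u => ann (R / 4) (2 * (2 * C0 ^ 2 * R)) (V x) u)
        ≤ 1 * flim p (fun _ => g) n x (fun u => ann (R / 4) (2 * (2 * C0 ^ 2 * R)) (V x) u) :=
      mul_le_mul_of_nonneg_right ht.le e2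
    linarith
  have ev1 := ann_uniform D P.sec ha hb (show 2 * τ < 3 * τ by linarith) hann
  have hδ := D.δlim.mono_left uf_le_atTop
  have ev2 : ∀ᶠ j in UF, ∀ k ∈ Finset.range (K0 + 1), ∀ x, dd (sb (h j) V k x) (V x) ≤ R / 2 := by
    rw [Filter.eventually_all_finset]
    intro k _
    obtain ⟨E, hE⟩ := sb_close D P.sec k
    have : Filter.Tendsto (fun j => δ j * E) UF (nhds (0 * E)) := hδ.mul_const E
    rw [zero_mul] at this
    filter_upwards [this.eventually_lt_const (show (0 : ℝ) < R / 2 by linarith)] with j hj x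
    exact (hE j x).trans hj.le
  have hδC : Filter.Tendsto (fun j => δ j * C0) UF (nhds 0) := by simpa using hδ.mul_const C0
  have ev3 := hδC.eventually_lt_const hR0
  have ev4 := hδC.eventually_lt_const (show (0 : ℝ) < β / 4 by linarith)
  have hev : ∀ᶠ j in UF, Fam p (h j) (n j) (j + 1) y (fun u => chi R (V y) u) ≤
      Cq * (1 - c)⁻¹ * ((n j : ℕ) : ℝ)⁻¹ + (R + ((j + 1 : ℕ) : ℝ)⁻¹)
      + Cq * (c ^ K0 * (1 - c)⁻¹) + (K0 + 2) * (3 * τ) := by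
    filter_upwards [ev1, ev2, ev3, ev4] with j h1 h2 h3 h4
    have A : Loc (h j) g V w C0 (δ j) β R :=
      ⟨hC1, (D.good j).bd, D.goodg.bd, D.conv j, P.sec, hR0, h3.le, by nlinarith⟩
    exact A.fam D.pv K0 (fun k hk x => h2 k (Finset.mem_range.mpr (Nat.lt_succ_of_le hk)) x) hs hc0 hc1
      hK hld (by have := D.nlarge j; omega) (Nat.succ_pos j) h1 y
  have hinv : Filter.Tendsto (fun j : ℕ => ((j + 1 : ℕ) : ℝ)⁻¹) UF (nhds 0) := by
    refine Filter.Tendsto.mono_left ?_ uf_le_atTop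
    simpa using (tendsto_one_div_add_atTop_nhds_zero_nat (𝕜 := ℝ))
  have hrhs : Filter.Tendsto (fun j => Cq * (1 - c)⁻¹ * ((n j : ℕ) : ℝ)⁻¹ + (R + ((j + 1 : ℕ) : ℝ)⁻¹)
      + Cq * (c ^ K0 * (1 - c)⁻¹) + (K0 + 2) * (3 * τ)) UF
      (nhds (Cq * (1 - c)⁻¹ * 0 + (R + 0) + Cq * (c ^ K0 * (1 - c)⁻¹) + (K0 + 2) * (3 * τ))) :=
    (((D.ninv.const_mul _).add (hinv.const_add R)).add_const _).add_const _
  have hfin := le_of_tendsto_of_tendsto (flim_tendsto D y (Lip.chi hR0 (V y))) hrhs hev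
  rw [P.eq y _ _ (Lip.chi hR0 (V y)), chi_self] at hfin
  have h5 : 0 ≤ t * flim p (fun _ => g) n y (fun u => chi R (V y) u) :=
    mul_nonneg P.t0 (SL.nonneg (Lip.chi hR0 (V y)) (fun u => chi_nonneg _ _ _) y)
  have h6 : (K0 + 2) * (3 * τ) = θ / 4 := by rw [hτ]; field_simp; ring
  rw [h6] at hfin
  linarith

theorem abstract_main (D : LD p h g C0 ω δ n) {L CG ε0 : ℝ} (G : Gr p g L CG) (hε : 0 < ε0) (y0 : Y κ)
    (hv : ∀ j, Pn p (n j) (fun z => Real.log (nm (hc (h j) (n j) z))) y0 ≤ n j * (L - ε0)) : False := by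
  have DL : LD p (fun _ => g) g C0 ω δ n :=
    ⟨D.pv, fun _ => D.goodg, D.goodg, fun j z => by
      have : gd (g z) (g z) = 0 := by simp [gd]
      rw [this]; exact D.δ0 j, D.δlim, D.ωlim, D.nlarge⟩
  obtain ⟨w, V, t, ℓ, P⟩ := phase2 D DL G y0 (show L - ε0 < L by linarith) (val_upper D y0 _ hv)
  exact P.contra D DL y0

end Ph5

/-! ### Part 10: reduction to one-sided cocycles through stable holonomies -/

section Hol

lemma gd_triangle (a b c : SL2) : gd a c ≤ gd a b + gd b c := by
  unfold gd; exact norm_sub_le_norm_sub_add_norm_sub _ _ _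

lemma gd_self (a : SL2) : gd a a = 0 := by simp [gd]

lemma gd_mul_left (a b c : SL2) : gd (a * b) (a * c) ≤ nm a * gd b c := by
  unfold gd nm
  rw [toEuc_mul, toEuc_mul, ← mul_sub]; exact norm_mul_le _ _

lemma gd_mul_right (a b c : SL2) : gd (b * a) (c * a) ≤ gd b c * nm a := by
  unfold gd nm
  rw [toEuc_mul, toEuc_mul, ← sub_mul]; exact norm_mul_le _ _

lemma gd_mid (P E Q' : SL2) : gd (P * E * Q') (P * Q') ≤ nm P * gd E 1 * nm Q' := by
  have h1 := gd_mul_right Q' (P * E) (P * 1)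
  have h2 := gd_mul_left P E 1
  rw [mul_one] at h1 h2
  exact h1.trans (mul_le_mul_of_nonneg_right h2 (nm_nonneg _))

lemma nm_le_gd (a b : SL2) : nm a ≤ nm b + gd a b := by
  unfold nm gd
  have := norm_add_le (toEuc b) (toEuc a - toEuc b)
  rwa [add_sub_cancel] at this

lemma gd_mul_inv (a b : SL2) : gd (a * b⁻¹) 1 ≤ gd a b * nm b := by
  have := gd_mul_right b⁻¹ a b
  rwa [mul_inv_cancel, nm_inv] at this

lemma gd_inv_mul (a b : SL2) : gd (b⁻¹ * a) 1 ≤ nm b * gd a b := by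
  have := gd_mul_left b⁻¹ a b
  rwa [inv_mul_cancel, nm_inv] at this

lemma gd_inv (a b : SL2) : gd a⁻¹ b⁻¹ ≤ nm a * gd a b * nm b := by
  have h1 := gd_mul_left a⁻¹ 1 (a * b⁻¹)
  rw [mul_one, inv_mul_cancel_left, nm_inv, gd_comm] at h1
  have h2 := gd_mul_inv a b
  have h3 := nm_nonneg a
  rw [gd_comm] at h1
  rw [gd_comm 1] at h1
  calc _ ≤ _ := h1
    _ ≤ nm a * (gd a b * nm b) := by gcongr
    _ = _ := by ring

/-- convergence in SL2 -/
def TT (a : ℕ → SL2) (g : SL2) : Prop := Filter.Tendsto (fun m => gd (a m) g) Filter.atTop (nhds 0)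

lemma TT.mul {a b : ℕ → SL2} {g h : SL2} (ha : TT a g) (hb : TT b h) :
    TT (fun m => a m * b m) (g * h) := by
  have : Filter.Tendsto (fun m => (nm g + gd (a m) g) * gd (b m) h + gd (a m) g * nm h) Filter.atTop
      (nhds ((nm g + 0) * 0 + 0 * nm h)) :=
    ((ha.const_add _).mul hb).add (ha.mul_const _)
  rw [mul_zero, zero_mul, add_zero] at this
  refine squeeze_zero (fun m => gd_nonneg _ _) (fun m => ?_) this
  have h1 := gd_triangle (a m * b m) (a m * h) (g * h)
  have h2 := gd_mul_left (a m) (b m) h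
  have h3 := gd_mul_right h (a m) g
  have h4 := mul_le_mul_of_nonneg_right (nm_le_gd (a m) g) (gd_nonneg (b m) h)
  linarith

lemma TT.inv {a : ℕ → SL2} {g : SL2} (ha : TT a g) : TT (fun m => (a m)⁻¹) g⁻¹ := by
  have : Filter.Tendsto (fun m => (nm g + gd (a m) g) * gd (a m) g * nm g) Filter.atTop
      (nhds ((nm g + 0) * 0 * nm g)) := ((ha.const_add _).mul ha).mul_const _
  rw [mul_zero, zero_mul] at this
  refine squeeze_zero (fun m => gd_nonneg _ _) (fun m => ?_) this
  refine (gd_inv _ _).trans ?_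
  have := nm_le_gd (a m) g
  have h1 := gd_nonneg (a m) g
  have h2 := nm_nonneg g
  gcongr

lemma TT.shift {a : ℕ → SL2} {g : SL2} (ha : TT a g) (n : ℕ) : TT (fun m => a (m + n)) g :=
  (Filter.tendsto_add_atTop_iff_nat n).mpr ha

lemma TT.gd_le {a : ℕ → SL2} {g h : SL2} (ha : TT a g) {c : ℝ}
    (hb : ∀ᶠ m in Filter.atTop, gd (a m) h ≤ c) : gd g h ≤ c := by
  have h1 : Filter.Tendsto (fun m => gd (a m) g + c) Filter.atTop (nhds (0 + c)) := ha.add_const c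
  rw [zero_add] at h1
  refine ge_of_tendsto h1 ?_
  filter_upwards [hb] with m hm
  have := gd_triangle g (a m) h
  rw [gd_comm g (a m)] at this
  linarith

lemma TT.nm_le {a : ℕ → SL2} {g : SL2} (ha : TT a g) {c : ℝ} (hb : ∀ m, nm (a m) ≤ c) : nm g ≤ c := by
  have h1 : Filter.Tendsto (fun m => gd (a m) g + c) Filter.atTop (nhds (0 + c)) := ha.add_const c
  rw [zero_add] at h1
  refine ge_of_tendsto h1 (Filter.Eventually.of_forall fun m => ?_)
  have := nm_le_gd g (a m)
  rw [gd_comm g] at this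
  linarith [hb m]

lemma TT.le_nm {a : ℕ → SL2} {g : SL2} (ha : TT a g) {c : ℝ} (hb : ∀ m, c ≤ nm (a m)) : c ≤ nm g := by
  have h1 : Filter.Tendsto (fun m => gd (a m) g + nm g) Filter.atTop (nhds (0 + nm g)) := ha.add_const _
  rw [zero_add] at h1
  refine ge_of_tendsto h1 (Filter.Eventually.of_forall fun m => ?_)
  have := nm_le_gd (a m) g
  linarith [hb m]

lemma TT.congr {a b : ℕ → SL2} {g : SL2} (ha : TT a g) (h : ∀ m, a m = b m) : TT b g := by
  have : a = b := funext h
  rwa [← this]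

lemma SL2_complete (a : ℕ → SL2) {c ρ : ℝ} (h1 : ρ < 1)
    (h : ∀ m, gd (a (m + 1)) (a m) ≤ c * ρ ^ m) : ∃ g, TT a g := by
  have hc : CauchySeq (fun m => toEuc (a m)) :=
    cauchySeq_of_le_geometric ρ c h1 (fun m => by
      rw [dist_comm, dist_eq_norm]; exact h m)
  obtain ⟨T, hT⟩ := cauchySeq_tendsto_of_complete hc
  set e := (Matrix.toEuclideanCLM (n := Fin 2) (𝕜 := ℝ)).symm with he
  have hcont : Continuous (fun T : E2 →L[ℝ] E2 => (e T : Mat2)) :=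
    LinearMap.continuous_of_finiteDimensional (e.toAlgEquiv.toLinearMap)
  have h2 : Filter.Tendsto (fun m => (e (toEuc (a m)) : Mat2).det) Filter.atTop (nhds (e T : Mat2).det) :=
    ((hcont.matrix_det).tendsto T).comp hT
  have h3 : ∀ m, (e (toEuc (a m)) : Mat2) = (a m : Mat2) := fun m => by
    simp [he, toEuc]
  have h4 : (e T : Mat2).det = 1 := by
    refine tendsto_nhds_unique h2 ?_
    simp only [h3, Matrix.SpecialLinearGroup.det_coe]
    exact tendsto_const_nhds
  refine ⟨⟨e T, h4⟩, ?_⟩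
  have h5 : toEuc ⟨e T, h4⟩ = T := by simp [toEuc, he]
  unfold TT gd
  rw [h5]
  exact tendsto_iff_norm_sub_tendsto_zero.mp hT

variable {κ : ℕ}

/-- iterated shift -/
def shN (n : ℕ) (x : Sig κ) : Sig κ := fun k => x (k + n)

lemma shN_zero (x : Sig κ) : shN 0 x = x := by funext k; simp [shN]
lemma shN_shift (n : ℕ) (x : Sig κ) : shN n (shift x) = shN (n + 1) x := by
  funext k; simp only [shN, shift]; congr 1; push_cast; ring
lemma shN_one (x : Sig κ) : shN 1 x = shift x := by funext k; simp [shN, shift]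
lemma shN_shN (m n : ℕ) (x : Sig κ) : shN m (shN n x) = shN (m + n) x := by
  funext k; simp only [shN]; congr 1; push_cast; ring

lemma cocycleN_add (B : Sig κ → SL2) (m n : ℕ) (x : Sig κ) :
    cocycleN B (m + n) x = cocycleN B m (shN n x) * cocycleN B n x := by
  induction n generalizing x with
  | zero => simp [shN_zero, cocycleN]
  | succ n ih =>
    rw [← Nat.add_assoc]
    simp only [cocycleN]
    rw [ih, shN_shift, mul_assoc]

lemma cocycleN_one (B : Sig κ → SL2) (x : Sig κ) : cocycleN B 1 x = B x := by simp [cocycleN]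

lemma cocycleN_succ' (B : Sig κ → SL2) (m : ℕ) (x : Sig κ) :
    cocycleN B (m + 1) x = B (shN m x) * cocycleN B m x := by
  rw [Nat.add_comm, cocycleN_add, cocycleN_one]

/-- symmetric agreement -/
def SA (N : ℕ) (x x' : Sig κ) : Prop := ∀ k : ℤ, -(N : ℤ) < k → k < N → x k = x' k
/-- agreement in the future -/
def FA (x x' : Sig κ) : Prop := ∀ k : ℤ, 0 ≤ k → x k = x' k
/-- agreement in the past -/
def PA (M : ℕ) (x x' : Sig κ) : Prop := ∀ k : ℤ, k < M → x k = x' k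

/-- uniform regularity of a bilateral cocycle -/
structure HB (B : Sig κ → SL2) (C H K θ r : ℝ) : Prop where
  bd : ∀ x, nm (B x) ≤ C
  grow : ∀ k x, nm (cocycleN B k x) ^ 2 ≤ K * θ ^ k
  hol : ∀ N x x', SA N x x' → gd (B x) (B x') ≤ H * r ^ N
  C1 : 1 ≤ C
  H0 : 0 ≤ H
  K0 : 0 < K
  θ0 : 1 ≤ θ
  r0 : 0 < r
  ρ1 : θ * r < 1

variable {B : Sig κ → SL2} {C H K θ r : ℝ}

/-- the geometric constant -/
def c1 (C H K θ r : ℝ) : ℝ := K * C * H * (1 - θ * r)⁻¹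

lemma HB.ρ0 (D : HB B C H K θ r) : 0 < θ * r := mul_pos (by linarith [D.θ0]) D.r0
lemma HB.r1 (D : HB B C H K θ r) : r < 1 := by nlinarith [D.θ0, D.ρ1, D.r0]
lemma HB.c10 (D : HB B C H K θ r) : 0 ≤ c1 C H K θ r := by
  have h1 := D.C1; have h2 := D.H0; have h3 := D.K0
  have h4 : 0 < 1 - θ * r := by linarith [D.ρ1]
  unfold c1; positivity

lemma HB.prod (D : HB B C H K θ r) (k : ℕ) (x x' : Sig κ) :
    nm (cocycleN B k x) * nm (cocycleN B k x') ≤ K * θ ^ k := by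
  nlinarith [D.grow k x, D.grow k x', sq_nonneg (nm (cocycleN B k x) - nm (cocycleN B k x'))]

/-- approximate stable holonomy -/
def Hm (B : Sig κ → SL2) (X X' : Sig κ) (m : ℕ) : SL2 := (cocycleN B m X')⁻¹ * cocycleN B m X

lemma HB.stab_step (D : HB B C H K θ r) {X X' : Sig κ} (hX : FA X X') (m : ℕ) :
    gd (Hm B X X' (m + 1)) (Hm B X X' m) ≤ K * C * H * (θ * r) ^ m := by
  have e : Hm B X X' (m + 1) = (cocycleN B m X')⁻¹ * ((B (shN m X'))⁻¹ * B (shN m X)) * cocycleN B m X := by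
    unfold Hm; rw [cocycleN_succ', cocycleN_succ']; group
  rw [e]
  refine (gd_mid _ _ _).trans ?_
  rw [nm_inv]
  have h1 : gd ((B (shN m X'))⁻¹ * B (shN m X)) 1 ≤ C * (H * r ^ m) := by
    refine (gd_inv_mul _ _).trans ?_
    refine mul_le_mul (D.bd _) (D.hol m _ _ ?_) (gd_nonneg _ _) (by linarith [D.C1])
    intro k hk _
    exact hX _ (by omega)
  have h2 := D.prod m X' X
  have h3 : 0 ≤ nm (cocycleN B m X') * nm (cocycleN B m X) := mul_nonneg (nm_nonneg _) (nm_nonneg _)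
  calc nm (cocycleN B m X') * gd ((B (shN m X'))⁻¹ * B (shN m X)) 1 * nm (cocycleN B m X)
      = (nm (cocycleN B m X') * nm (cocycleN B m X)) * gd ((B (shN m X'))⁻¹ * B (shN m X)) 1 := by ring
    _ ≤ (K * θ ^ m) * (C * (H * r ^ m)) := mul_le_mul h2 h1 (gd_nonneg _ _) (h3.trans h2)
    _ = _ := by rw [mul_pow]; ring

lemma HB.stab_le (D : HB B C H K θ r) {X X' : Sig κ} (hX : FA X X') (n i : ℕ) :
    gd (Hm B X X' (n + i)) (Hm B X X' n) ≤ c1 C H K θ r * (θ * r) ^ n := by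
  have h1 := D.C1; have h2 := D.H0; have h3 := D.K0; have h4 := D.ρ0
  have key : gd (Hm B X X' (n + i)) (Hm B X X' n) ≤
      K * C * H * (θ * r) ^ n * ∑ l ∈ Finset.range i, (θ * r) ^ l := by
    induction i with
    | zero => simp [gd_self]
    | succ i ih =>
      have e1 := gd_triangle (Hm B X X' (n + (i + 1))) (Hm B X X' (n + i)) (Hm B X X' n)
      have e2 := D.stab_step hX (n + i)
      rw [Finset.sum_range_succ, mul_add]
      rw [pow_add, ← mul_assoc] at e2
      rw [← Nat.add_assoc] at e1 ⊢
      linarith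
  refine key.trans ?_
  have := mul_le_mul_of_nonneg_left (geom_bound h4 D.ρ1 i) (show 0 ≤ K * C * H * (θ * r) ^ n by positivity)
  unfold c1
  linarith

lemma HB.stab_gd_one (D : HB B C H K θ r) {X X' : Sig κ} (hX : FA X X') (m : ℕ) :
    nm (Hm B X X' m) ≤ 1 + c1 C H K θ r := by
  have h1 := D.stab_le hX 0 m
  rw [Nat.zero_add, pow_zero, mul_one] at h1
  have h2 := nm_le_gd (Hm B X X' m) (Hm B X X' 0)
  have h3 : Hm B X X' 0 = 1 := by simp [Hm, cocycleN]
  rw [h3, nm_one] at h2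
  rw [h3] at h1
  linarith

/-- unstable estimate -/
lemma HB.unst (D : HB B C H K θ r) (n N : ℕ) {X X' : Sig κ} (hX : PA (n + N) X X') :
    gd (cocycleN B n X' * (cocycleN B n X)⁻¹) 1 ≤ c1 C H K θ r * r ^ N := by
  have h1 := D.C1; have h2 := D.H0; have h3 := D.K0; have h4 := D.ρ0; have h5 := D.r0; have h6 := D.r1
  have key : gd (cocycleN B n X' * (cocycleN B n X)⁻¹) 1 ≤
      K * C * H * r ^ N * ∑ l ∈ Finset.range n, (θ * r) ^ l := by
    induction n generalizing X X' with
    | zero => simp [cocycleN, gd_self]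
    | succ n ih =>
      have i1 := ih (X := shift X) (X' := shift X') (fun k hk => hX _ (by push_cast at hk ⊢; omega))
      have e : cocycleN B (n + 1) X' * (cocycleN B (n + 1) X)⁻¹ =
          cocycleN B n (shift X') * (B X' * (B X)⁻¹) * (cocycleN B n (shift X))⁻¹ := by
        simp only [cocycleN]; group
      rw [e]
      have e1 := gd_mid (cocycleN B n (shift X')) (B X' * (B X)⁻¹) (cocycleN B n (shift X))⁻¹
      have e2 := gd_triangle (cocycleN B n (shift X') * (B X' * (B X)⁻¹) * (cocycleN B n (shift X))⁻¹)
        (cocycleN B n (shift X') * (cocycleN B n (shift X))⁻¹) 1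
      rw [nm_inv] at e1
      have e3 : gd (B X' * (B X)⁻¹) 1 ≤ H * r ^ (n + N) * C := by
        refine (gd_mul_inv _ _).trans ?_
        refine mul_le_mul (D.hol (n + N) _ _ ?_) (D.bd _) (nm_nonneg _) (by positivity)
        intro k _ hk
        exact (hX _ (by push_cast at hk ⊢; omega)).symm
      have e4 := D.prod n (shift X') (shift X)
      have e5 : nm (cocycleN B n (shift X')) * gd (B X' * (B X)⁻¹) 1 * nm (cocycleN B n (shift X))
          ≤ K * C * H * r ^ N * (θ * r) ^ n := by
        calc _ = (nm (cocycleN B n (shift X')) * nm (cocycleN B n (shift X))) * gd (B X' * (B X)⁻¹) 1 := by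
              ring
          _ ≤ (K * θ ^ n) * (H * r ^ (n + N) * C) := mul_le_mul e4 e3 (gd_nonneg _ _)
              (by have := D.θ0; positivity)
          _ = _ := by rw [mul_pow, pow_add]; ring
      rw [Finset.sum_range_succ, mul_add]
      linarith
  refine key.trans ?_
  have := mul_le_mul_of_nonneg_left (geom_bound h4 D.ρ1 n) (show 0 ≤ K * C * H * r ^ N by positivity)
  unfold c1
  linarith

end Hol

section Hol2
variable {κ : ℕ} {B : Sig κ → SL2} {C H K θ r : ℝ}

open Classical in
/-- stable holonomy -/
def sthol (B : Sig κ → SL2) (X X' : Sig κ) : SL2 :=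
  if h : ∃ g, TT (Hm B X X') g then h.choose else 1

lemma HB.hol_tt (D : HB B C H K θ r) {X X' : Sig κ} (hX : FA X X') : TT (Hm B X X') (sthol B X X') := by
  have h : ∃ g, TT (Hm B X X') g := SL2_complete _ D.ρ1 (D.stab_step hX)
  unfold sthol
  rw [dif_pos h]
  exact h.choose_spec

/-- extension to the past by a constant -/
def ext (a : Fin κ) (y : Y κ) : Sig κ := fun k => if 0 ≤ k then y k.toNat else a

/-- the one-sided cocycle -/
def hB (a : Fin κ) (B : Sig κ → SL2) (y : Y κ) : SL2 :=
  sthol B (shift (ext a y)) (ext a (ssh y)) * B (ext a y)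

lemma ext_FA (a : Fin κ) (n : ℕ) (y : Y κ) : FA (shN n (ext a y)) (ext a (shn n y)) := by
  intro k hk
  simp only [shN, ext, shn]
  rw [if_pos hk, if_pos (by omega)]
  congr 1
  omega

lemma ext_PA (a : Fin κ) {M : ℕ} {y y' : Y κ} (h : Agree M y y') : PA M (ext a y) (ext a y') := by
  intro k hk
  simp only [ext]
  split_ifs with h0
  · exact h _ (by omega)
  · rfl

lemma PA.shN {M n : ℕ} {x x' : Sig κ} (h : PA (n + M) x x') : PA M (shN n x) (shN n x') := by
  intro k hk
  exact h _ (by push_cast; omega)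

/-- approximants of the one-sided cocycle -/
def ap (a : Fin κ) (B : Sig κ → SL2) (n : ℕ) (y : Y κ) (m : ℕ) : SL2 :=
  Hm B (shN n (ext a y)) (ext a (shn n y)) m * cocycleN B n (ext a y)

lemma HB.ap_tt (D : HB B C H K θ r) (a : Fin κ) (n : ℕ) (y : Y κ) :
    TT (ap a B n y) (hc (hB a B) n y) := by
  induction n generalizing y with
  | zero =>
    unfold TT
    have : ∀ m, ap a B 0 y m = 1 := fun m => by
      simp [ap, Hm, shN_zero, shn_zero, cocycleN]
    simp only [this, hc_zero, gd_self]
    exact tendsto_const_nhds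
  | succ n ih =>
    have h1 := ih (ssh y)
    have hfa : FA (shift (ext a y)) (ext a (ssh y)) := by
      have := ext_FA a 1 y
      rwa [shN_one, shn_one] at this
    have h2 := (D.hol_tt hfa).shift n
    have h3 : TT (fun _ : ℕ => B (ext a y)) (B (ext a y)) := by
      unfold TT; simp only [gd_self]; exact tendsto_const_nhds
    have h4 := h1.mul (h2.mul h3)
    rw [hc_succ]
    refine h4.congr fun m => ?_
    unfold ap Hm
    rw [shn_succ, ← shN_shift, cocycleN_add B m n, cocycleN_add B m n]
    rw [show cocycleN B (n + 1) (ext a y) = cocycleN B n (shift (ext a y)) * B (ext a y) from rfl]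
    generalize cocycleN B m (ext a (shn n (ssh y))) = g1
    generalize cocycleN B m (shN n (shift (ext a y))) = g2
    generalize cocycleN B n (shift (ext a y)) = g3
    generalize B (ext a y) = g4
    generalize cocycleN B m (shN n (ext a (ssh y))) = g5
    generalize cocycleN B n (ext a (ssh y)) = g6
    group

lemma HB.nm_hc_le (D : HB B C H K θ r) (a : Fin κ) (n : ℕ) (y : Y κ) :
    nm (hc (hB a B) n y) ≤ (1 + c1 C H K θ r) * nm (cocycleN B n (ext a y)) := by
  refine (D.ap_tt a n y).nm_le fun m => ?_
  refine (nm_mul _ _).trans (mul_le_mul_of_nonneg_right (D.stab_gd_one (ext_FA a n y) m) (nm_nonneg _))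

lemma HB.le_nm_hc (D : HB B C H K θ r) (a : Fin κ) (n : ℕ) (y : Y κ) :
    nm (cocycleN B n (ext a y)) ≤ (1 + c1 C H K θ r) * nm (hc (hB a B) n y) := by
  have h0 : 0 < 1 + c1 C H K θ r := by linarith [D.c10]
  rw [← div_le_iff₀' h0]
  refine (D.ap_tt a n y).le_nm fun m => ?_
  rw [div_le_iff₀' h0]
  have e : cocycleN B n (ext a y) = (Hm B (shN n (ext a y)) (ext a (shn n y)) m)⁻¹ * ap a B n y m := by
    unfold ap; group
  rw [e]
  refine (nm_mul _ _).trans (mul_le_mul_of_nonneg_right ?_ (nm_nonneg _))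
  rw [nm_inv]
  exact D.stab_gd_one (ext_FA a n y) m

/-- modulus of continuity -/
def om (C H K θ r : ℝ) (N : ℕ) : ℝ :=
  (1 + c1 C H K θ r) * (c1 C H K θ r * r ^ N) * (1 + c1 C H K θ r) +
  (2 * c1 C H K θ r + K * ((1 + c1 C H K θ r) * (2 * c1 C H K θ r))) * (θ * r) ^ (N / 2)
    * (1 + c1 C H K θ r)

lemma HB.om_lim (D : HB B C H K θ r) : Filter.Tendsto (om C H K θ r) Filter.atTop (nhds 0) := by
  have h1 := tendsto_pow_atTop_nhds_zero_of_lt_one D.r0.le D.r1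
  have h2 := (tendsto_pow_atTop_nhds_zero_of_lt_one D.ρ0.le D.ρ1).comp
    (Nat.tendsto_div_const_atTop (show (2 : ℕ) ≠ 0 by norm_num))
  have := (((h1.const_mul (c1 C H K θ r)).const_mul (1 + c1 C H K θ r)).mul_const (1 + c1 C H K θ r)).add
    ((h2.const_mul (2 * c1 C H K θ r + K * ((1 + c1 C H K θ r) * (2 * c1 C H K θ r)))).mul_const
      (1 + c1 C H K θ r))
  rw [mul_zero, mul_zero, zero_mul, mul_zero, zero_mul, add_zero] at this
  exact this

lemma HB.stab_cont (D : HB B C H K θ r) {M0 N : ℕ} (hM : 2 * M0 ≤ N) {X X' Z Z' : Sig κ}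
    (hX : PA N X X') (hZ : PA N Z Z') :
    gd (Hm B X' Z' M0) (Hm B X Z M0) ≤
      K * ((1 + c1 C H K θ r) * (2 * c1 C H K θ r)) * (θ * r) ^ M0 := by
  have hc0 := D.c10; have hr0 := D.r0; have hr1 := D.r1; have hK := D.K0; have hθ := D.θ0
  set c := c1 C H K θ r
  have hrp : r ^ (N - M0) ≤ r ^ M0 := pow_le_pow_of_le_one hr0.le hr1.le (by omega)
  have hun : ∀ X X' : Sig κ, PA N X X' →
      gd (cocycleN B M0 X' * (cocycleN B M0 X)⁻¹) 1 ≤ c * r ^ M0 := by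
    intro X X' hX
    refine (D.unst M0 (N - M0) (X := X) (X' := X') ?_).trans (mul_le_mul_of_nonneg_left hrp hc0)
    rwa [show M0 + (N - M0) = N by omega]
  have u1 := hun X X' hX
  have u2 := hun Z Z' hZ
  set U := cocycleN B M0 X' * (cocycleN B M0 X)⁻¹ with hU
  set W := cocycleN B M0 Z' * (cocycleN B M0 Z)⁻¹ with hW
  have e1 : Hm B X' Z' M0 = (cocycleN B M0 Z)⁻¹ * (W⁻¹ * U) * cocycleN B M0 X := by
    unfold Hm; rw [hU, hW]; group
  rw [e1]
  refine (gd_mid _ _ _).trans ?_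
  rw [nm_inv]
  have hW1 : nm W ≤ 1 + c := by
    have := nm_le_gd W 1
    rw [nm_one] at this
    have h2 : c * r ^ M0 ≤ c := mul_le_of_le_one_right hc0 (pow_le_one₀ hr0.le hr1.le)
    linarith
  have h3 : gd (W⁻¹ * U) 1 ≤ (1 + c) * (2 * c) * r ^ M0 := by
    refine (gd_inv_mul _ _).trans ?_
    have h4 := gd_triangle U 1 W
    rw [gd_comm 1 W] at h4
    calc nm W * gd U W ≤ (1 + c) * (2 * (c * r ^ M0)) :=
          mul_le_mul hW1 (by linarith) (gd_nonneg _ _) (by linarith)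
      _ = _ := by ring
  have h4 := D.prod M0 Z X
  calc nm (cocycleN B M0 Z) * gd (W⁻¹ * U) 1 * nm (cocycleN B M0 X)
      = (nm (cocycleN B M0 Z) * nm (cocycleN B M0 X)) * gd (W⁻¹ * U) 1 := by ring
    _ ≤ (K * θ ^ M0) * ((1 + c) * (2 * c) * r ^ M0) := mul_le_mul h4 h3 (gd_nonneg _ _) (by positivity)
    _ = _ := by rw [mul_pow]; ring

lemma HB.good (D : HB B C H K θ r) (a : Fin κ) :
    Good (hB a B) ((1 + c1 C H K θ r) * C) (om C H K θ r) where
  bd z := by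
    have := D.nm_hc_le a 1 z
    rw [hc_one, cocycleN_one] at this
    exact this.trans (mul_le_mul_of_nonneg_left (D.bd _) (by linarith [D.c10]))
  hol n N z z' ha := by
    have hc0 := D.c10; have hr0 := D.r0; have hr1 := D.r1; have hK := D.K0; have hθ := D.θ0
    have hρ := D.ρ0
    have hone : toEuc (1 : SL2) = 1 := toEuc_one
    have hgoal : gd (hc (hB a B) n z' * (hc (hB a B) n z)⁻¹) 1 ≤ om C H K θ r N := by
      refine ((D.ap_tt a n z').mul (D.ap_tt a n z).inv).gd_le ?_
      filter_upwards [Filter.eventually_ge_atTop (N / 2)] with m hm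
      have hst := D.stab_gd_one (ext_FA a n z) m
      have hst' := D.stab_gd_one (ext_FA a n z') m
      have hU := D.unst n N (ext_PA a ha)
      obtain ⟨i, rfl⟩ := Nat.exists_eq_add_of_le hm
      have s1 := D.stab_le (ext_FA a n z) (N / 2) i
      have s2 := D.stab_le (ext_FA a n z') (N / 2) i
      have s3 := D.stab_cont (M0 := N / 2) (N := N) (by omega) (ext_PA a ha).shN (ext_PA a (ha.shn))
      unfold ap om
      set c := c1 C H K θ r
      set P := Hm B (shN n (ext a z)) (ext a (shn n z))
      set P' := Hm B (shN n (ext a z')) (ext a (shn n z'))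
      have e : P' (N / 2 + i) * cocycleN B n (ext a z') * (P (N / 2 + i) * cocycleN B n (ext a z))⁻¹ =
        P' (N / 2 + i) * (cocycleN B n (ext a z') * (cocycleN B n (ext a z))⁻¹) * (P (N / 2 + i))⁻¹ := by
        group
      rw [e]
      have t1 := gd_triangle (P' (N / 2 + i) * (cocycleN B n (ext a z') * (cocycleN B n (ext a z))⁻¹)
        * (P (N / 2 + i))⁻¹) (P' (N / 2 + i) * (P (N / 2 + i))⁻¹) 1
      have t2 := gd_mid (P' (N / 2 + i)) (cocycleN B n (ext a z') * (cocycleN B n (ext a z))⁻¹)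
        (P (N / 2 + i))⁻¹
      rw [nm_inv] at t2
      have t3 : nm (P' (N / 2 + i)) * gd (cocycleN B n (ext a z') * (cocycleN B n (ext a z))⁻¹) 1
          * nm (P (N / 2 + i)) ≤ (1 + c) * (c * r ^ N) * (1 + c) :=
        mul_le_mul (mul_le_mul hst' hU (gd_nonneg _ _) (by linarith)) hst (nm_nonneg _)
          (by positivity)
      have t4 := gd_mul_inv (P' (N / 2 + i)) (P (N / 2 + i))
      have t5 := gd_triangle (P' (N / 2 + i)) (P' (N / 2)) (P (N / 2 + i))
      have t6 := gd_triangle (P' (N / 2)) (P (N / 2)) (P (N / 2 + i))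
      rw [gd_comm (P (N / 2))] at t6
      have t7 : gd (P' (N / 2 + i)) (P (N / 2 + i)) * nm (P (N / 2 + i)) ≤
          ((2 * c + K * ((1 + c) * (2 * c))) * (θ * r) ^ (N / 2)) * (1 + c) :=
        mul_le_mul (by linarith) hst (nm_nonneg _) (by positivity)
      linarith
    unfold gd at hgoal
    rwa [hone] at hgoal

lemma cocycle_close (n : ℕ) (C : ℝ) (hC : 1 ≤ C) : ∃ E, 0 ≤ E ∧ ∀ (A B : Sig κ → SL2) (ε : ℝ), 0 ≤ ε →
    (∀ x, nm (A x) ≤ C) → (∀ x, nm (B x) ≤ C) → (∀ x, gd (B x) (A x) ≤ ε) →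
    ∀ x, gd (cocycleN B n x) (cocycleN A n x) ≤ E * ε ∧ nm (cocycleN A n x) ≤ C ^ n := by
  induction n with
  | zero => exact ⟨0, le_rfl, fun A B ε hε _ _ _ x => by simp [cocycleN, gd_self, nm_one]⟩
  | succ n ih =>
    obtain ⟨E, hE, ih⟩ := ih
    refine ⟨E * C + C ^ n, by positivity, fun A B ε hε hA hB hAB x => ?_⟩
    obtain ⟨i1, i2⟩ := ih A B ε hε hA hB hAB (shift x)
    simp only [cocycleN]
    constructor
    · have h1 := gd_triangle (cocycleN B n (shift x) * B x) (cocycleN A n (shift x) * B x)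
        (cocycleN A n (shift x) * A x)
      have h2 := gd_mul_right (B x) (cocycleN B n (shift x)) (cocycleN A n (shift x))
      have h3 := gd_mul_left (cocycleN A n (shift x)) (B x) (A x)
      have h4 : gd (cocycleN B n (shift x)) (cocycleN A n (shift x)) * nm (B x) ≤ (E * ε) * C :=
        mul_le_mul i1 (hB x) (nm_nonneg _) (by positivity)
      have h5 : nm (cocycleN A n (shift x)) * gd (B x) (A x) ≤ C ^ n * ε :=
        mul_le_mul i2 (hAB x) (gd_nonneg _ _) (by positivity)
      linarith
    · rw [pow_succ]
      exact (nm_mul _ _).trans (mul_le_mul i2 (hA x) (nm_nonneg _) (by positivity))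

lemma hB_close (a : Fin κ) (hC : 1 ≤ C) {η : ℝ} (hη : 0 < η) (hρ0 : 0 < θ * r) (hρ1 : θ * r < 1) :
    ∃ ε0 > 0, ∀ A B : Sig κ → SL2, HB A C H K θ r → HB B C H K θ r →
    (∀ x, gd (B x) (A x) ≤ ε0) → ∀ y, gd (hB a B y) (hB a A y) ≤ η := by
  have hlim := ((tendsto_pow_atTop_nhds_zero_of_lt_one hρ0.le hρ1).const_mul
    (c1 C H K θ r)).mul_const C
  rw [mul_zero, zero_mul] at hlim
  obtain ⟨m, hm⟩ := (hlim.eventually_lt_const (show (0 : ℝ) < η / 3 by linarith)).exists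
  obtain ⟨E1, hE1, h1⟩ := cocycle_close (κ := κ) m C hC
  obtain ⟨E2, hE2, h2⟩ := cocycle_close (κ := κ) (m + 1) C hC
  have hC0 : 0 < C := by linarith
  set F := C ^ m * E1 * C ^ m * C ^ (m + 1) + C ^ m * E2 + 1 with hF
  have hFpos : 0 < F := by positivity
  refine ⟨η / 3 / F, by positivity, fun A B DA DB hAB y => ?_⟩
  set ε := η / 3 / F with hε
  have hε0 : 0 < ε := by positivity
  have hFε : F * ε = η / 3 := by rw [hε]; field_simp
  have hfa : FA (shift (ext a y)) (ext a (ssh y)) := by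
    have := ext_FA a 1 y
    rwa [shN_one, shn_one] at this
  have key : ∀ B : Sig κ → SL2, HB B C H K θ r →
      gd (hB a B y) (Hm B (shift (ext a y)) (ext a (ssh y)) m * B (ext a y)) ≤ η / 3 := by
    intro B D
    unfold hB
    refine (gd_mul_right (B (ext a y)) (sthol B (shift (ext a y)) (ext a (ssh y))) _).trans ?_
    have e : gd (sthol B (shift (ext a y)) (ext a (ssh y))) (Hm B (shift (ext a y)) (ext a (ssh y)) m)
        ≤ c1 C H K θ r * (θ * r) ^ m := by
      refine (D.hol_tt hfa).gd_le ?_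
      filter_upwards [Filter.eventually_ge_atTop m] with i hi
      obtain ⟨l, rfl⟩ := Nat.exists_eq_add_of_le hi
      exact D.stab_le hfa m l
    exact (mul_le_mul e (D.bd _) (nm_nonneg _) (mul_nonneg D.c10 (by positivity))).trans hm.le
  have kA := key A DA
  have kB := key B DB
  have e : ∀ B : Sig κ → SL2, Hm B (shift (ext a y)) (ext a (ssh y)) m * B (ext a y) =
      (cocycleN B m (ext a (ssh y)))⁻¹ * cocycleN B (m + 1) (ext a y) := by
    intro B; unfold Hm; simp only [cocycleN]; group
  rw [e] at kA kB
  obtain ⟨a1, a2⟩ := h1 A B ε hε0.le DA.bd DB.bd hAB (ext a (ssh y))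
  obtain ⟨b1, b2⟩ := h2 A B ε hε0.le DA.bd DB.bd hAB (ext a y)
  obtain ⟨-, a3⟩ := h1 B B ε hε0.le DB.bd DB.bd (fun x => by rw [gd_self]; exact hε0.le) (ext a (ssh y))
  set P := cocycleN A m (ext a (ssh y))
  set P' := cocycleN B m (ext a (ssh y))
  set T := cocycleN A (m + 1) (ext a y)
  set T' := cocycleN B (m + 1) (ext a y)
  have g1 : gd (P'⁻¹ * T') (P⁻¹ * T) ≤ η / 3 := by
    have t1 := gd_triangle (P'⁻¹ * T') (P'⁻¹ * T) (P⁻¹ * T)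
    have t2 := gd_mul_left P'⁻¹ T' T
    have t3 := gd_mul_right T P'⁻¹ P⁻¹
    have t4 := gd_inv P' P
    rw [nm_inv] at t2
    have t5 : nm P' * gd T' T ≤ C ^ m * (E2 * ε) := mul_le_mul a3 b1 (gd_nonneg _ _) (by positivity)
    have t6 : nm P' * gd P' P * nm P ≤ C ^ m * (E1 * ε) * C ^ m :=
      mul_le_mul (mul_le_mul a3 a1 (gd_nonneg _ _) (by positivity)) a2 (nm_nonneg _) (by positivity)
    have t7 : gd P'⁻¹ P⁻¹ * nm T ≤ C ^ m * (E1 * ε) * C ^ m * C ^ (m + 1) :=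
      mul_le_mul (t4.trans t6) b2 (nm_nonneg _) (by positivity)
    have : F * ε = C ^ m * (E1 * ε) * C ^ m * C ^ (m + 1) + C ^ m * (E2 * ε) + ε := by rw [hF]; ring
    linarith
  have f1 := gd_triangle (hB a B y) (P'⁻¹ * T') (hB a A y)
  have f2 := gd_triangle (P'⁻¹ * T') (P⁻¹ * T) (hB a A y)
  rw [gd_comm (P⁻¹ * T) (hB a A y)] at f2
  linarith

end Hol2

/-! ### Part 11: integrals against the Bernoulli measure -/

section Bern
variable {κ : ℕ} {p : Fin κ → ℝ} {μ : Measure (Sig κ)}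

/-- take n symbols of x, then y -/
def glue (n : ℕ) (x : Sig κ) (y : Y κ) : Y κ := fun k => if k < n then x k else y (k - n)

lemma glue_zero (x : Sig κ) (y : Y κ) : glue 0 x y = y := by
  funext k; simp [glue]

lemma glue_succ (n : ℕ) (x : Sig κ) (y : Y κ) (i : Fin κ) (h : x n = i) :
    glue (n + 1) x y = glue n x (scons i y) := by
  funext k
  simp only [glue]
  rcases lt_trichotomy k n with hk | hk | hk
  · rw [if_pos hk, if_pos (by omega)]
  · subst hk
    rw [if_pos (by omega), if_neg (by omega), h]
    simp [scons]
  · rw [if_neg (by omega), if_neg (by omega)]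
    obtain ⟨l, rfl⟩ := Nat.exists_eq_add_of_lt hk
    rw [show n + l + 1 - (n + 1) = l by omega, show n + l + 1 - n = l + 1 by omega]
    rfl

lemma glue_int [IsProbabilityMeasure μ] (F : Y κ → ℝ) (n : ℕ) (y : Y κ) :
    Integrable (fun x => F (glue n x y)) μ := by
  classical
  set Φ : (Fin n → Fin κ) → ℝ := fun w => F (fun k => if h : k < n then w ⟨k, h⟩ else y (k - n)) with hΦ
  have e : (fun x : Sig κ => F (glue n x y)) = Φ ∘ (fun x (k : Fin n) => x ((k : ℕ) : ℤ)) := by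
    funext x
    simp only [hΦ, Function.comp]
    rfl
  have hm : Measurable (fun (x : Sig κ) (k : Fin n) => x ((k : ℕ) : ℤ)) :=
    measurable_pi_lambda _ fun k => measurable_pi_apply _
  have hm2 : Measurable (Φ ∘ (fun (x : Sig κ) (k : Fin n) => x ((k : ℕ) : ℤ))) :=
    (measurable_of_countable Φ).comp hm
  rw [e]
  refine Integrable.of_bound hm2.aestronglyMeasurable (∑ w, ‖Φ w‖) (Filter.Eventually.of_forall fun x => ?_)
  exact Finset.single_le_sum (f := fun w => ‖Φ w‖) (fun _ _ => norm_nonneg _) (Finset.mem_univ (fun k : Fin n => x ((k : ℕ) : ℤ)))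

lemma cyl_meas (s : Finset ℤ) (a : ℤ → Fin κ) : MeasurableSet {x : Sig κ | ∀ k ∈ s, x k = a k} := by
  have : {x : Sig κ | ∀ k ∈ s, x k = a k} = ⋂ k ∈ s, (fun x : Sig κ => x k) ⁻¹' {a k} := by
    ext x; simp
  rw [this]
  exact Finset.measurableSet_biInter _ fun k _ => measurable_pi_apply k (MeasurableSet.singleton _)

lemma glue_cyl (hp : PV p) (hμ : IsBernoulli p μ) (F : Y κ → ℝ) (n : ℕ) (y : Y κ) (s : Finset ℤ)
    (a : ℤ → Fin κ) (hs : ∀ k ∈ s, (n : ℤ) ≤ k) :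
    ∫ x in {x | ∀ k ∈ s, x k = a k}, F (glue n x y) ∂μ = (∏ k ∈ s, p (a k)) * Pn p n F y := by
  classical
  have := hμ.1
  induction n generalizing y s a with
  | zero =>
    simp only [glue_zero, Pn_zero]
    rw [setIntegral_const, measureReal_def, hμ.2, ENNReal.toReal_prod, smul_eq_mul]
    congr 1
    refine Finset.prod_congr rfl fun k _ => ENNReal.toReal_ofReal (hp.pos _).le
  | succ n ih =>
    have hn : (n : ℤ) ∉ s := fun h => by have := hs _ h; push_cast at this; omega
    have hU : {x : Sig κ | ∀ k ∈ s, x k = a k} =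
        ⋃ i : Fin κ, {x : Sig κ | ∀ k ∈ insert (n : ℤ) s, x k = Function.update a n i k} := by
      ext x
      simp only [Set.mem_ofPred_eq, Set.mem_iUnion, Finset.mem_insert, forall_eq_or_imp,
        Function.update_self]
      constructor
      · intro h
        refine ⟨x n, rfl, fun k hk => ?_⟩
        rw [Function.update_of_ne (by rintro rfl; exact hn hk)]
        exact h k hk
      · rintro ⟨i, -, h⟩ k hk
        have := h k hk
        rwa [Function.update_of_ne (by rintro rfl; exact hn hk)] at this
    rw [hU, integral_iUnion_fintype (fun i => cyl_meas _ _) ?_ (fun i => (glue_int F _ y).integrableOn)]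
    · rw [Pn_succ, Finset.mul_sum]
      refine Finset.sum_congr rfl fun i _ => ?_
      have e : ∫ x in {x : Sig κ | ∀ k ∈ insert (n : ℤ) s, x k = Function.update a n i k},
          F (glue (n + 1) x y) ∂μ =
          ∫ x in {x : Sig κ | ∀ k ∈ insert (n : ℤ) s, x k = Function.update a n i k},
          F (glue n x (scons i y)) ∂μ := by
        refine setIntegral_congr_fun (cyl_meas _ _) fun x hx => ?_
        have := hx n (Finset.mem_insert_self _ _)
        rw [Function.update_self] at this
        simp only [glue_succ n x y i this]
      rw [e, ih]
      · rw [Finset.prod_insert hn, Function.update_self]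
        have : ∏ k ∈ s, p (Function.update a n i k) = ∏ k ∈ s, p (a k) :=
          Finset.prod_congr rfl fun k hk => by
            rw [Function.update_of_ne (by rintro rfl; exact hn hk)]
        rw [this]; ring
      · intro k hk
        rcases Finset.mem_insert.mp hk with rfl | hk
        · exact le_rfl
        · have := hs k hk; push_cast at this; omega
    · intro i j hij
      refine Set.disjoint_left.mpr fun x hx hx' => hij ?_
      have h1 := hx n (Finset.mem_insert_self _ _)
      have h2 := hx' n (Finset.mem_insert_self _ _)
      rw [Function.update_self] at h1 h2
      rw [← h1, h2]

lemma glue_integral (hp : PV p) (hμ : IsBernoulli p μ) (F : Y κ → ℝ) (n : ℕ) (y : Y κ) :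
    ∫ x, F (glue n x y) ∂μ = Pn p n F y := by
  have := glue_cyl hp hμ F n y ∅ (fun _ => y 0) (by simp)
  simpa using this

/-- cylinders, with the empty set -/
def Cyl (κ : ℕ) : Set (Set (Sig κ)) :=
  {S | S = ∅ ∨ ∃ (s : Finset ℤ) (a : ℤ → Fin κ), S = {x | ∀ k ∈ s, x k = a k}}

lemma Cyl_pi : IsPiSystem (Cyl κ) := by
  classical
  rintro S (rfl | ⟨s, a, rfl⟩) T (rfl | ⟨t, b, rfl⟩) hne
  · left; simp
  · left; simp
  · left; simp
  · right
    obtain ⟨x, hx1, hx2⟩ := hne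
    refine ⟨s ∪ t, x, ?_⟩
    ext z
    simp only [Set.mem_inter_iff, Set.mem_ofPred_eq, Finset.mem_union]
    constructor
    · rintro ⟨h1, h2⟩ k (hk | hk)
      · rw [h1 k hk, hx1 k hk]
      · rw [h2 k hk, hx2 k hk]
    · intro h
      exact ⟨fun k hk => by rw [h k (Or.inl hk), hx1 k hk], fun k hk => by rw [h k (Or.inr hk), hx2 k hk]⟩

lemma Cyl_gen : (MeasurableSpace.pi : MeasurableSpace (Sig κ)) = MeasurableSpace.generateFrom (Cyl κ) := by
  apply le_antisymm
  · refine iSup_le fun k => ?_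
    rintro _ ⟨S, -, rfl⟩
    have : (fun x : Sig κ => x k) ⁻¹' S = ⋃ i ∈ S, {x : Sig κ | ∀ l ∈ ({k} : Finset ℤ), x l = (fun _ => i) l} := by
      ext x; simp
    rw [this]
    refine MeasurableSet.biUnion (Set.to_countable _) fun i _ => ?_
    exact MeasurableSpace.measurableSet_generateFrom (Or.inr ⟨_, _, rfl⟩)
  · refine MeasurableSpace.generateFrom_le ?_
    rintro S (rfl | ⟨s, a, rfl⟩)
    · exact MeasurableSet.empty
    · exact cyl_meas s a

lemma shN_mp (hμ : IsBernoulli p μ) (n : ℕ) : MeasurePreserving (shN n : Sig κ → Sig κ) μ μ := by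
  have hpr := hμ.1
  have hm : Measurable (shN n : Sig κ → Sig κ) := measurable_pi_lambda _ fun k => measurable_pi_apply _
  refine ⟨hm, ?_⟩
  have : IsProbabilityMeasure (Measure.map (shN n) μ) := Measure.isProbabilityMeasure_map hm.aemeasurable
  refine ext_of_generate_finite (Cyl κ) Cyl_gen Cyl_pi ?_ (by simp)
  rintro S (rfl | ⟨s, a, rfl⟩)
  · simp
  · rw [Measure.map_apply hm (cyl_meas s a), hμ.2]
    have e : (shN n : Sig κ → Sig κ) ⁻¹' {x | ∀ k ∈ s, x k = a k} =
        {x | ∀ k ∈ s.map (addRightEmbedding (n : ℤ)), x k = (fun l => a (l - n)) k} := by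
      ext x
      simp [shN]
    rw [e, hμ.2, Finset.prod_map]
    simp

end Bern

/-! ### Part 12: asymptotics of the averages -/

section Asym
variable {κ : ℕ} {p : Fin κ → ℝ} {μ : Measure (Sig κ)} {B : Sig κ → SL2} {C H K θ r : ℝ}

/-- averaged logarithmic norm -/
def av (μ : Measure (Sig κ)) (B : Sig κ → SL2) (n : ℕ) : ℝ := ∫ x, Real.log (nm (cocycleN B n x)) ∂μ

lemma lyap_eq (μ : Measure (Sig κ)) (B : Sig κ → SL2) :
    lyap μ B = ⨅ n : {m : ℕ // 0 < m}, (((n : ℕ) : ℝ))⁻¹ * av μ B n := rfl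

lemma HB.cont (D : HB B C H K θ r) : Continuous (fun x => toEuc (B x)) := by
  rw [continuous_iff_continuousAt]
  intro x0
  rw [ContinuousAt, Metric.tendsto_nhds]
  intro ε hε
  have hlim := (tendsto_pow_atTop_nhds_zero_of_lt_one D.r0.le D.r1).const_mul H
  rw [mul_zero] at hlim
  obtain ⟨N, hN⟩ := (hlim.eventually_lt_const hε).exists
  have h1 : ∀ᶠ x in nhds x0, ∀ k ∈ Finset.Ioo (-(N : ℤ)) N, x k = x0 k := by
    rw [Finset.eventually_all]
    intro k _
    have := (continuous_apply (A := fun _ : ℤ => Fin κ) k).continuousAt (x := x0)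
    exact this (show ({x0 k} : Set (Fin κ)) ∈ nhds (x0 k) from mem_nhds_discrete.mpr rfl)
  filter_upwards [h1] with x hx
  rw [dist_eq_norm]
  exact (D.hol N x x0 fun k h1 h2 => hx k (Finset.mem_Ioo.mpr ⟨h1, h2⟩)).trans_lt hN

lemma shift_cont : Continuous (shift : Sig κ → Sig κ) :=
  continuous_pi fun k => continuous_apply _

lemma HB.cont_n (D : HB B C H K θ r) (n : ℕ) : Continuous (fun x => toEuc (cocycleN B n x)) := by
  induction n with
  | zero => simp only [cocycleN]; exact continuous_const
  | succ n ih =>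
    simp only [cocycleN, toEuc_mul]
    exact (ih.comp shift_cont).mul D.cont

lemma nm_coc_le (hC : 1 ≤ C) (hB : ∀ x, nm (B x) ≤ C) (n : ℕ) (x : Sig κ) : nm (cocycleN B n x) ≤ C ^ n := by
  induction n generalizing x with
  | zero => simp [cocycleN, nm_one]
  | succ n ih =>
    simp only [cocycleN]
    rw [pow_succ]
    exact (nm_mul _ _).trans (mul_le_mul (ih _) (hB x) (nm_nonneg _) (by positivity))

lemma log_nm_nonneg (g : SL2) : 0 ≤ Real.log (nm g) := Real.log_nonneg (one_le_nm g)

lemma HB.integrable [IsProbabilityMeasure μ] (D : HB B C H K θ r) (n : ℕ) :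
    Integrable (fun x => Real.log (nm (cocycleN B n x))) μ := by
  have hc : Continuous (fun x => Real.log (nm (cocycleN B n x))) := by
    refine Continuous.log ?_ (fun x => (nm_pos _).ne')
    exact (D.cont_n n).norm
  refine Integrable.of_bound hc.measurable.aestronglyMeasurable (Real.log (C ^ n))
    (Filter.Eventually.of_forall fun x => ?_)
  rw [Real.norm_of_nonneg (log_nm_nonneg _)]
  exact Real.log_le_log (nm_pos _) (nm_coc_le D.C1 D.bd n x)

lemma av_nonneg (n : ℕ) : 0 ≤ av μ B n := integral_nonneg fun _ => log_nm_nonneg _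

lemma HB.subadd (D : HB B C H K θ r) (hμ : IsBernoulli p μ) : Subadditive (av μ B) := by
  have := hμ.1
  intro m n
  have mp := shN_mp hμ n
  have e : ∫ x, Real.log (nm (cocycleN B m (shN n x))) ∂μ = av μ B m := by
    have h2 := integral_map (μ := μ) (φ := shN n) mp.1.aemeasurable
      (f := fun x => Real.log (nm (cocycleN B m x))) (by
        rw [mp.2]; exact (D.integrable m).aestronglyMeasurable)
    rw [mp.2] at h2
    exact h2.symm
  have i1 : Integrable (fun x => Real.log (nm (cocycleN B m (shN n x)))) μ :=
    mp.integrable_comp_of_integrable (D.integrable m)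
  rw [← e]
  unfold av
  rw [← integral_add i1 (D.integrable n)]
  refine integral_mono (D.integrable _) (i1.add (D.integrable n)) fun x => ?_
  simp only [Pi.add_apply]
  rw [cocycleN_add, ← Real.log_mul (nm_pos _).ne' (nm_pos _).ne']
  exact Real.log_le_log (nm_pos _) (nm_mul _ _)

lemma lyap_bdd (μ : Measure (Sig κ)) (B : Sig κ → SL2) :
    BddBelow (Set.range fun n : {m : ℕ // 0 < m} => (((n : ℕ) : ℝ))⁻¹ * av μ B n) :=
  ⟨0, by rintro _ ⟨n, rfl⟩; exact mul_nonneg (by positivity) (av_nonneg _)⟩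

lemma lyap_nonneg (μ : Measure (Sig κ)) (B : Sig κ → SL2) : 0 ≤ lyap μ B := by
  rw [lyap_eq]
  haveI : Nonempty {m : ℕ // 0 < m} := ⟨⟨1, one_pos⟩⟩
  exact le_ciInf fun n => mul_nonneg (by positivity) (av_nonneg _)

lemma lyap_le (μ : Measure (Sig κ)) (B : Sig κ → SL2) (n : ℕ) : n * lyap μ B ≤ av μ B n := by
  rcases Nat.eq_zero_or_pos n with rfl | hn
  · simp only [Nat.cast_zero, zero_mul]; exact av_nonneg _
  · have h := ciInf_le (lyap_bdd μ B) ⟨n, hn⟩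
    rw [← lyap_eq] at h
    have hn' : (0 : ℝ) < n := by exact_mod_cast hn
    calc (n : ℝ) * lyap μ B ≤ n * ((n : ℝ)⁻¹ * av μ B n) := mul_le_mul_of_nonneg_left h hn'.le
      _ = av μ B n := by field_simp

lemma HB.av_up (D : HB B C H K θ r) (hμ : IsBernoulli p μ) {ε : ℝ} (hε : 0 < ε) :
    ∃ n0 : ℕ, ∀ n ≥ n0, av μ B n ≤ n * (lyap μ B + ε) := by
  have hs := D.subadd hμ
  have hbdd : BddBelow (Set.range fun n => av μ B n / n) :=
    ⟨0, by rintro _ ⟨n, rfl⟩; exact div_nonneg (av_nonneg _) (by positivity)⟩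
  have ht := hs.tendsto_lim hbdd
  have hle : hs.lim ≤ lyap μ B := by
    rw [lyap_eq]
    haveI : Nonempty {m : ℕ // 0 < m} := ⟨⟨1, one_pos⟩⟩
    refine le_ciInf fun n => ?_
    have := hs.lim_le_div hbdd (n := n) n.2.ne'
    rwa [div_eq_inv_mul] at this
  have h1 := ht.eventually_lt_const (show hs.lim < lyap μ B + ε by linarith)
  obtain ⟨n0, h2⟩ := Filter.eventually_atTop.mp h1
  refine ⟨n0 + 1, fun n hn => ?_⟩
  have hn' : (0 : ℝ) < n := by exact_mod_cast (show 0 < n by omega)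
  have := h2 n (by omega)
  rw [div_lt_iff₀ hn'] at this
  linarith

/-- the comparison constant -/
def c3 (C H K θ r : ℝ) : ℝ := 3 * Real.log (1 + c1 C H K θ r)

lemma HB.chain (D : HB B C H K θ r) (n : ℕ) (x x' : Sig κ) (h : ∀ k : ℤ, 0 ≤ k → k < n → x k = x' k) :
    nm (cocycleN B n x) ≤ (1 + c1 C H K θ r) * (1 + c1 C H K θ r) * nm (cocycleN B n x') := by
  have hc0 := D.c10
  set X : Sig κ := fun k => if 0 ≤ k then x k else x' k with hX
  have hs := D.stab_gd_one (X := x) (X' := X) (fun k hk => by simp [hX, hk]) n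
  have hu := D.unst n 0 (X := x') (X' := X) (fun k hk => by
    simp only [hX]
    split_ifs with h0
    · exact (h k h0 (by simpa using hk)).symm
    · rfl)
  rw [pow_zero, mul_one] at hu
  have e1 : cocycleN B n x = cocycleN B n X * Hm B x X n := by unfold Hm; group
  have e2 : cocycleN B n X = (cocycleN B n X * (cocycleN B n x')⁻¹) * cocycleN B n x' := by group
  have h1 : nm (cocycleN B n x) ≤ nm (cocycleN B n X) * (1 + c1 C H K θ r) := by
    rw [e1]
    exact (nm_mul _ _).trans (mul_le_mul_of_nonneg_left hs (nm_nonneg _))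
  have h2 : nm (cocycleN B n X) ≤ (1 + c1 C H K θ r) * nm (cocycleN B n x') := by
    rw [e2]
    refine (nm_mul _ _).trans (mul_le_mul_of_nonneg_right ?_ (nm_nonneg _))
    have := nm_le_gd (cocycleN B n X * (cocycleN B n x')⁻¹) 1
    rw [nm_one] at this
    linarith
  have h3 := mul_le_mul_of_nonneg_right h2 (show 0 ≤ 1 + c1 C H K θ r by linarith)
  linarith

lemma glue_ext (a : Fin κ) (n : ℕ) (x : Sig κ) (y : Y κ) (k : ℤ) (h0 : 0 ≤ k) (hk : k < n) :
    x k = ext a (glue n x y) k := by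
  simp only [ext, glue]
  rw [if_pos h0, if_pos (by omega)]
  congr 1
  omega

lemma HB.compare (D : HB B C H K θ r) (hp : PV p) (hμ : IsBernoulli p μ) (a : Fin κ) (n : ℕ) (y : Y κ) :
    |av μ B n - Pn p n (fun z => Real.log (nm (hc (hB a B) n z))) y| ≤ c3 C H K θ r := by
  have := hμ.1
  have hc0 := D.c10
  rw [← glue_integral hp hμ]
  unfold av
  have i2 := glue_int (μ := μ) (fun z => Real.log (nm (hc (hB a B) n z))) n y
  rw [← integral_sub (D.integrable n) i2, ← Real.norm_eq_abs]
  have key : ∀ x, ‖Real.log (nm (cocycleN B n x)) - Real.log (nm (hc (hB a B) n (glue n x y)))‖ ≤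
      c3 C H K θ r := by
    intro x
    have g := fun k h0 hk => glue_ext a n x y k h0 hk
    have f1 := D.chain n x _ g
    have f2 := D.chain n _ x (fun k h0 hk => (g k h0 hk).symm)
    have f3 := D.nm_hc_le a n (glue n x y)
    have f4 := D.le_nm_hc a n (glue n x y)
    have hc1 : 0 < 1 + c1 C H K θ r := by linarith
    set c := 1 + c1 C H K θ r with hcdef
    have q1 : nm (cocycleN B n x) ≤ c ^ 3 * nm (hc (hB a B) n (glue n x y)) := by
      calc _ ≤ _ := f1
        _ ≤ c * c * (c * nm (hc (hB a B) n (glue n x y))) := mul_le_mul_of_nonneg_left f4 (by positivity)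
        _ = _ := by ring
    have q2 : nm (hc (hB a B) n (glue n x y)) ≤ c ^ 3 * nm (cocycleN B n x) := by
      calc _ ≤ _ := f3
        _ ≤ c * (c * c * nm (cocycleN B n x)) := mul_le_mul_of_nonneg_left f2 (by positivity)
        _ = _ := by ring
    have l1 := Real.log_le_log (nm_pos _) q1
    have l2 := Real.log_le_log (nm_pos _) q2
    rw [Real.log_mul (by positivity) (nm_pos _).ne', Real.log_pow] at l1 l2
    unfold c3
    rw [Real.norm_eq_abs, abs_le]
    push_cast at l1 l2
    constructor <;> linarith
  have := norm_integral_le_of_norm_le_const (μ := μ) (Filter.Eventually.of_forall key)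
  simpa using this

end Asym

/-! ### Part 13: uniform constants and conclusion -/

section Fin13
variable {κ : ℕ} {p : Fin κ → ℝ} {μ : Measure (Sig κ)} {A B : Sig κ → SL2} {ζ γ : ℝ}

lemma opNorm_sub_eq (g h : SL2) : opNorm ((g : Mat2) - (h : Mat2)) = gd g h := by
  unfold opNorm gd toEuc; rw [map_sub]

lemma opNorm_nonneg (M : Mat2) : 0 ≤ opNorm M := norm_nonneg _

lemma opNorm_add (M N : Mat2) : opNorm (M + N) ≤ opNorm M + opNorm N := by
  unfold opNorm; rw [map_add]; exact norm_add_le _ _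

lemma opNorm_neg (M : Mat2) : opNorm (-M) = opNorm M := by
  unfold opNorm; rw [map_neg]; exact norm_neg _

lemma firstDiff_ge {x x' : Sig κ} (hne : x ≠ x') {N : ℕ} (h : SA N x x') : N ≤ firstDiff x x' := by
  have hn : ({m : ℕ | x (m : ℤ) ≠ x' (m : ℤ) ∨ x (-(m : ℤ)) ≠ x' (-(m : ℤ))}).Nonempty := by
    by_contra hem
    rw [Set.not_nonempty_iff_eq_empty] at hem
    apply hne
    funext k
    by_contra hk
    have : k.natAbs ∈ ({m : ℕ | x (m : ℤ) ≠ x' (m : ℤ) ∨ x (-(m : ℤ)) ≠ x' (-(m : ℤ))}) := by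
      rcases le_total 0 k with h0 | h0
      · left
        rwa [Int.natAbs_of_nonneg h0]
      · right
        rwa [Int.ofNat_natAbs_of_nonpos h0, neg_neg]
    rw [hem] at this
    exact this
  have hm := Nat.sInf_mem hn
  by_contra hlt
  have hlt' : firstDiff x x' < N := not_le.mp hlt
  unfold firstDiff at hlt'
  rcases hm with hm | hm
  · exact hm (h _ (by omega) (by omega))
  · exact hm (h _ (by omega) (by omega))

lemma dSig_pos (hζ : 1 < ζ) {x x' : Sig κ} (hne : x ≠ x') : 0 < dSig ζ x x' := by
  unfold dSig; rw [if_neg hne]; exact zpow_pos (by linarith) _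

lemma dSig_le (hζ : 1 < ζ) (hγ : 0 < γ) {x x' : Sig κ} (hne : x ≠ x') {N : ℕ} (h : SA N x x') :
    (dSig ζ x x') ^ γ ≤ (ζ ^ (-γ)) ^ N := by
  have h0 : 0 < ζ := by linarith
  have h1 : dSig ζ x x' ≤ ζ ^ (-(N : ℤ)) := by
    unfold dSig; rw [if_neg hne]
    have := firstDiff_ge hne h
    exact zpow_le_zpow_right₀ hζ.le (by omega)
  refine (Real.rpow_le_rpow (dSig_pos hζ hne).le h1 hγ.le).trans_eq ?_
  rw [← Real.rpow_intCast, ← Real.rpow_mul h0.le, ← Real.rpow_natCast (ζ ^ (-γ)), ← Real.rpow_mul h0.le]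
  congr 1
  push_cast
  ring

lemma close_bounds (hκ : 2 ≤ κ) (hζ : 1 < ζ) {δ : ℝ} (h : CgammaClose ζ γ A B δ) :
    ∃ C₂ : ℝ, C₂ < δ ∧ (∀ x, gd (B x) (A x) ≤ δ) ∧
    (∀ x y : Sig κ, x ≠ y →
      opNorm (((A x : Mat2) - (B x : Mat2)) - ((A y : Mat2) - (B y : Mat2)))
        ≤ C₂ * (dSig ζ x y) ^ γ) := by
  obtain ⟨C₁, C₂, hs, h1, h2⟩ := h
  set x : Sig κ := fun _ => ⟨0, by omega⟩ with hx
  set y : Sig κ := fun _ => ⟨1, by omega⟩ with hy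
  have hne : x ≠ y := by
    intro h
    have := congrFun h 0
    simp [hx, hy] at this
  have g1 := (opNorm_nonneg _).trans (h1 x)
  have g2 := (opNorm_nonneg _).trans (h2 x y hne)
  have g3 : 0 ≤ C₂ := nonneg_of_mul_nonneg_left g2 (Real.rpow_pos_of_pos (dSig_pos hζ hne) _)
  refine ⟨C₂, by linarith, fun x => ?_, h2⟩
  have := h1 x
  rw [opNorm_sub_eq, gd_comm] at this
  linarith

lemma close_self {δ : ℝ} (hδ : 0 < δ) : CgammaClose ζ γ A A δ := by
  have h0 : opNorm 0 = 0 := by unfold opNorm; rw [map_zero]; exact norm_zero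
  exact ⟨0, 0, by linarith, fun x => by rw [sub_self, h0], fun x y _ => by simp [h0]⟩

lemma close_mono {δ δ' : ℝ} (h : CgammaClose ζ γ A B δ) (hl : δ ≤ δ') : CgammaClose ζ γ A B δ' := by
  obtain ⟨C₁, C₂, hs, h1, h2⟩ := h
  exact ⟨C₁, C₂, by linarith, h1, h2⟩

lemma uniform (hκ : 2 ≤ κ) (hζ : 1 < ζ) (hγ : 0 < γ) (hA : HolderCocycle ζ γ A)
    (hFB : FiberBunched ζ γ A) :
    ∃ δ0 C H K θ r : ℝ, 0 < δ0 ∧ ∀ B, CgammaClose ζ γ A B δ0 → HB B C H K θ r := by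
  obtain ⟨HA, hHA⟩ := hA
  obtain ⟨n0, hn0, c, hc, hgr⟩ := hFB
  have hζ0 : 0 < ζ := by linarith
  set r := ζ ^ (-γ) with hr
  have hr0 : 0 < r := Real.rpow_pos_of_pos hζ0 _
  have hHol : ∀ N x x', SA N x x' → gd (A x) (A x') ≤ |HA| * r ^ N := by
    intro N x x' h
    by_cases hne : x = x'
    · rw [hne, gd_self]; positivity
    · have h1 := hHA x x' hne
      rw [opNorm_sub_eq] at h1
      have h2 := Real.rpow_nonneg (dSig_pos hζ hne).le γ
      calc _ ≤ _ := h1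
        _ ≤ |HA| * dSig ζ x x' ^ γ := mul_le_mul_of_nonneg_right (le_abs_self _) h2
        _ ≤ _ := mul_le_mul_of_nonneg_left (dSig_le hζ hγ hne h) (abs_nonneg _)
  set x0 : Sig κ := fun _ => ⟨0, by omega⟩ with hx0
  set CA := nm (A x0) + |HA| with hCA
  have hCA1 : 1 ≤ CA := by have := one_le_nm (A x0); have := abs_nonneg HA; linarith
  have hAbd : ∀ x, nm (A x) ≤ CA := by
    intro x
    have h1 := hHol 0 x x0 (fun k h1 h2 => by push_cast at h1 h2; omega)
    have h2 := nm_le_gd (A x) (A x0)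
    rw [pow_zero, mul_one] at h1
    linarith
  set C := CA + 1 with hC
  have hC1 : 1 ≤ C := by linarith
  obtain ⟨E, hE, hcl⟩ := cocycle_close (κ := κ) n0 C hC1
  set R := ζ ^ ((n0 : ℝ) * γ) with hR
  have hc1 : 1 ≤ c := by
    have h1 : nm (cocycleN A n0 x0) ^ 2 ≤ c := hgr x0
    have h2 := one_le_nm (cocycleN A n0 x0)
    nlinarith
  set F := E * (2 * C ^ n0 + E) + 1 with hF
  have hFpos : 0 < F := by positivity
  set δ0 := min 1 ((R - c) / 2 / F) with hδ0
  have hδpos : 0 < δ0 := lt_min one_pos (div_pos (by linarith) hFpos)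
  have hδ1 : δ0 ≤ 1 := min_le_left _ _
  have hδF : F * δ0 ≤ (R - c) / 2 := by
    have : δ0 ≤ (R - c) / 2 / F := min_le_right _ _
    rw [le_div_iff₀ hFpos] at this
    linarith
  set c' := (c + R) / 2 with hc'
  have hc'1 : 1 ≤ c' := by linarith
  set θ := c' ^ ((n0 : ℝ)⁻¹) with hθ
  have hn0' : (n0 : ℝ) ≠ 0 := by exact_mod_cast hn0.ne'
  have hθpow : θ ^ n0 = c' := Real.rpow_inv_natCast_pow (by linarith) hn0.ne'
  have hθ1 : 1 ≤ θ := Real.one_le_rpow hc'1 (by positivity)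
  have hθr : θ * r < 1 := by
    have h1 : (θ * r) ^ n0 < 1 := by
      have h2 : r ^ n0 = R⁻¹ := by
        rw [hr, hR, ← Real.rpow_natCast, ← Real.rpow_mul hζ0.le, ← Real.rpow_neg hζ0.le]
        congr 1; ring
      rw [mul_pow, hθpow, h2, ← div_eq_mul_inv, div_lt_one (by linarith)]
      linarith
    exact (pow_lt_one_iff_of_nonneg (by positivity) hn0.ne').mp h1
  refine ⟨δ0, C, |HA| + 1, C ^ (2 * n0), θ, r, hδpos, fun B hB => ?_⟩
  obtain ⟨C₂, hC₂, hd, hh⟩ := close_bounds hκ hζ hB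
  have hBbd : ∀ x, nm (B x) ≤ C := by
    intro x
    have := nm_le_gd (B x) (A x)
    have := hd x; have := hAbd x
    linarith
  have hBn : ∀ x, nm (cocycleN B n0 x) ^ 2 ≤ c' := by
    intro x
    obtain ⟨k1, k2⟩ := hcl A B δ0 hδpos.le (fun x => by linarith [hAbd x]) hBbd hd x
    have k3 := nm_le_gd (cocycleN B n0 x) (cocycleN A n0 x)
    have k4 : nm (cocycleN A n0 x) ^ 2 ≤ c := hgr x
    have k5 := nm_nonneg (cocycleN A n0 x)
    have k6 : nm (cocycleN B n0 x) ^ 2 ≤ (nm (cocycleN A n0 x) + E * δ0) ^ 2 :=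
      pow_le_pow_left₀ (nm_nonneg _) (by linarith) 2
    have k7 : E * δ0 * nm (cocycleN A n0 x) ≤ E * δ0 * C ^ n0 :=
      mul_le_mul_of_nonneg_left k2 (by positivity)
    have k8 : E * E * δ0 * δ0 ≤ E * E * δ0 * 1 := mul_le_mul_of_nonneg_left hδ1 (by positivity)
    have k9 : F * δ0 = 2 * (E * δ0 * C ^ n0) + E * E * δ0 + δ0 := by rw [hF]; ring
    nlinarith
  have hKpos : 0 < C ^ (2 * n0) := by positivity
  refine ⟨hBbd, fun k => ?_, ?_, hC1, by positivity, hKpos, hθ1, hr0, hθr⟩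
  · induction k using Nat.strong_induction_on with
    | _ k ih =>
      intro x
      by_cases hk : k < n0
      · have h1 := nm_coc_le hC1 hBbd k x
        calc nm (cocycleN B k x) ^ 2 ≤ (C ^ k) ^ 2 := pow_le_pow_left₀ (nm_nonneg _) h1 2
          _ = C ^ (2 * k) := by rw [← pow_mul, mul_comm]
          _ ≤ C ^ (2 * n0) := pow_le_pow_right₀ hC1 (by omega)
          _ ≤ C ^ (2 * n0) * θ ^ k := le_mul_of_one_le_right hKpos.le (one_le_pow₀ hθ1)
      · obtain ⟨l, rfl⟩ := Nat.exists_eq_add_of_le (not_lt.mp hk)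
        rw [Nat.add_comm, cocycleN_add]
        have h1 := ih l (by omega) (shN n0 x)
        have h2 := hBn x
        calc nm (cocycleN B l (shN n0 x) * cocycleN B n0 x) ^ 2
            ≤ (nm (cocycleN B l (shN n0 x)) * nm (cocycleN B n0 x)) ^ 2 :=
              pow_le_pow_left₀ (nm_nonneg _) (nm_mul _ _) 2
          _ = nm (cocycleN B l (shN n0 x)) ^ 2 * nm (cocycleN B n0 x) ^ 2 := mul_pow _ _ _
          _ ≤ (C ^ (2 * n0) * θ ^ l) * c' := mul_le_mul h1 h2 (sq_nonneg _) (by positivity)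
          _ = _ := by rw [pow_add, hθpow]; ring
  · intro N x x' h
    by_cases hne : x = x'
    · rw [hne, gd_self]; positivity
    · have h1 := hh x x' hne
      have h2 := Real.rpow_nonneg (dSig_pos hζ hne).le γ
      have h3 := dSig_le hζ hγ hne h
      have h4 := hHol N x x' h
      rw [← opNorm_sub_eq] at h4 ⊢
      have e : (B x : Mat2) - (B x' : Mat2) = ((A x : Mat2) - (A x' : Mat2)) +
          -(((A x : Mat2) - (B x : Mat2)) - ((A x' : Mat2) - (B x' : Mat2))) := by abel
      have h5 := opNorm_add ((A x : Mat2) - (A x' : Mat2))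
          (-(((A x : Mat2) - (B x : Mat2)) - ((A x' : Mat2) - (B x' : Mat2))))
      rw [← e, opNorm_neg] at h5
      have h6 : C₂ * dSig ζ x x' ^ γ ≤ 1 * dSig ζ x x' ^ γ :=
        mul_le_mul_of_nonneg_right (by linarith) h2
      rw [add_mul]
      linarith

end Fin13

theorem backes_brown_butler_continuity {κ : ℕ} (hκ : 2 ≤ κ) (p : Fin κ → ℝ)
    (hp : ∀ i, 0 < p i) (hp1 : ∑ i, p i = 1)
    (μ : Measure (Sig κ)) (hμ : IsBernoulli p μ)
    (ζ : ℝ) (hζ : 1 < ζ) (γ : ℝ) (hγ : 0 < γ)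
    (A : Sig κ → SL2) (hA : HolderCocycle ζ γ A) (hFB : FiberBunched ζ γ A) :
    ∀ ε : ℝ, 0 < ε → ∃ δ : ℝ, 0 < δ ∧
      ∀ B : Sig κ → SL2, HolderCocycle ζ γ B → FiberBunched ζ γ B →
        CgammaClose ζ γ A B δ → |lyap μ B - lyap μ A| < ε := by
  intro ε hε
  have pv : PV p := ⟨hp, hp1⟩
  have hpr := hμ.1
  obtain ⟨δ0, C, H, K, θ, r, hδ0, hun⟩ := uniform hκ hζ hγ hA hFB
  have DA := hun A (close_self hδ0)
  -- upper semicontinuity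
  obtain ⟨δ1, hδ1, hup⟩ : ∃ δ1 > 0, ∀ B, CgammaClose ζ γ A B δ0 → (∀ x, gd (B x) (A x) ≤ δ1) →
      lyap μ B < lyap μ A + ε := by
    obtain ⟨n0, hn⟩ := DA.av_up hμ (show 0 < ε / 2 by linarith)
    have hn1 := hn (n0 + 1) (by omega)
    obtain ⟨E, hE, hcl⟩ := cocycle_close (κ := κ) (n0 + 1) C DA.C1
    refine ⟨ε / 4 / (E + 1), by positivity, fun B hB hd => ?_⟩
    have DB := hun B hB
    set δ1 := ε / 4 / (E + 1) with hδ1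
    have hδ1pos : 0 < δ1 := by positivity
    have hEδ : E * δ1 ≤ ε / 4 := by
      have : (E + 1) * δ1 = ε / 4 := by rw [hδ1]; field_simp
      linarith
    have h1 : av μ B (n0 + 1) ≤ av μ A (n0 + 1) + E * δ1 := by
      unfold av
      have : ∫ x, (Real.log (nm (cocycleN A (n0 + 1) x)) + E * δ1) ∂μ =
          ∫ x, Real.log (nm (cocycleN A (n0 + 1) x)) ∂μ + E * δ1 := by
        rw [integral_add (DA.integrable _) (integrable_const _)]; simp
      rw [← this]
      refine integral_mono (DB.integrable _) ((DA.integrable _).add (integrable_const _)) fun x => ?_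
      obtain ⟨k1, -⟩ := hcl A B δ1 hδ1pos.le DA.bd DB.bd hd x
      have k2 := nm_le_gd (cocycleN B (n0 + 1) x) (cocycleN A (n0 + 1) x)
      have k3 := one_le_nm (cocycleN A (n0 + 1) x)
      have k4 : nm (cocycleN B (n0 + 1) x) ≤ nm (cocycleN A (n0 + 1) x) * Real.exp (E * δ1) := by
        have := Real.add_one_le_exp (E * δ1)
        have h0 : 0 ≤ E * δ1 := by positivity
        nlinarith
      have k5 := Real.log_le_log (nm_pos _) k4
      rwa [Real.log_mul (nm_pos _).ne' (Real.exp_pos _).ne', Real.log_exp] at k5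
    have h2 := lyap_le μ B (n0 + 1)
    have hN : (1 : ℝ) ≤ ((n0 + 1 : ℕ) : ℝ) := by push_cast; linarith [Nat.cast_nonneg (α := ℝ) n0]
    have h3 : ((n0 + 1 : ℕ) : ℝ) * lyap μ B < ((n0 + 1 : ℕ) : ℝ) * (lyap μ A + ε) := by
      nlinarith
    exact lt_of_mul_lt_mul_left h3 (by linarith)
  -- lower semicontinuity
  obtain ⟨δ2, hδ2, hlow⟩ : ∃ δ2 > 0, ∀ B, CgammaClose ζ γ A B δ0 → (∀ x, gd (B x) (A x) ≤ δ2) →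
      lyap μ A - ε < lyap μ B := by
    by_contra hcon
    push Not at hcon
    set a : Fin κ := ⟨0, by omega⟩ with ha
    have y0 : Y κ := fun _ => a
    have hex : ∀ j : ℕ, ∃ B, CgammaClose ζ γ A B δ0 ∧ lyap μ B ≤ lyap μ A - ε ∧
        ∀ y, gd (hB a B y) (hB a A y) ≤ 1 / ((j : ℝ) + 1) := by
      intro j
      obtain ⟨e0, he0, hh⟩ := hB_close (C := C) (H := H) (K := K) a DA.C1
        (show (0 : ℝ) < 1 / ((j : ℝ) + 1) by positivity) DA.ρ0 DA.ρ1
      obtain ⟨B, h1, h2, h3⟩ := hcon e0 he0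
      exact ⟨B, h1, h3, hh A B DA (hun B h1) h2⟩
    choose Bs hB1 hB2 hB3 using hex
    have hLpos : 0 < lyap μ A := by linarith [lyap_nonneg μ (Bs 0), hB2 0]
    set c := c3 C H K θ r with hcdef
    have hc0 : 0 ≤ c := (abs_nonneg _).trans (DA.compare pv hμ a 0 y0)
    have hex2 : ∀ j : ℕ, ∃ n : ℕ, j < n ∧
        Pn p n (fun z => Real.log (nm (hc (hB a (Bs j)) n z))) y0 ≤ n * (lyap μ A - ε / 4) := by
      intro j
      have D := hun _ (hB1 j)
      obtain ⟨n0, hn⟩ := D.av_up hμ (show 0 < ε / 2 by linarith)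
      obtain ⟨n1, hn1⟩ := exists_nat_gt (c / (ε / 4))
      set n := n0 + n1 + j + 1 with hndef
      refine ⟨n, by omega, ?_⟩
      have h1 := hn n (by omega)
      have h2 := (abs_le.mp (D.compare pv hμ a n y0)).1
      have h3 : c ≤ n * (ε / 4) := by
        rw [div_lt_iff₀ (by linarith)] at hn1
        have : (n1 : ℝ) ≤ n := by exact_mod_cast (show n1 ≤ n by omega)
        nlinarith
      have h4 : (n : ℝ) * (lyap μ (Bs j) + ε / 2) ≤ n * (lyap μ A - ε + ε / 2) :=
        mul_le_mul_of_nonneg_left (by linarith [hB2 j]) (Nat.cast_nonneg _)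
      linarith
    choose ns hns hPn using hex2
    have LDd : LD p (fun j => hB a (Bs j)) (hB a A) ((1 + c1 C H K θ r) * C) (om C H K θ r)
        (fun j => 1 / ((j : ℝ) + 1)) ns :=
      { pv := pv
        good := fun j => (hun _ (hB1 j)).good a
        goodg := DA.good a
        conv := fun j z => hB3 j z
        δlim := tendsto_one_div_add_atTop_nhds_zero_nat
        ωlim := DA.om_lim
        nlarge := hns }
    have G : Gr p (hB a A) (lyap μ A) c :=
      { pos := hLpos
        low := fun n y => by
          have h1 := (abs_le.mp (DA.compare pv hμ a n y)).2
          have h2 := lyap_le μ A n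
          linarith
        up := fun e he => by
          obtain ⟨n0, hn⟩ := DA.av_up hμ (show 0 < e / 2 by linarith)
          obtain ⟨n1, hn1⟩ := exists_nat_gt (c / (e / 2))
          refine ⟨n0 + n1, fun n hn' y => ?_⟩
          have h1 := hn n (by omega)
          have h2 := (abs_le.mp (DA.compare pv hμ a n y)).1
          have h3 : c ≤ n * (e / 2) := by
            rw [div_lt_iff₀ (by linarith)] at hn1
            have : (n1 : ℝ) ≤ n := by exact_mod_cast (show n1 ≤ n by omega)
            nlinarith
          linarith }
    exact abstract_main LDd G (show 0 < ε / 4 by linarith) y0 hPn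
  refine ⟨min δ0 (min δ1 δ2), lt_min hδ0 (lt_min hδ1 hδ2), fun B _ _ hB => ?_⟩
  have hB0 := close_mono hB (min_le_left _ _)
  obtain ⟨-, -, hd, -⟩ := close_bounds hκ hζ hB
  have u := hup B hB0 fun x => (hd x).trans ((min_le_right _ _).trans (min_le_left _ _))
  have l := hlow B hB0 fun x => (hd x).trans ((min_le_right _ _).trans (min_le_right _ _))
  rw [abs_lt]
  constructor <;> linarith
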